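/- arXiv:1510.08086 — 2 statements merged into one kernel-verified Lean document; each statement's English description precedes it below -/
import Mathlib

section
/- Let H be a congruence class group of K. For every ε > 0, h_H ≤ e^{O_ε(n_K)} · D_K^{1/2+ε} · Q^{1+ε}. -/
open scoped BigOperators
open Complex NumberField Filter Topology

noncomputable section

namespace RTZ

/-- The degree `n_K = [K : ℚ]` of a number field. -/
def nK (K : Type*) [Field K] [NumberField K] : ℕ := Module.finrank ℚ K

/-- The absolute value `D_K` of the discriminant of `K`. -/
def DK (K : Type*) [Field K] [NumberField K] : ℕ := (NumberField.discr K).natAbs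

/-- An algebraic integer is totally positive if it is positive under every real embedding. -/
def TotPos (K : Type*) [Field K] [NumberField K] (α : 𝓞 K) : Prop :=
  ∀ φ : K →+* ℝ, 0 < φ (algebraMap (𝓞 K) K α)

/-- A Hecke (narrow ray class) character modulo `𝔮`, regarded as a function on integral
ideals extended by zero: it is completely multiplicative, vanishes on ideals not coprime
to `𝔮`, has modulus one on ideals coprime to `𝔮`, and is trivial on principal ideals
generated by totally positive elements `α ≡ 1 (mod 𝔮)`. -/
structure HeckeChar (K : Type*) [Field K] [NumberField K] (𝔮 : Ideal (𝓞 K)) where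
  toFun : Ideal (𝓞 K) → ℂ
  map_mul' : ∀ 𝔞 𝔟 : Ideal (𝓞 K), toFun (𝔞 * 𝔟) = toFun 𝔞 * toFun 𝔟
  eq_zero' : ∀ 𝔞 : Ideal (𝓞 K), ¬ IsCoprime 𝔞 𝔮 → toFun 𝔞 = 0
  norm_one' : ∀ 𝔞 : Ideal (𝓞 K), IsCoprime 𝔞 𝔮 → ‖toFun 𝔞‖ = 1
  ray_one' : ∀ α : 𝓞 K, TotPos K α → α - 1 ∈ 𝔮 → toFun (Ideal.span {α}) = 1

variable {K : Type*} [Field K] [NumberField K]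

/-- The trivial (principal) Hecke character condition. -/
def IsTrivialChar {𝔮 : Ideal (𝓞 K)} (χ : HeckeChar K 𝔮) : Prop :=
  ∀ 𝔞, IsCoprime 𝔞 𝔮 → χ.toFun 𝔞 = 1

open scoped Classical in
/-- `δ(χ)`: the indicator of the trivial character. -/
def delta {𝔮 : Ideal (𝓞 K)} (χ : HeckeChar K 𝔮) : ℝ :=
  if IsTrivialChar χ then 1 else 0

/-- `χ' (mod 𝔣)` induces `χ (mod 𝔮)`: `𝔣 ∣ 𝔮` and the two characters agree on ideals
coprime to `𝔮`. -/
def Induces {𝔣 𝔮 : Ideal (𝓞 K)} (χ' : HeckeChar K 𝔣) (χ : HeckeChar K 𝔮) : Prop :=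
  𝔮 ≤ 𝔣 ∧ ∀ 𝔞, IsCoprime 𝔞 𝔮 → χ.toFun 𝔞 = χ'.toFun 𝔞

/-- `𝔣` is the conductor `𝔣_χ` of `χ`: `χ` is induced from a character mod `𝔣`, and `𝔣`
divides every modulus from which `χ` is induced. -/
def IsConductor {𝔮 : Ideal (𝓞 K)} (χ : HeckeChar K 𝔮) (𝔣 : Ideal (𝓞 K)) : Prop :=
  (∃ χ' : HeckeChar K 𝔣, Induces χ' χ) ∧
    ∀ 𝔣' : Ideal (𝓞 K), (∃ χ' : HeckeChar K 𝔣', Induces χ' χ) → 𝔣' ≤ 𝔣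

/-- A Hecke character is primitive if its conductor equals its modulus. -/
def IsPrimitiveChar {𝔮 : Ideal (𝓞 K)} (χ : HeckeChar K 𝔮) : Prop := IsConductor χ 𝔮

/-- Two integral ideals lie in the same narrow ray class mod `𝔮`: `(α)𝔞 = (β)𝔟` for some
totally positive `α, β ≡ 1 (mod 𝔮)`. -/
def rayEquiv (𝔮 𝔞 𝔟 : Ideal (𝓞 K)) : Prop :=
  ∃ α β : 𝓞 K, TotPos K α ∧ TotPos K β ∧ α - 1 ∈ 𝔮 ∧ β - 1 ∈ 𝔮 ∧
    Ideal.span {α} * 𝔞 = Ideal.span {β} * 𝔟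

/-- A congruence class group `H (mod 𝔮)`: a subgroup of `I(𝔮)` containing `P_𝔮`, described
by the set of integral ideals whose narrow ray class lies in the subgroup. -/
structure CongClassGroup (K : Type*) [Field K] [NumberField K] (𝔮 : Ideal (𝓞 K)) where
  mem : Ideal (𝓞 K) → Prop
  coprime' : ∀ 𝔞, mem 𝔞 → IsCoprime 𝔞 𝔮
  princ_mem' : ∀ α : 𝓞 K, TotPos K α → α - 1 ∈ 𝔮 → mem (Ideal.span {α})
  mul_mem' : ∀ 𝔞 𝔟, mem 𝔞 → mem 𝔟 → mem (𝔞 * 𝔟)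
  class_mem' : ∀ 𝔞 𝔟, IsCoprime 𝔟 𝔮 → rayEquiv 𝔮 𝔞 𝔟 → mem 𝔞 → mem 𝔟

/-- `χ(H) = 1`: the character is trivial on the congruence class group `H`. -/
def CharTrivOn {𝔮 : Ideal (𝓞 K)} (χ : HeckeChar K 𝔮) (H : CongClassGroup K 𝔮) : Prop :=
  ∀ 𝔞, H.mem 𝔞 → χ.toFun 𝔞 = 1

/-- The coset of `H` in `I(𝔮)` determined by an integral ideal `𝔞₀`. -/
def coset {𝔮 : Ideal (𝓞 K)} (H : CongClassGroup K 𝔮) (𝔞₀ : Ideal (𝓞 K)) :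
    Set (Ideal (𝓞 K)) :=
  {𝔞 | ∃ 𝔥, H.mem 𝔥 ∧ rayEquiv 𝔮 (𝔞₀ * 𝔥) 𝔞}

/-- `h_H = [I(𝔮) : H]`, the number of cosets of `H`. -/
def hH {𝔮 : Ideal (𝓞 K)} (H : CongClassGroup K 𝔮) : ℕ :=
  Nat.card {C : Set (Ideal (𝓞 K)) // ∃ 𝔞₀, IsCoprime 𝔞₀ 𝔮 ∧ C = coset H 𝔞₀}

/-- `Q = Q_H = max { N𝔣_χ : χ (mod 𝔮), χ(H) = 1 }`. -/
def QH {𝔮 : Ideal (𝓞 K)} (H : CongClassGroup K 𝔮) : ℕ :=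
  sSup {n | ∃ (χ : HeckeChar K 𝔮) (𝔣 : Ideal (𝓞 K)),
    CharTrivOn χ H ∧ IsConductor χ 𝔣 ∧ n = Ideal.absNorm 𝔣}

/-- `𝔣_H = lcm { 𝔣_χ : χ(H) = 1 }` (the lcm of ideals is their infimum). -/
def fH {𝔮 : Ideal (𝓞 K)} (H : CongClassGroup K 𝔮) : Ideal (𝓞 K) :=
  sInf {𝔣 | ∃ χ : HeckeChar K 𝔮, CharTrivOn χ H ∧ IsConductor χ 𝔣}

/-- A congruence class group `H (mod 𝔮)` is primitive if `𝔮 = 𝔣_H`. -/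
def IsPrimitiveCCG {𝔮 : Ideal (𝓞 K)} (H : CongClassGroup K 𝔮) : Prop := 𝔮 = fH H

/-- The Dirichlet series `Σ_𝔫 χ(𝔫) N𝔫^{-s}` of a Hecke character. -/
def LSer {𝔮 : Ideal (𝓞 K)} (χ : HeckeChar K 𝔮) (s : ℂ) : ℂ :=
  ∑' 𝔞 : {I : Ideal (𝓞 K) // I ≠ ⊥}, χ.toFun 𝔞.1 * (Ideal.absNorm 𝔞.1 : ℂ) ^ (-s)

/-- `L` is "the" Hecke `L`-function of `χ`: analytic away from `s = 1` and given by the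
Dirichlet series on `Re s > 1` (this determines `L` away from `s = 1`). -/
def IsLFun {𝔮 : Ideal (𝓞 K)} (χ : HeckeChar K 𝔮) (L : ℂ → ℂ) : Prop :=
  (∀ s : ℂ, s ≠ 1 → DifferentiableAt ℂ L s) ∧ ∀ s : ℂ, 1 < s.re → L s = LSer χ s

/-- The Dedekind zeta series of `K`. -/
def zetaSer (K : Type*) [Field K] [NumberField K] (s : ℂ) : ℂ :=
  ∑' 𝔞 : {I : Ideal (𝓞 K) // I ≠ ⊥}, (Ideal.absNorm 𝔞.1 : ℂ) ^ (-s)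

/-- `Z` is "the" Dedekind zeta function of `K`. -/
def IsZetaFun (K : Type*) [Field K] [NumberField K] (Z : ℂ → ℂ) : Prop :=
  (∀ s : ℂ, s ≠ 1 → DifferentiableAt ℂ Z s) ∧ ∀ s : ℂ, 1 < s.re → Z s = zetaSer K s

/-- `L` vanishes at `ρ` to order at least `m`. -/
def ZeroOrderAtLeast (L : ℂ → ℂ) (ρ : ℂ) (m : ℕ) : Prop :=
  ∃ g : ℂ → ℂ, AnalyticAt ℂ g ρ ∧ ∀ᶠ z in nhds ρ, L z = (z - ρ) ^ m * g z

/-- `L` vanishes at `ρ` to order exactly `m`. -/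
def ZeroOrderExact (L : ℂ → ℂ) (ρ : ℂ) (m : ℕ) : Prop :=
  ∃ g : ℂ → ℂ, AnalyticAt ℂ g ρ ∧ g ρ ≠ 0 ∧ ∀ᶠ z in nhds ρ, L z = (z - ρ) ^ m * g z

open scoped Classical in
/-- The von Mangoldt function `Λ_K` of the field `K`. -/
def ΛK (K : Type*) [Field K] [NumberField K] (𝔫 : Ideal (𝓞 K)) : ℝ :=
  if h : ∃ (𝔭 : Ideal (𝓞 K)) (k : ℕ), 𝔭.IsPrime ∧ 𝔭 ≠ ⊥ ∧ 1 ≤ k ∧ 𝔫 = 𝔭 ^ k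
  then Real.log (Ideal.absNorm h.choose) else 0

/-- The residue `κ_K` of `ζ_K` at `s = 1`, characterized as a limit of the real Dirichlet
series. -/
def IsResidue (K : Type*) [Field K] [NumberField K] (κ : ℝ) : Prop :=
  Filter.Tendsto (fun σ : ℝ => (σ - 1) *
      ∑' 𝔞 : {I : Ideal (𝓞 K) // I ≠ ⊥}, (Ideal.absNorm 𝔞.1 : ℝ) ^ (-σ))
    (nhdsWithin 1 (Set.Ioi 1)) (nhds κ)

/-- `γ_K`, the Euler–Kronecker constant: `ζ_K(s) - κ_K/(s-1) → κ_K γ_K` as `s → 1⁺`. -/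
def IsEulerKronecker (K : Type*) [Field K] [NumberField K] (κ γK : ℝ) : Prop :=
  Filter.Tendsto (fun σ : ℝ =>
      (∑' 𝔞 : {I : Ideal (𝓞 K) // I ≠ ⊥}, (Ideal.absNorm 𝔞.1 : ℝ) ^ (-σ)) - κ / (σ - 1))
    (nhdsWithin 1 (Set.Ioi 1)) (nhds (κ * γK))

lemma exists_prime_mem {P : Ideal (𝓞 K)} (hP : Prime P) :
    ∃ p : ℕ, p.Prime ∧ (p : 𝓞 K) ∈ P ∧ p ≤ Ideal.absNorm P := by
  have hPp : P.IsPrime := Ideal.isPrime_of_prime hP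
  have hN0 : Ideal.absNorm P ≠ 0 := by
    rw [Ne, Ideal.absNorm_eq_zero_iff]; exact hP.ne_zero
  have h1 := Ideal.absNorm_mem P
  rw [← Nat.prod_primeFactorsList hN0, Nat.cast_list_prod] at h1
  obtain ⟨x, hx, hxP⟩ := (hPp.multiset_prod_mem_iff_exists_mem
    ((Ideal.absNorm P).primeFactorsList.map (fun n : ℕ => (n : 𝓞 K)) : Multiset (𝓞 K))).1
      (by simpa using h1)
  simp only [Multiset.mem_coe, List.mem_map] at hx
  obtain ⟨p, hp, rfl⟩ := hx
  exact ⟨p, Nat.prime_of_mem_primeFactorsList hp, hxP, Nat.le_of_mem_primeFactorsList hp⟩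

lemma card_primes_containing_le (F : Finset (Ideal (𝓞 K))) (hF : ∀ P ∈ F, Prime P) {p : ℕ}
    (hp : p.Prime) (hpF : ∀ P ∈ F, (p : 𝓞 K) ∈ P) : F.card ≤ nK K := by
  have hle : ∀ P ∈ F, p ≤ Ideal.absNorm P := by
    intro P hP
    have hd : Ideal.absNorm P ∣ p ^ nK K := by
      have := Ideal.absNorm_dvd_absNorm_of_le
        (show Ideal.span {(p : 𝓞 K)} ≤ P by simpa [Ideal.span_le] using hpF P hP)
      rwa [Ideal.absNorm_span_natCast, RingOfIntegers.rank K] at this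
    obtain ⟨k, -, hk⟩ := (Nat.dvd_prime_pow hp).1 hd
    have hk0 : k ≠ 0 := by
      rintro rfl
      rw [pow_zero, Ideal.absNorm_eq_one_iff] at hk
      exact (Ideal.isPrime_of_prime (hF P hP)).ne_top hk
    rw [hk]
    exact Nat.le_self_pow hk0 p
  have hd : ∏ P ∈ F, P ∣ Ideal.span {(p : 𝓞 K)} :=
    Finset.prod_primes_dvd _ hF fun P hP => by
      rw [Ideal.dvd_span_singleton]; exact hpF P hP
  have hd2 : ∏ P ∈ F, Ideal.absNorm P ∣ p ^ nK K := by
    have := Ideal.absNorm_dvd_absNorm_of_le (Ideal.le_of_dvd hd)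
    rwa [map_prod, Ideal.absNorm_span_natCast, RingOfIntegers.rank K] at this
  have h1 : p ^ F.card ≤ p ^ nK K :=
    (Finset.pow_card_le_prod F _ p hle).trans
      (Nat.le_of_dvd (pow_pos hp.pos _) hd2)
  exact (Nat.pow_le_pow_iff_right hp.one_lt).1 h1

lemma sum_absNorm_prime_le (F : Finset (Ideal (𝓞 K))) (hF : ∀ P ∈ F, Prime P) (B : ℕ)
    (hB : ∀ P ∈ F, Ideal.absNorm P ≤ B) (g : ℕ → ℝ) (hg0 : ∀ m, 0 ≤ g m)
    (hg : ∀ a b, 0 < a → a ≤ b → g b ≤ g a) :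
    ∑ P ∈ F, g (Ideal.absNorm P) ≤ nK K * ∑ m ∈ Finset.Icc 1 B, g m := by
  classical
  choose! u hu using fun (P : Ideal (𝓞 K)) (hP : Prime P) => exists_prime_mem hP
  have hmaps : ∀ P ∈ F, u P ∈ Finset.Icc 1 B := fun P hP =>
    Finset.mem_Icc.2 ⟨(hu P (hF P hP)).1.pos, (hu P (hF P hP)).2.2.trans (hB P hP)⟩
  calc ∑ P ∈ F, g (Ideal.absNorm P) ≤ ∑ P ∈ F, g (u P) :=
        Finset.sum_le_sum fun P hP => hg _ _ (hu P (hF P hP)).1.pos (hu P (hF P hP)).2.2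
    _ = ∑ m ∈ Finset.Icc 1 B, ∑ P ∈ F with u P = m, g (u P) :=
        (Finset.sum_fiberwise_of_maps_to hmaps _).symm
    _ ≤ ∑ m ∈ Finset.Icc 1 B, nK K * g m := by
        refine Finset.sum_le_sum fun m _ => ?_
        rw [Finset.sum_congr rfl (g := fun _ => g m)
          (fun P hP => by rw [(Finset.mem_filter.1 hP).2]), Finset.sum_const, nsmul_eq_mul]
        refine mul_le_mul_of_nonneg_right ?_ (hg0 m)
        norm_cast
        rcases (F.filter (fun P => u P = m)).eq_empty_or_nonempty with h | ⟨P, hP⟩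
        · simp [h]
        · obtain ⟨hPF, rfl⟩ := Finset.mem_filter.1 hP
          refine card_primes_containing_le _ (fun Q hQ => hF Q (Finset.mem_filter.1 hQ).1)
            (hu P (hF P hPF)).1 fun Q hQ => ?_
          obtain ⟨hQF, hQ⟩ := Finset.mem_filter.1 hQ
          rw [← hQ]
          exact (hu Q (hF Q hQF)).2.1
    _ = _ := by rw [Finset.mul_sum]

lemma two_le_absNorm {P : Ideal (𝓞 K)} (hP : Prime P) : 2 ≤ Ideal.absNorm P := by
  obtain ⟨p, hp, -, h⟩ := exists_prime_mem hP
  exact hp.two_le.trans h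

lemma eq_prod_pow_count {I : Ideal (𝓞 K)} (hI : I ≠ ⊥) (S : Finset (Ideal (𝓞 K)))
    [DecidableEq (Ideal (𝓞 K))]
    (hS : (UniqueFactorizationMonoid.normalizedFactors I).toFinset ⊆ S) :
    I = ∏ P ∈ S, P ^ (UniqueFactorizationMonoid.normalizedFactors I).count P := by
  conv_lhs => rw [← Ideal.prod_normalizedFactors_eq_self hI, Finset.prod_multiset_count]
  refine Finset.prod_subset hS fun P _ hP => ?_
  rw [Multiset.count_eq_zero_of_notMem (fun h => hP (Multiset.mem_toFinset.2 h)), pow_zero]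

lemma geom_sum_le_exp {w : ℝ} (h0 : 0 ≤ w) (h1 : w ≤ 1 / 2) (L : ℕ) :
    ∑ j ∈ Finset.range L, w ^ j ≤ Real.exp (2 * w) := by
  have h2 : ∑ j ∈ Finset.range L, w ^ j ≤ (1 - w)⁻¹ := by
    rw [← tsum_geometric_of_lt_one h0 (by linarith)]
    exact (summable_geometric_of_lt_one h0 (by linarith)).sum_le_tsum _
      fun i _ => pow_nonneg h0 i
  refine h2.trans ?_
  have h3 : (1 - w)⁻¹ ≤ 1 + 2 * w := by
    rw [inv_le_iff_one_le_mul₀ (by linarith)]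
    nlinarith
  linarith [Real.add_one_le_exp (2 * w)]

/-- The number of nonzero integral ideals of norm at most `x` is at most
`x ^ s * exp (C * n_K)` for every `s > 1`, with `C` depending only on `s`. -/
lemma card_ideals_norm_le (s : ℝ) (hs : 1 < s) : ∃ C : ℝ, 0 ≤ C ∧
    ∀ (K : Type) [Field K] [NumberField K] (x : ℝ), 0 ≤ x → ∀ F : Finset (Ideal (𝓞 K)),
      (∀ I ∈ F, I ≠ ⊥ ∧ (Ideal.absNorm I : ℝ) ≤ x) →
      (F.card : ℝ) ≤ x ^ s * Real.exp (C * nK K) := by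
  classical
  have hsum : Summable fun m : ℕ => ((m : ℝ) ^ s)⁻¹ := Real.summable_nat_rpow_inv.2 hs
  refine ⟨2 * ∑' m : ℕ, ((m : ℝ) ^ s)⁻¹, by positivity, ?_⟩
  intro K _ _ x hx F hF
  set w : Ideal (𝓞 K) → ℝ := fun P => ((Ideal.absNorm P : ℝ) ^ s)⁻¹ with hw
  have hw0 : ∀ P, 0 ≤ w P := fun P => by positivity
  have hwmul : ∀ I J, w (I * J) = w I * w J := fun I J => by
    simp only [hw, map_mul, Nat.cast_mul]
    rw [Real.mul_rpow (by positivity) (by positivity), mul_inv]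
  let W : Ideal (𝓞 K) →* ℝ := ⟨⟨w, by simp [hw]⟩, hwmul⟩
  set S : Finset (Ideal (𝓞 K)) :=
    F.biUnion fun I => (UniqueFactorizationMonoid.normalizedFactors I).toFinset with hS
  have hSp : ∀ P ∈ S, Prime P := by
    intro P hP
    obtain ⟨I, -, hI⟩ := Finset.mem_biUnion.1 hP
    exact UniqueFactorizationMonoid.prime_of_normalized_factor P (Multiset.mem_toFinset.1 hI)
  set c : Ideal (𝓞 K) → Ideal (𝓞 K) → ℕ := fun I P =>
    (UniqueFactorizationMonoid.normalizedFactors I).count P with hc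
  set L : ℕ := (F.sup fun I => S.sup fun P => c I P) + 1 with hL
  have hfac : ∀ I ∈ F, I = ∏ P ∈ S, P ^ c I P := fun I hI =>
    eq_prod_pow_count (hF I hI).1 S
      (Finset.subset_biUnion_of_mem
        (fun I => (UniqueFactorizationMonoid.normalizedFactors I).toFinset) hI)
  have hwP : ∀ P ∈ S, w P ≤ 1 / 2 := by
    intro P hP
    have h2 : (2 : ℝ) ≤ Ideal.absNorm P := by exact_mod_cast two_le_absNorm (hSp P hP)
    simp only [hw, one_div]
    refine inv_anti₀ (by norm_num) ?_
    calc (2 : ℝ) ≤ (Ideal.absNorm P : ℝ) ^ (1 : ℝ) := by simpa using h2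
      _ ≤ _ := Real.rpow_le_rpow_of_exponent_le (by linarith) hs.le
  have key : ∑ I ∈ F, w I ≤ Real.exp ((2 * ∑' m : ℕ, ((m : ℝ) ^ s)⁻¹) * nK K) := by
    calc ∑ I ∈ F, w I = ∑ I ∈ F, ∏ P : S, w P ^ c I P := by
          refine Finset.sum_congr rfl fun I hI => ?_
          conv_lhs => rw [hfac I hI]
          change W _ = _
          rw [map_prod, ← Finset.prod_coe_sort S (fun P => W (P ^ c I P))]
          simp only [map_pow]
          rfl
      _ ≤ ∑ f ∈ Fintype.piFinset (fun _ : S => Finset.range L), ∏ P : S, w P ^ f P := by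
          have hinj : Set.InjOn (fun (I : Ideal (𝓞 K)) (P : S) => c I P) F := by
            intro I hI J hJ hIJ
            rw [hfac I hI, hfac J hJ]
            exact Finset.prod_congr rfl fun P hP => by
              have := congrFun hIJ ⟨P, hP⟩
              simp only at this
              rw [this]
          rw [← Finset.sum_image (f := fun f : S → ℕ => ∏ P : S, w P ^ f P) hinj]
          refine Finset.sum_le_sum_of_subset_of_nonneg ?_ fun f _ _ =>
            Finset.prod_nonneg fun P _ => pow_nonneg (hw0 _) _
          intro f hf
          obtain ⟨I, hI, rfl⟩ := Finset.mem_image.1 hf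
          rw [Fintype.mem_piFinset]
          intro P
          rw [Finset.mem_range, hL, Nat.lt_succ_iff]
          exact (Finset.le_sup (f := fun P => c I P) P.2).trans
            (Finset.le_sup (f := fun I => S.sup fun P => c I P) hI)
      _ = ∏ P : S, ∑ j ∈ Finset.range L, w P ^ j := by rw [Finset.prod_univ_sum]
      _ ≤ ∏ P : S, Real.exp (2 * w P) :=
          Finset.prod_le_prod (fun P _ => Finset.sum_nonneg fun j _ => pow_nonneg (hw0 _) _)
            fun P _ => geom_sum_le_exp (hw0 _) (hwP P P.2) L
      _ = Real.exp (∑ P ∈ S, 2 * w P) := by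
          rw [Finset.prod_coe_sort S (fun P => Real.exp (2 * w P)), Real.exp_sum]
      _ ≤ _ := by
          rw [Real.exp_le_exp, ← Finset.mul_sum, mul_assoc]
          refine mul_le_mul_of_nonneg_left ?_ (by norm_num)
          refine (sum_absNorm_prime_le S hSp (S.sup Ideal.absNorm)
            (fun P hP => Finset.le_sup (f := Ideal.absNorm) hP)
            (fun m => ((m : ℝ) ^ s)⁻¹) (fun m => by positivity) ?_).trans ?_
          · intro a b ha hab
            have : (0 : ℝ) < a := by exact_mod_cast ha
            have : (a : ℝ) ≤ b := by exact_mod_cast hab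
            gcongr
          · rw [mul_comm]
            refine mul_le_mul_of_nonneg_right ?_ (by positivity)
            exact hsum.sum_le_tsum _ fun i _ => by positivity
  calc (F.card : ℝ) = ∑ I ∈ F, 1 := by simp
    _ ≤ ∑ I ∈ F, x ^ s * w I := by
        refine Finset.sum_le_sum fun I hI => ?_
        have hpos : 0 < (Ideal.absNorm I : ℝ) := by
          have := (Ideal.absNorm_eq_zero_iff (I := I)).not.2 (hF I hI).1
          exact_mod_cast Nat.pos_of_ne_zero this
        simp only [hw]
        rw [← div_eq_mul_inv, one_le_div (by positivity)]
        exact Real.rpow_le_rpow hpos.le (hF I hI).2 (by linarith)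
    _ = x ^ s * ∑ I ∈ F, w I := by rw [Finset.mul_sum]
    _ ≤ _ := mul_le_mul_of_nonneg_left key (by positivity)

lemma card_small_primes_le (F : Finset (Ideal (𝓞 K))) (hF : ∀ P ∈ F, Prime P) (B : ℕ)
    (hB : ∀ P ∈ F, Ideal.absNorm P ≤ B) : (F.card : ℝ) ≤ nK K * B := by
  simpa using sum_absNorm_prime_le F hF B hB (fun _ => 1) (by simp) (by simp)

lemma one_le_DK (K : Type*) [Field K] [NumberField K] : (1 : ℝ) ≤ DK K := by
  have : DK K ≠ 0 := by
    simpa [DK] using NumberField.discr_ne_zero K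
  exact_mod_cast Nat.one_le_iff_ne_zero.2 this

lemma minkowski_bound_le (K : Type*) [Field K] [NumberField K] :
    (4 / Real.pi) ^ InfinitePlace.nrComplexPlaces K *
      ((Module.finrank ℚ K).factorial / (Module.finrank ℚ K : ℝ) ^ Module.finrank ℚ K *
        √|(discr K : ℝ)|) ≤ 2 ^ nK K * √(DK K) := by
  have h1 : (4 / Real.pi) ^ InfinitePlace.nrComplexPlaces K ≤ 2 ^ nK K := by
    have hr : InfinitePlace.nrComplexPlaces K ≤ nK K := by
      have := InfinitePlace.card_add_two_mul_card_eq_rank K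
      simp only [nK]
      omega
    have h2 : 4 / Real.pi ≤ 2 := by
      rw [div_le_iff₀ Real.pi_pos]; linarith [Real.pi_gt_three]
    calc (4 / Real.pi) ^ InfinitePlace.nrComplexPlaces K
        ≤ 2 ^ InfinitePlace.nrComplexPlaces K := by
          have := Real.pi_pos
          gcongr
      _ ≤ 2 ^ nK K := pow_le_pow_right₀ (by norm_num) hr
  have h2 : ((Module.finrank ℚ K).factorial / (Module.finrank ℚ K : ℝ) ^ Module.finrank ℚ K)
      ≤ 1 := by
    refine div_le_one_of_le₀ ?_ (by positivity)
    exact_mod_cast Nat.factorial_le_pow _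
  have h3 : |(discr K : ℝ)| = DK K := by
    rw [DK, Nat.cast_natAbs, Int.cast_abs]
  rw [h3]
  have : (0 : ℝ) ≤ √(DK K) := Real.sqrt_nonneg _
  have := Real.pi_pos
  calc _ ≤ 2 ^ nK K * (1 * √(DK K)) := by gcongr
    _ = _ := by rw [one_mul]

lemma card_realEmbeddings_le (K : Type*) [Field K] [NumberField K] :
    Finite (K →+* ℝ) ∧ Nat.card (K →+* ℝ) ≤ nK K := by
  have hinj : Function.Injective
      (fun φ : K →+* ℝ => (Complex.ofRealHom.comp φ : K →+* ℂ)) := by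
    intro φ ψ h
    ext x
    have := RingHom.congr_fun h x
    simpa using this
  refine ⟨Finite.of_injective _ hinj, ?_⟩
  refine (Nat.card_le_card_of_injective _ hinj).trans ?_
  rw [Nat.card_eq_fintype_card, NumberField.Embeddings.card]
  rfl

open scoped Classical in
/-- The positivity pattern of an algebraic integer under the real embeddings. -/
def signPattern (x : 𝓞 K) : (K →+* ℝ) → Bool :=
  fun φ => decide (0 < φ (algebraMap (𝓞 K) K x))

lemma map_ne_zero_of_ne_zero {K : Type*} [Field K] (φ : K →+* ℝ) {x : 𝓞 K} (hx : x ≠ 0) :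
    φ (algebraMap (𝓞 K) K x) ≠ 0 := by
  rw [Ne, map_eq_zero]
  simpa using hx

lemma TotPos.mul {α β : 𝓞 K} (hα : TotPos K α) (hβ : TotPos K β) : TotPos K (α * β) := by
  intro φ
  rw [map_mul, map_mul]
  exact mul_pos (hα φ) (hβ φ)

lemma totPos_one : TotPos K 1 := fun φ => by simp

lemma totPos_sq {x : 𝓞 K} (hx : x ≠ 0) : TotPos K (x * x) := by
  intro φ
  rw [map_mul, map_mul]
  exact mul_self_pos.2 (map_ne_zero_of_ne_zero φ hx)

lemma totPos_mul_of_signPattern_eq {x y : 𝓞 K} (hx : x ≠ 0) (hy : y ≠ 0)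
    (h : signPattern x = signPattern y) : TotPos K (x * y) := by
  intro φ
  have h1 := congrFun h φ
  simp only [signPattern, decide_eq_decide] at h1
  rw [map_mul, map_mul]
  rcases (map_ne_zero_of_ne_zero φ hx).lt_or_gt with h2 | h2
  · have h3 : φ (algebraMap (𝓞 K) K y) < 0 :=
      lt_of_le_of_ne (not_lt.1 fun h4 => absurd (h1.2 h4) (not_lt.2 h2.le))
        (map_ne_zero_of_ne_zero φ hy)
    exact mul_pos_of_neg_of_neg h2 h3
  · exact mul_pos h2 (h1.1 h2)

/-- Nonzero integral ideals fall into at most `e^{O_ε(n_K)} D_K^{1/2+ε}` narrow classes. -/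
lemma narrow_class_bound (ε : ℝ) (hε : 0 < ε) : ∃ C : ℝ, 0 ≤ C ∧
    ∀ (K : Type) [Field K] [NumberField K], ∃ (X : Type) (T : Finset X)
      (c : Ideal (𝓞 K) → X), (∀ 𝔞, 𝔞 ≠ ⊥ → c 𝔞 ∈ T) ∧
      (T.card : ℝ) ≤ Real.exp (C * nK K) * (DK K : ℝ) ^ ((1 : ℝ) / 2 + ε) ∧
      ∀ 𝔞 𝔟, 𝔞 ≠ ⊥ → 𝔟 ≠ ⊥ → c 𝔞 = c 𝔟 → ∃ α β : 𝓞 K, α ≠ 0 ∧ β ≠ 0 ∧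
        TotPos K α ∧ TotPos K β ∧ Ideal.span {α} * 𝔞 = Ideal.span {β} * 𝔟 := by
  classical
  obtain ⟨C, hC, hcount⟩ := card_ideals_norm_le (1 + 2 * ε) (by linarith)
  refine ⟨Real.log 2 * (1 + 2 * ε) + C + Real.log 2, by positivity, ?_⟩
  intro K _ _
  have : Finite (K →+* ℝ) := (card_realEmbeddings_le K).1
  have : Fintype (K →+* ℝ) := Fintype.ofFinite _
  set M : ℝ := 2 ^ nK K * √(DK K) with hM
  have hM0 : 0 ≤ M := by positivity
  have hfin : {I : Ideal (𝓞 K) | Ideal.absNorm I ≤ ⌊M⌋₊}.Finite :=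
    Ideal.finite_setOfPred_absNorm_le _
  set S : Finset (Ideal (𝓞 K)) := hfin.toFinset.filter (fun I => I ≠ ⊥) with hS
  have hSmem : ∀ I, I ∈ S ↔ I ≠ ⊥ ∧ (Ideal.absNorm I : ℝ) ≤ M := by
    intro I
    simp [hS, Nat.le_floor_iff hM0, and_comm]
  have hex : ∀ 𝔞 : Ideal (𝓞 K), 𝔞 ≠ ⊥ → ∃ I ∈ S, ∃ x y : 𝓞 K, x ≠ 0 ∧ y ≠ 0 ∧
      Ideal.span {x} * 𝔞 = Ideal.span {y} * I := by
    intro 𝔞 h𝔞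
    obtain ⟨I, hI, hIn⟩ := exists_ideal_in_class_of_norm_le
      (ClassGroup.mk0 ⟨𝔞, mem_nonZeroDivisors_of_ne_zero h𝔞⟩)
    obtain ⟨x, y, hx, hy, hxy⟩ := ClassGroup.mk0_eq_mk0_iff.1 hI
    exact ⟨I, (hSmem I).2 ⟨nonZeroDivisors.coe_ne_zero I, hIn.trans (minkowski_bound_le K)⟩,
      y, x, hy, hx, hxy.symm⟩
  choose! J hJS x y hx hy hxy using hex
  refine ⟨Ideal (𝓞 K) × ((K →+* ℝ) → Bool), S ×ˢ Finset.univ,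
    fun 𝔞 => (J 𝔞, signPattern (x 𝔞 * y 𝔞)), ?_, ?_, ?_⟩
  · intro 𝔞 h𝔞
    simp [hJS 𝔞 h𝔞]
  · have h1 := hcount K M hM0 S fun I hI => (hSmem I).1 hI
    have h2 : (Fintype.card ((K →+* ℝ) → Bool) : ℝ) ≤ Real.exp (Real.log 2 * nK K) := by
      rw [Fintype.card_fun, Fintype.card_bool, Real.exp_mul, Real.exp_log (by norm_num),
        Real.rpow_natCast]
      push_cast
      refine pow_le_pow_right₀ (by norm_num) ?_
      rw [← Nat.card_eq_fintype_card]
      exact (card_realEmbeddings_le K).2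
    have h3 : M ^ (1 + 2 * ε) = Real.exp (Real.log 2 * (1 + 2 * ε) * nK K) *
        (DK K : ℝ) ^ ((1 : ℝ) / 2 + ε) := by
      rw [hM, Real.mul_rpow (by positivity) (by positivity), Real.sqrt_eq_rpow,
        ← Real.rpow_mul (by positivity), mul_assoc, Real.exp_mul, Real.exp_log (by norm_num),
        ← Real.rpow_natCast, ← Real.rpow_mul (by norm_num)]
      congr 2 <;> ring
    rw [Finset.card_product, Finset.card_univ, Nat.cast_mul]
    calc _ ≤ (M ^ (1 + 2 * ε) * Real.exp (C * nK K)) * Real.exp (Real.log 2 * nK K) := by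
          gcongr
      _ = _ := by
          rw [h3, add_mul, add_mul, Real.exp_add, Real.exp_add]
          ring
  · intro 𝔞 𝔟 h𝔞 h𝔟 h
    simp only [Prod.mk.injEq] at h
    obtain ⟨h1, h2⟩ := h
    have hxa := hx 𝔞 h𝔞
    have hya := hy 𝔞 h𝔞
    have hxb := hx 𝔟 h𝔟
    have hyb := hy 𝔟 h𝔟
    refine ⟨(y 𝔟 * x 𝔞) * (y 𝔟 * x 𝔞), (x 𝔞 * y 𝔞) * (x 𝔟 * y 𝔟), ?_, ?_,
      totPos_sq (mul_ne_zero hyb hxa), totPos_mul_of_signPattern_eq (mul_ne_zero hxa hya)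
        (mul_ne_zero hxb hyb) h2, ?_⟩
    · simp [hxa, hyb]
    · simp [hxa, hyb, hya, hxb]
    · have e1 := hxy 𝔞 h𝔞
      have e2 := hxy 𝔟 h𝔟
      rw [h1] at e1
      simp only [← Ideal.span_singleton_mul_span_singleton]
      calc _ = Ideal.span {y 𝔟} * Ideal.span {y 𝔟} * Ideal.span {x 𝔞} *
            (Ideal.span {x 𝔞} * 𝔞) := by ring
        _ = Ideal.span {y 𝔟} * Ideal.span {y 𝔞} * Ideal.span {x 𝔞} *
            (Ideal.span {y 𝔟} * J 𝔟) := by rw [e1]; ring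
        _ = _ := by rw [← e2]; ring

lemma exists_totPos_sub_mem {𝔫 : Ideal (𝓞 K)} (h𝔫 : 𝔫 ≠ ⊥) (x : 𝓞 K) :
    ∃ y : 𝓞 K, TotPos K y ∧ y - x ∈ 𝔫 := by
  have : Finite (K →+* ℝ) := (card_realEmbeddings_le K).1
  obtain ⟨t, ht⟩ := Finite.exists_le fun φ : K →+* ℝ => ⌈-φ (algebraMap (𝓞 K) K x)⌉₊
  have hN : (1 : ℝ) ≤ Ideal.absNorm 𝔫 := by
    exact_mod_cast Nat.one_le_iff_ne_zero.2 (Ideal.absNorm_eq_zero_iff.not.2 h𝔫)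
  refine ⟨x + (Ideal.absNorm 𝔫 : 𝓞 K) * ((t + 1 : ℕ) : 𝓞 K), fun φ => ?_, ?_⟩
  · have h1 : -φ (algebraMap (𝓞 K) K x) ≤ t := (Nat.ceil_le.1 (ht φ))
    simp only [map_add, map_mul, map_natCast]
    have h2 : ((t + 1 : ℕ) : ℝ) ≤ Ideal.absNorm 𝔫 * ((t + 1 : ℕ) : ℝ) :=
      le_mul_of_one_le_left (by positivity) hN
    push_cast at h2 ⊢
    linarith
  · rw [add_sub_cancel_left]
    exact 𝔫.mul_mem_right _ (Ideal.absNorm_mem 𝔫)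

lemma totPos_of_mul_eq {α β η : 𝓞 K} (hα : TotPos K α) (hβ : TotPos K β) (h : α * η = β) :
    TotPos K η := by
  intro φ
  have h1 := hβ φ
  rw [← h, map_mul, map_mul] at h1
  exact (mul_pos_iff_of_pos_left (hα φ)).1 h1

lemma isCoprime_span_singleton_iff {R : Type*} [CommRing R] {α : R} {𝔮 : Ideal R} :
    IsCoprime (Ideal.span {α}) 𝔮 ↔ ∃ β, α * β - 1 ∈ 𝔮 := by
  rw [Ideal.isCoprime_iff_exists]
  constructor
  · rintro ⟨i, hi, j, hj, hij⟩
    obtain ⟨β, rfl⟩ := Ideal.mem_span_singleton'.1 hi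
    refine ⟨β, ?_⟩
    have : α * β - 1 = -j := by rw [← hij]; ring
    rw [this]
    exact 𝔮.neg_mem hj
  · rintro ⟨β, hβ⟩
    exact ⟨α * β, Ideal.mul_mem_right _ _ (Ideal.mem_span_singleton_self α), -(α * β - 1),
      𝔮.neg_mem hβ, by ring⟩

lemma isCoprime_of_sub_one_mem {R : Type*} [CommRing R] {α : R} {𝔮 : Ideal R} (h : α - 1 ∈ 𝔮) :
    IsCoprime (Ideal.span {α}) 𝔮 :=
  isCoprime_span_singleton_iff.2 ⟨1, by simpa using h⟩

lemma isCoprime_span_mul {R : Type*} [CommRing R] {𝔮 : Ideal R} {α β : R}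
    (hα : IsCoprime (Ideal.span {α}) 𝔮)
    (hβ : IsCoprime (Ideal.span {β}) 𝔮) : IsCoprime (Ideal.span {α * β}) 𝔮 := by
  rw [← Ideal.span_singleton_mul_span_singleton]; exact hα.mul_left hβ

lemma ne_bot_of_isCoprime {R : Type*} [CommRing R] {𝔞 𝔮 : Ideal R} (h𝔮 : 𝔮 ≠ ⊤)
    (h : IsCoprime 𝔞 𝔮) : 𝔞 ≠ ⊥ := by
  rintro rfl
  rw [Ideal.isCoprime_iff_sup_eq, bot_sup_eq] at h
  exact h𝔮 h

/-- An ideal `𝔞` coprime to `𝔣 ∣ 𝔮` divides a principal ideal `(γ)` with `γ` totally positive,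
`γ ≡ 1 (mod 𝔣)`, and cofactor coprime to `𝔮`. -/
lemma exists_totPos_span_eq_mul {𝔮 𝔣 𝔞 : Ideal (𝓞 K)} (h0 : 𝔮 ≠ ⊥) (h1 : 𝔮 ≠ ⊤)
    (hle : 𝔮 ≤ 𝔣) (h𝔞 : 𝔞 ≠ ⊥) (hcop : IsCoprime 𝔞 𝔣) :
    ∃ (γ : 𝓞 K) (𝔟 : Ideal (𝓞 K)), TotPos K γ ∧ γ ≠ 0 ∧ γ - 1 ∈ 𝔣 ∧
      Ideal.span {γ} = 𝔞 * 𝔟 ∧ IsCoprime 𝔟 𝔮 := by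
  classical
  have h𝔣 : 𝔣 ≠ ⊥ := fun h => h0 (le_bot_iff.1 (h ▸ hle))
  obtain ⟨γ₀, hγ₀⟩ := IsDedekindDomain.exists_sup_span_eq
    (Ideal.mul_le_left : 𝔞 * 𝔮 ≤ 𝔞) (mul_ne_zero h𝔞 h0)
  set S := (UniqueFactorizationMonoid.normalizedFactors 𝔮).toFinset.filter fun 𝔭 => ¬ 𝔣 ≤ 𝔭
    with hS
  have hSp : ∀ 𝔭 ∈ S, Prime 𝔭 ∧ ¬ 𝔣 ≤ 𝔭 := by
    intro 𝔭 h𝔭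
    obtain ⟨h2, h3⟩ := Finset.mem_filter.1 h𝔭
    exact ⟨UniqueFactorizationMonoid.prime_of_normalized_factor _ (Multiset.mem_toFinset.1 h2),
      h3⟩
  set 𝔯 := ∏ 𝔭 ∈ S, 𝔭 with h𝔯
  have h𝔯0 : 𝔯 ≠ ⊥ := by
    rw [h𝔯, ← Ideal.zero_eq_bot, Finset.prod_ne_zero_iff]
    exact fun 𝔭 h𝔭 => (hSp 𝔭 h𝔭).1.ne_zero
  have h𝔯cop : IsCoprime 𝔯 𝔣 := by
    refine IsCoprime.prod_left fun 𝔭 h𝔭 => ?_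
    have hmax : 𝔭.IsMaximal :=
      (Ideal.isPrime_of_prime (hSp 𝔭 h𝔭).1).isMaximal (hSp 𝔭 h𝔭).1.ne_zero
    rw [Ideal.isCoprime_iff_sup_eq]
    refine hmax.1.2 _ (lt_of_le_of_ne le_sup_left fun h => (hSp 𝔭 h𝔭).2 ?_)
    rw [h]; exact le_sup_right
  obtain ⟨i, hi, j, hj, hij⟩ := Ideal.isCoprime_iff_exists.1 (hcop.mul_left h𝔯cop)
  obtain ⟨γ, hγ, hγmem⟩ := exists_totPos_sub_mem
    (mul_ne_zero (mul_ne_zero h𝔞 h𝔯0) h𝔣 : 𝔞 * 𝔯 * 𝔣 ≠ ⊥) (γ₀ * j + i)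
  have hγ₀mem : γ₀ ∈ 𝔞 := by
    rw [← hγ₀]; exact Ideal.mem_sup_right (Ideal.mem_span_singleton_self γ₀)
  have e1 : γ - γ₀ ∈ 𝔞 * 𝔯 := by
    have : γ - γ₀ = (γ - (γ₀ * j + i)) + (1 - γ₀) * i := by
      rw [← eq_sub_iff_add_eq'] at hij
      rw [hij]; ring
    rw [this]
    exact add_mem (Ideal.mul_le_left hγmem) (Ideal.mul_mem_left _ _ hi)
  have e2 : γ - 1 ∈ 𝔣 := by
    have : γ - 1 = (γ - (γ₀ * j + i)) + (γ₀ - 1) * j := by linear_combination hij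
    rw [this]
    exact add_mem (Ideal.mul_le_right hγmem) (Ideal.mul_mem_left _ _ hj)
  have e3 : γ ∈ 𝔞 := by
    have := add_mem (Ideal.mul_le_left e1 : γ - γ₀ ∈ 𝔞) hγ₀mem
    simpa using this
  obtain ⟨𝔟, h𝔟⟩ := Ideal.dvd_span_singleton.2 e3
  have h𝔟cop : IsCoprime 𝔟 𝔮 := by
    rw [Ideal.isCoprime_iff_sup_eq]
    by_contra hne
    obtain ⟨𝔭, h𝔭, hle2⟩ := Ideal.exists_le_maximal _ hne
    have h𝔟le : 𝔟 ≤ 𝔭 := le_sup_left.trans hle2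
    have h𝔮le : 𝔮 ≤ 𝔭 := le_sup_right.trans hle2
    have hγ𝔞𝔭 : γ ∈ 𝔞 * 𝔭 :=
      Ideal.mul_mono_right h𝔟le (h𝔟 ▸ Ideal.mem_span_singleton_self γ)
    by_cases hf : 𝔣 ≤ 𝔭
    · refine h𝔭.ne_top ((Ideal.eq_top_iff_one _).2 ?_)
      have := sub_mem (Ideal.mul_le_right hγ𝔞𝔭) (hf e2)
      simpa using this
    · have h𝔭S : 𝔭 ∈ S := by
        rw [hS, Finset.mem_filter, Multiset.mem_toFinset]
        exact ⟨(Ideal.mem_normalizedFactors_iff h0).2 ⟨h𝔭.isPrime, h𝔮le⟩, hf⟩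
      have h𝔯𝔭 : 𝔯 ≤ 𝔭 := Ideal.le_of_dvd (Finset.dvd_prod_of_mem _ h𝔭S)
      have h4 : γ₀ ∈ 𝔞 * 𝔭 := by
        have := sub_mem hγ𝔞𝔭 (Ideal.mul_mono_right h𝔯𝔭 e1)
        simpa using this
      have h5 : 𝔞 ≤ 𝔞 * 𝔭 := by
        conv_lhs => rw [← hγ₀]
        refine sup_le (Ideal.mul_mono_right h𝔮le) ?_
        rwa [Ideal.span_singleton_le_iff_mem]
      have h6 : 𝔞 * 𝔭 = 𝔞 * 1 := by
        rw [mul_one]; exact le_antisymm Ideal.mul_le_left h5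
      exact h𝔭.ne_top (by simpa using mul_left_cancel₀ (h𝔞 : 𝔞 ≠ 0) h6)
  refine ⟨γ, 𝔟, hγ, ?_, e2, h𝔟, h𝔟cop⟩
  rintro rfl
  have : 𝔞 * 𝔟 = 0 := by rw [← h𝔟]; simp
  exact (mul_ne_zero h𝔞 (ne_bot_of_isCoprime h1 h𝔟cop)) this

/-- A surjective homomorphism from the narrow ray class group modulo `𝔮` onto a group, seen as a
function on integral ideals that is multiplicative on ideals coprime to `𝔮`. -/
structure RayHom (𝔮 : Ideal (𝓞 K)) (G : Type*) [CommGroup G] where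
  toFun : Ideal (𝓞 K) → G
  map_mul' : ∀ 𝔞 𝔟, IsCoprime 𝔞 𝔮 → IsCoprime 𝔟 𝔮 → toFun (𝔞 * 𝔟) = toFun 𝔞 * toFun 𝔟
  ray_one' : ∀ α : 𝓞 K, TotPos K α → α - 1 ∈ 𝔮 → toFun (Ideal.span {α}) = 1
  surj' : ∀ g, ∃ 𝔞, IsCoprime 𝔞 𝔮 ∧ toFun 𝔞 = g

section RayHom

variable {𝔮 : Ideal (𝓞 K)} {G : Type*} [CommGroup G] (f : RayHom 𝔮 G)

lemma RayHom.map_span_mul {α β : 𝓞 K} (hα : IsCoprime (Ideal.span {α}) 𝔮)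
    (hβ : IsCoprime (Ideal.span {β}) 𝔮) :
    f.toFun (Ideal.span {α * β}) = f.toFun (Ideal.span {α}) * f.toFun (Ideal.span {β}) := by
  rw [← Ideal.span_singleton_mul_span_singleton, f.map_mul' _ _ hα hβ]

lemma RayHom.exists_inv (h0 : 𝔮 ≠ ⊥) {α : 𝓞 K} (hα : TotPos K α)
    (hc : IsCoprime (Ideal.span {α}) 𝔮) : ∃ β : 𝓞 K, TotPos K β ∧ α * β - 1 ∈ 𝔮 ∧
      IsCoprime (Ideal.span {β}) 𝔮 ∧
      f.toFun (Ideal.span {β}) = (f.toFun (Ideal.span {α}))⁻¹ := by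
  obtain ⟨β₀, hβ₀⟩ := isCoprime_span_singleton_iff.1 hc
  obtain ⟨β, hβ, hββ₀⟩ := exists_totPos_sub_mem h0 β₀
  have h1 : α * β - 1 ∈ 𝔮 := by
    have : α * β - 1 = α * (β - β₀) + (α * β₀ - 1) := by ring
    rw [this]
    exact add_mem (Ideal.mul_mem_left _ _ hββ₀) hβ₀
  have h2 : IsCoprime (Ideal.span {β}) 𝔮 :=
    isCoprime_span_singleton_iff.2 ⟨α, by rwa [mul_comm]⟩
  refine ⟨β, hβ, h1, h2, eq_inv_of_mul_eq_one_right ?_⟩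
  rw [← f.map_span_mul hc h2]
  exact f.ray_one' _ (hα.mul hβ) h1

/-- The image in `G` of the principal ideals generated by totally positive elements coprime to
`𝔮` and congruent to `1` modulo `𝔫 + 𝔮`. -/
def RayHom.raySubgroup (h0 : 𝔮 ≠ ⊥) (𝔫 : Ideal (𝓞 K)) : Subgroup G where
  carrier := {g | ∃ α : 𝓞 K, TotPos K α ∧ IsCoprime (Ideal.span {α}) 𝔮 ∧ α - 1 ∈ 𝔫 ⊔ 𝔮 ∧
    f.toFun (Ideal.span {α}) = g}
  one_mem' := ⟨1, totPos_one, isCoprime_of_sub_one_mem (by simp), by simp,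
    f.ray_one' 1 totPos_one (by simp)⟩
  mul_mem' := by
    rintro _ _ ⟨α, hα, hαc, hα1, rfl⟩ ⟨β, hβ, hβc, hβ1, rfl⟩
    refine ⟨α * β, hα.mul hβ, isCoprime_span_mul hαc hβc, ?_, f.map_span_mul hαc hβc⟩
    have : α * β - 1 = α * (β - 1) + (α - 1) := by ring
    rw [this]
    exact add_mem (Ideal.mul_mem_left _ _ hβ1) hα1
  inv_mem' := by
    rintro _ ⟨α, hα, hαc, hα1, rfl⟩
    obtain ⟨β, hβ, hαβ, hβc, hβf⟩ := f.exists_inv h0 hα hαc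
    refine ⟨β, hβ, hβc, ?_, hβf⟩
    have : β - 1 = (α * β - 1) - β * (α - 1) := by ring
    rw [this]
    exact sub_mem (Ideal.mem_sup_right hαβ) (Ideal.mul_mem_left _ _ hα1)

lemma RayHom.mem_raySubgroup (h0 : 𝔮 ≠ ⊥) {𝔫 : Ideal (𝓞 K)} (hle : 𝔮 ≤ 𝔫) {g : G} :
    g ∈ f.raySubgroup h0 𝔫 ↔ ∃ α : 𝓞 K, TotPos K α ∧ IsCoprime (Ideal.span {α}) 𝔮 ∧
      α - 1 ∈ 𝔫 ∧ f.toFun (Ideal.span {α}) = g := by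
  rw [← SetLike.mem_coe]
  change (∃ α : 𝓞 K, _) ↔ _
  rw [sup_eq_left.2 hle]

lemma RayHom.raySubgroup_mono (h0 : 𝔮 ≠ ⊥) {𝔪 𝔫 : Ideal (𝓞 K)} (h : 𝔪 ≤ 𝔫) :
    f.raySubgroup h0 𝔪 ≤ f.raySubgroup h0 𝔫 := by
  rintro _ ⟨α, hα, hαc, hα1, rfl⟩
  exact ⟨α, hα, hαc, sup_le_sup_right h _ hα1, rfl⟩

lemma RayHom.raySubgroup_self (h0 : 𝔮 ≠ ⊥) : f.raySubgroup h0 𝔮 = ⊥ := by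
  rw [eq_bot_iff]
  rintro _ ⟨α, hα, hαc, hα1, rfl⟩
  rw [sup_idem] at hα1
  exact f.ray_one' α hα hα1

lemma RayHom.div_mem_raySubgroup (h0 : 𝔮 ≠ ⊥) {𝔫 : Ideal (𝓞 K)} (hle : 𝔮 ≤ 𝔫) {α β : 𝓞 K}
    (hα : TotPos K α) (hαc : IsCoprime (Ideal.span {α}) 𝔮)
    (hβ : TotPos K β) (hβc : IsCoprime (Ideal.span {β}) 𝔮) (h : α - β ∈ 𝔫) :
    (f.toFun (Ideal.span {β}))⁻¹ * f.toFun (Ideal.span {α}) ∈ f.raySubgroup h0 𝔫 := by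
  obtain ⟨γ, hγ, hβγ, hγc, hγf⟩ := f.exists_inv h0 hβ hβc
  rw [f.mem_raySubgroup h0 hle]
  refine ⟨γ * α, hγ.mul hα, isCoprime_span_mul hγc hαc, ?_, ?_⟩
  · have : γ * α - 1 = γ * (α - β) + (β * γ - 1) := by ring
    rw [this]
    exact add_mem (Ideal.mul_mem_left _ _ h) (hle hβγ)
  · rw [f.map_span_mul hγc hαc, hγf]

lemma RayHom.congr_of_sub_mem (h0 : 𝔮 ≠ ⊥) {α β : 𝓞 K}
    (hα : TotPos K α) (hαc : IsCoprime (Ideal.span {α}) 𝔮)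
    (hβ : TotPos K β) (hβc : IsCoprime (Ideal.span {β}) 𝔮) (h : α - β ∈ 𝔮) :
    f.toFun (Ideal.span {α}) = f.toFun (Ideal.span {β}) := by
  have := f.div_mem_raySubgroup h0 le_rfl hα hαc hβ hβc h
  rw [f.raySubgroup_self, Subgroup.mem_bot] at this
  exact (inv_mul_eq_one.1 this).symm

/-- Ideals coprime to `𝔮` in the same narrow ray class modulo `𝔣 ∣ 𝔮` differ by an element of
the subgroup attached to `𝔣`. -/
lemma RayHom.inv_mul_mem_raySubgroup (h0 : 𝔮 ≠ ⊥) (h1 : 𝔮 ≠ ⊤) {𝔣 : Ideal (𝓞 K)}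
    (hle : 𝔮 ≤ 𝔣) {𝔞 𝔟 : Ideal (𝓞 K)} (h𝔞 : IsCoprime 𝔞 𝔮) (h𝔟 : IsCoprime 𝔟 𝔮)
    {γ γ' : 𝓞 K} (hγ : TotPos K γ) (hγ' : TotPos K γ') (hγ0 : γ ≠ 0)
    (hγ1 : γ - 1 ∈ 𝔣) (hγ1' : γ' - 1 ∈ 𝔣)
    (h : Ideal.span {γ} * 𝔞 = Ideal.span {γ'} * 𝔟) :
    (f.toFun 𝔟)⁻¹ * f.toFun 𝔞 ∈ f.raySubgroup h0 𝔣 := by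
  obtain ⟨δ, 𝔠, hδ, -, hδ1, hδ𝔠, h𝔠⟩ := exists_totPos_span_eq_mul h0 h1 le_rfl
    (ne_bot_of_isCoprime h1 h𝔟) h𝔟
  have e1 : Ideal.span {γ' * δ} = Ideal.span {γ} * (𝔞 * 𝔠) := by
    rw [← Ideal.span_singleton_mul_span_singleton, hδ𝔠, ← mul_assoc, ← h, mul_assoc]
  obtain ⟨η, hη⟩ : γ ∣ γ' * δ := by
    rw [← Ideal.mem_span_singleton]
    exact Ideal.mul_le_left (e1 ▸ Ideal.mem_span_singleton_self (γ' * δ))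
  have e2 : Ideal.span {η} = 𝔞 * 𝔠 := by
    rw [hη, ← Ideal.span_singleton_mul_span_singleton] at e1
    exact mul_left_cancel₀ (by simpa using hγ0) e1
  have hηc : IsCoprime (Ideal.span {η}) 𝔮 := e2 ▸ h𝔞.mul_left h𝔠
  rw [f.mem_raySubgroup h0 hle]
  refine ⟨η, totPos_of_mul_eq hγ (hγ'.mul hδ) hη.symm, hηc, ?_, ?_⟩
  · have : η - 1 = -(η * (γ - 1)) + (γ' * (δ - 1) + (γ' - 1)) := by
      have e3 : γ' * (δ - 1) + (γ' - 1) = γ * η - 1 := by rw [← hη]; ring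
      rw [e3]; ring
    rw [this]
    exact add_mem (neg_mem (Ideal.mul_mem_left _ _ hγ1))
      (add_mem (Ideal.mul_mem_left _ _ (hle hδ1)) hγ1')
  · have e3 : f.toFun 𝔟 * f.toFun 𝔠 = 1 := by
      rw [← f.map_mul' _ _ h𝔟 h𝔠, ← hδ𝔠]
      exact f.ray_one' δ hδ hδ1
    rw [e2, f.map_mul' _ _ h𝔞 h𝔠, inv_eq_of_mul_eq_one_right e3, mul_comm]

lemma RayHom.card_le_card_mul [Finite G] (h0 : 𝔮 ≠ ⊥) (h1 : 𝔮 ≠ ⊤) {X : Type*} (T : Finset X)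
    (c : Ideal (𝓞 K) → X) (hc : ∀ 𝔞, 𝔞 ≠ ⊥ → c 𝔞 ∈ T)
    (h : ∀ 𝔞 𝔟, 𝔞 ≠ ⊥ → 𝔟 ≠ ⊥ → c 𝔞 = c 𝔟 → ∃ α β : 𝓞 K, α ≠ 0 ∧ β ≠ 0 ∧
        TotPos K α ∧ TotPos K β ∧ Ideal.span {α} * 𝔞 = Ideal.span {β} * 𝔟) :
    Nat.card G ≤ Nat.card (f.raySubgroup h0 ⊤) * T.card := by
  rw [← (f.raySubgroup h0 ⊤).card_mul_index]
  refine Nat.mul_le_mul_left _ ?_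
  choose r hr hrf using f.surj'
  let F : G ⧸ f.raySubgroup h0 ⊤ → T :=
    fun x => ⟨c (r x.out), hc _ (ne_bot_of_isCoprime h1 (hr _))⟩
  have hF : Function.Injective F := by
    intro x y hxy
    obtain ⟨α, β, hα0, -, hα, hβ, hαβ⟩ := h _ _ (ne_bot_of_isCoprime h1 (hr x.out))
      (ne_bot_of_isCoprime h1 (hr y.out)) (Subtype.ext_iff.1 hxy)
    have := f.inv_mul_mem_raySubgroup h0 h1 (le_top : 𝔮 ≤ ⊤) (hr _) (hr _) hα hβ hα0 trivial
      trivial hαβ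
    rw [hrf, hrf, ← QuotientGroup.eq, QuotientGroup.out_eq', QuotientGroup.out_eq'] at this
    exact this.symm
  have := Nat.card_le_card_of_injective F hF
  rwa [Nat.card_eq_fintype_card (α := T), Fintype.card_coe] at this

lemma RayHom.card_raySubgroup_le [Finite G] (h0 : 𝔮 ≠ ⊥) {𝔪 𝔫 : Ideal (𝓞 K)} (h𝔪 : 𝔮 ≤ 𝔪)
    (hle : 𝔪 ≤ 𝔫) {r : ℕ} (hr : Ideal.absNorm 𝔪 = r * Ideal.absNorm 𝔫) :
    Nat.card (f.raySubgroup h0 𝔫) ≤ r * Nat.card (f.raySubgroup h0 𝔪) := by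
  have hB := f.raySubgroup_mono h0 hle
  have h𝔫 : 𝔮 ≤ 𝔫 := h𝔪.trans hle
  have hidx : (𝔪.toAddSubgroup).relIndex 𝔫.toAddSubgroup = r := by
    have h1 := AddSubgroup.relIndex_mul_index (H := 𝔪.toAddSubgroup) (K := 𝔫.toAddSubgroup) hle
    have h2 : 𝔪.toAddSubgroup.index = Ideal.absNorm 𝔪 := rfl
    have h3 : 𝔫.toAddSubgroup.index = Ideal.absNorm 𝔫 := rfl
    rw [h2, h3, hr] at h1
    refine Nat.eq_of_mul_eq_mul_right (Nat.pos_of_ne_zero ?_) h1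
    rw [Ne, Ideal.absNorm_eq_zero_iff]
    rintro rfl
    exact h0 (le_bot_iff.1 h𝔫)
  have hr0 : r ≠ 0 := by
    rintro rfl
    rw [zero_mul, Ideal.absNorm_eq_zero_iff] at hr
    exact h0 (le_bot_iff.1 (hr ▸ h𝔪))
  choose a ha hac ha1 haf using fun x : f.raySubgroup h0 𝔫 => (f.mem_raySubgroup h0 h𝔫).1 x.2
  have key : (f.raySubgroup h0 𝔪).relIndex (f.raySubgroup h0 𝔫) ≤ r := by
    rw [← hidx, Subgroup.relIndex, AddSubgroup.relIndex, Subgroup.index, AddSubgroup.index]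
    have : Finite (𝔫.toAddSubgroup ⧸ 𝔪.toAddSubgroup.addSubgroupOf 𝔫.toAddSubgroup) := by
      refine Nat.finite_of_card_ne_zero ?_
      change (𝔪.toAddSubgroup).relIndex 𝔫.toAddSubgroup ≠ 0
      rwa [hidx]
    refine Nat.card_le_card_of_injective
      (fun x => (QuotientAddGroup.mk ⟨a x.out - 1, ha1 x.out⟩ :
        𝔫.toAddSubgroup ⧸ 𝔪.toAddSubgroup.addSubgroupOf 𝔫.toAddSubgroup)) ?_
    intro x y hxy
    simp only [QuotientAddGroup.eq] at hxy
    rw [AddSubgroup.mem_addSubgroupOf] at hxy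
    have h2 : a y.out - a x.out ∈ 𝔪 := by
      have : a y.out - a x.out = -(a x.out - 1) + (a y.out - 1) := by ring
      rw [this]
      exact hxy
    have h3 := f.div_mem_raySubgroup h0 h𝔪 (ha _) (hac _) (ha _) (hac _) h2
    rw [haf, haf] at h3
    rw [← QuotientGroup.out_eq' x, ← QuotientGroup.out_eq' y, QuotientGroup.eq,
      Subgroup.mem_subgroupOf]
    exact h3
  have h1 := Subgroup.relIndex_mul_relIndex ⊥ _ _ bot_le hB
  rw [Subgroup.relIndex_bot_left, Subgroup.relIndex_bot_left] at h1
  rw [← h1, mul_comm]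
  exact Nat.mul_le_mul_right _ key

end RayHom

lemma mem_prod_pow_iff {R : Type*} [CommRing R] [IsDedekindDomain R] {S : Finset (Ideal R)}
    (hS : ∀ 𝔭 ∈ S, Prime 𝔭) (a : Ideal R → ℕ) {x : R} :
    x ∈ ∏ 𝔭 ∈ S, 𝔭 ^ a 𝔭 ↔ ∀ 𝔭 ∈ S, x ∈ 𝔭 ^ a 𝔭 := by
  rw [← IsDedekindDomain.inf_pow_eq_prod_of_prime S (fun 𝔭 => 𝔭) a hS fun _ _ _ _ h => h,
    Submodule.mem_finsetInf]

lemma prod_pow_anti {R : Type*} [CommRing R] {S : Finset (Ideal R)} {a b : Ideal R → ℕ}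
    (hab : ∀ 𝔭 ∈ S, a 𝔭 ≤ b 𝔭) : ∏ 𝔭 ∈ S, 𝔭 ^ b 𝔭 ≤ ∏ 𝔭 ∈ S, 𝔭 ^ a 𝔭 :=
  Finset.prod_le_prod' fun 𝔭 h𝔭 => Ideal.pow_le_pow_right (hab 𝔭 h𝔭)

lemma isCoprime_span_of_sub_mem {R : Type*} [CommRing R] {α β : R} {𝔮 : Ideal R}
    (hα : IsCoprime (Ideal.span {α}) 𝔮) (h : β - α ∈ 𝔮) : IsCoprime (Ideal.span {β}) 𝔮 := by
  obtain ⟨γ, hγ⟩ := isCoprime_span_singleton_iff.1 hα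
  refine isCoprime_span_singleton_iff.2 ⟨γ, ?_⟩
  have : β * γ - 1 = γ * (β - α) + (α * γ - 1) := by ring
  rw [this]
  exact add_mem (Ideal.mul_mem_left _ _ h) hγ

lemma totPos_prod {ι : Type*} (s : Finset ι) (α : ι → 𝓞 K) (h : ∀ i ∈ s, TotPos K (α i)) :
    TotPos K (∏ i ∈ s, α i) := by
  classical
  induction s using Finset.induction_on with
  | empty => simpa using totPos_one
  | insert i s hi ih =>
    rw [Finset.prod_insert hi]
    exact (h i (Finset.mem_insert_self i s)).mul
      (ih fun j hj => h j (Finset.mem_insert_of_mem hj))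

section RayHom

variable {𝔮 : Ideal (𝓞 K)} {G : Type*} [CommGroup G] (f : RayHom 𝔮 G)

lemma RayHom.map_span_prod {ι : Type*} (s : Finset ι) (α : ι → 𝓞 K)
    (h : ∀ i ∈ s, IsCoprime (Ideal.span {α i}) 𝔮) :
    IsCoprime (Ideal.span {∏ i ∈ s, α i}) 𝔮 ∧
      f.toFun (Ideal.span {∏ i ∈ s, α i}) = ∏ i ∈ s, f.toFun (Ideal.span {α i}) := by
  classical
  induction s using Finset.induction_on with
  | empty =>
    simp only [Finset.prod_empty]
    exact ⟨isCoprime_of_sub_one_mem (by simp), f.ray_one' 1 totPos_one (by simp)⟩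
  | insert i s hi ih =>
    obtain ⟨h1, h2⟩ := ih fun j hj => h j (Finset.mem_insert_of_mem hj)
    have h3 := h i (Finset.mem_insert_self i s)
    rw [Finset.prod_insert hi, Finset.prod_insert hi, f.map_span_mul h3 h1, h2]
    exact ⟨isCoprime_span_mul h3 h1, rfl⟩

open scoped Classical in
/-- Chinese remainder decomposition of the subgroup attached to `∏ 𝔭 ^ a 𝔭` into local parts. -/
lemma RayHom.exists_prod_eq_of_mem_raySubgroup (h0 : 𝔮 ≠ ⊥) {S : Finset (Ideal (𝓞 K))}
    (hS : ∀ 𝔭 ∈ S, Prime 𝔭) {e a : Ideal (𝓞 K) → ℕ} (h𝔮 : 𝔮 = ∏ 𝔭 ∈ S, 𝔭 ^ e 𝔭)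
    (ha : ∀ 𝔭 ∈ S, a 𝔭 ≤ e 𝔭) {g : G} (hg : g ∈ f.raySubgroup h0 (∏ 𝔭 ∈ S, 𝔭 ^ a 𝔭)) :
    ∃ y : Ideal (𝓞 K) → G, (∀ 𝔭 ∈ S,
      y 𝔭 ∈ f.raySubgroup h0 (∏ 𝔭' ∈ S, 𝔭' ^ Function.update e 𝔭 (a 𝔭) 𝔭')) ∧
      g = ∏ 𝔭 ∈ S, y 𝔭 := by
  have hle : 𝔮 ≤ ∏ 𝔭 ∈ S, 𝔭 ^ a 𝔭 := h𝔮.trans_le (prod_pow_anti ha)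
  obtain ⟨α, hα, hαc, hα1, rfl⟩ := (f.mem_raySubgroup h0 hle).1 hg
  have hx : ∀ 𝔭 : Ideal (𝓞 K), ∃ y : 𝓞 K, TotPos K y ∧
      ∀ 𝔭' ∈ S, y - (if 𝔭' = 𝔭 then α else 1) ∈ 𝔭' ^ e 𝔭' := by
    intro 𝔭
    obtain ⟨x, hx⟩ := IsDedekindDomain.exists_forall_sub_mem_ideal (s := S) (fun 𝔭' => 𝔭') e hS
      (fun _ _ _ _ h => h) (fun 𝔭' => if (𝔭' : Ideal (𝓞 K)) = 𝔭 then α else 1)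
    obtain ⟨y, hy, hyx⟩ := exists_totPos_sub_mem h0 x
    refine ⟨y, hy, fun 𝔭' h𝔭' => ?_⟩
    rw [h𝔮, mem_prod_pow_iff hS] at hyx
    simpa using add_mem (hyx 𝔭' h𝔭') (hx 𝔭' h𝔭')
  choose y hy hyx using hx
  have hyc : ∀ 𝔭, IsCoprime (Ideal.span {y 𝔭}) 𝔮 := by
    intro 𝔭
    rw [h𝔮]
    refine IsCoprime.prod_right fun 𝔭' h𝔭' => ?_
    have h1 := hyx 𝔭 𝔭' h𝔭'
    split_ifs at h1 with h
    · refine isCoprime_span_of_sub_mem ?_ h1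
      rw [h𝔮] at hαc
      exact IsCoprime.of_isCoprime_of_dvd_right hαc (Finset.dvd_prod_of_mem (fun 𝔭 => 𝔭 ^ e 𝔭) h𝔭')
    · exact isCoprime_of_sub_one_mem h1
  refine ⟨fun 𝔭 => f.toFun (Ideal.span {y 𝔭}), fun 𝔭 h𝔭 => ?_, ?_⟩
  · have hle2 : 𝔮 ≤ ∏ 𝔭' ∈ S, 𝔭' ^ Function.update e 𝔭 (a 𝔭) 𝔭' := by
      refine h𝔮.trans_le (prod_pow_anti fun 𝔭' h𝔭' => ?_)
      by_cases h : 𝔭' = 𝔭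
      · subst h; simpa using ha 𝔭' h𝔭'
      · simp [h]
    rw [f.mem_raySubgroup h0 hle2]
    refine ⟨y 𝔭, hy 𝔭, hyc 𝔭, (mem_prod_pow_iff hS _).2 fun 𝔭' h𝔭' => ?_, rfl⟩
    have h1 := hyx 𝔭 𝔭' h𝔭'
    split_ifs at h1 with h
    · subst h
      have h2 := add_mem (Ideal.pow_le_pow_right (ha 𝔭' h𝔭') h1)
        ((mem_prod_pow_iff hS _).1 hα1 𝔭' h𝔭')
      simpa using h2
    · simpa [h] using h1
  · obtain ⟨h1, h2⟩ := f.map_span_prod S y fun 𝔭 _ => hyc 𝔭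
    rw [← h2]
    refine f.congr_of_sub_mem h0 hα hαc (totPos_prod S y fun 𝔭 _ => hy 𝔭) h1 ?_
    rw [h𝔮, mem_prod_pow_iff hS]
    intro 𝔭 h𝔭
    rw [← Ideal.Quotient.eq, map_prod, Finset.prod_eq_single_of_mem 𝔭 h𝔭]
    · rw [eq_comm, Ideal.Quotient.eq]
      simpa using hyx 𝔭 𝔭 h𝔭
    · intro 𝔭' _ hne
      rw [← map_one (Ideal.Quotient.mk (𝔭 ^ e 𝔭)), Ideal.Quotient.eq]
      simpa [hne.symm] using hyx 𝔭' 𝔭 h𝔭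

open scoped Classical in
lemma RayHom.card_raySubgroup_top_le [Finite G] (h0 : 𝔮 ≠ ⊥) {S : Finset (Ideal (𝓞 K))}
    (hS : ∀ 𝔭 ∈ S, Prime 𝔭) {e : Ideal (𝓞 K) → ℕ} (h𝔮 : 𝔮 = ∏ 𝔭 ∈ S, 𝔭 ^ e 𝔭) :
    Nat.card (f.raySubgroup h0 ⊤) ≤
      ∏ 𝔭 ∈ S, Nat.card (f.raySubgroup h0 (∏ 𝔭' ∈ S, 𝔭' ^ Function.update e 𝔭 0 𝔭')) := by
  rw [← Finset.prod_coe_sort S, ← Nat.card_pi]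
  have htop : (∏ 𝔭 ∈ S, 𝔭 ^ ((0 : Ideal (𝓞 K) → ℕ) 𝔭)) = ⊤ := by simp
  choose y hy hyg using fun g : f.raySubgroup h0 ⊤ =>
    f.exists_prod_eq_of_mem_raySubgroup h0 hS h𝔮 (a := 0) (fun _ _ => Nat.zero_le _)
      (g := g) (by rw [htop]; exact g.2)
  refine Nat.card_le_card_of_injective (fun g 𝔭 => ⟨y g 𝔭, hy g 𝔭 𝔭.2⟩) fun g g' h => ?_
  rw [Subtype.ext_iff, hyg, hyg]
  exact Finset.prod_congr rfl fun 𝔭 h𝔭 => Subtype.ext_iff.1 (congrFun h ⟨𝔭, h𝔭⟩)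

open scoped Classical in
lemma RayHom.raySubgroup_prod_le (h0 : 𝔮 ≠ ⊥) {S : Finset (Ideal (𝓞 K))}
    (hS : ∀ 𝔭 ∈ S, Prime 𝔭) {e a : Ideal (𝓞 K) → ℕ} (h𝔮 : 𝔮 = ∏ 𝔭 ∈ S, 𝔭 ^ e 𝔭)
    (ha : ∀ 𝔭 ∈ S, a 𝔭 ≤ e 𝔭) {L : Subgroup G} (hL : ∀ 𝔭 ∈ S,
      f.raySubgroup h0 (∏ 𝔭' ∈ S, 𝔭' ^ Function.update e 𝔭 (a 𝔭) 𝔭') ≤ L) :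
    f.raySubgroup h0 (∏ 𝔭 ∈ S, 𝔭 ^ a 𝔭) ≤ L := by
  intro g hg
  obtain ⟨y, hy, rfl⟩ := f.exists_prod_eq_of_mem_raySubgroup h0 hS h𝔮 ha hg
  exact L.prod_mem fun 𝔭 h𝔭 => hL 𝔭 h𝔭 (hy 𝔭 h𝔭)

/-- The Hecke character modulo `𝔮` attached to a character of `G`. -/
def RayHom.heckeChar [Finite G] (χ : G →* ℂˣ) : HeckeChar K 𝔮 where
  toFun 𝔞 := by
    classical exact if IsCoprime 𝔞 𝔮 then (χ (f.toFun 𝔞) : ℂ) else 0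
  map_mul' 𝔞 𝔟 := by
    by_cases h𝔞 : IsCoprime 𝔞 𝔮
    · by_cases h𝔟 : IsCoprime 𝔟 𝔮
      · simp [h𝔞, h𝔟, h𝔞.mul_left h𝔟, f.map_mul' _ _ h𝔞 h𝔟]
      · simp [h𝔟, IsCoprime.mul_left_iff]
    · simp [h𝔞, IsCoprime.mul_left_iff]
  eq_zero' 𝔞 h := by simp [h]
  norm_one' 𝔞 h := by
    simp only [h, if_true]
    have h1 : χ (f.toFun 𝔞) ^ Nat.card G = 1 := by rw [← map_pow, pow_card_eq_one', map_one]
    exact Complex.norm_eq_one_of_pow_eq_one (n := Nat.card G)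
      (by rw [← Units.val_pow_eq_pow_val, h1, Units.val_one]) Nat.card_pos.ne'
  ray_one' α hα h := by
    simp [isCoprime_of_sub_one_mem h, f.ray_one' α hα h]

lemma RayHom.heckeChar_apply [Finite G] (χ : G →* ℂˣ) {𝔞 : Ideal (𝓞 K)} (h : IsCoprime 𝔞 𝔮) :
    (f.heckeChar χ).toFun 𝔞 = χ (f.toFun 𝔞) := by
  simp [heckeChar, h]

/-- A character trivial on the subgroup attached to `𝔣 ≠ ⊤` is induced from modulus `𝔣`. -/
lemma RayHom.exists_induces [Finite G] (h0 : 𝔮 ≠ ⊥) (h1 : 𝔮 ≠ ⊤) {𝔣 : Ideal (𝓞 K)}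
    (hle : 𝔮 ≤ 𝔣) (h𝔣 : 𝔣 ≠ ⊤) (χ : G →* ℂˣ) (hχ : f.raySubgroup h0 𝔣 ≤ χ.ker) :
    ∃ χ' : HeckeChar K 𝔣, Induces χ' (f.heckeChar χ) := by
  classical
  have key : ∀ 𝔞 : Ideal (𝓞 K), ∃ z : ℂˣ, IsCoprime 𝔞 𝔣 → ∀ (γ : 𝓞 K) (𝔟 : Ideal (𝓞 K)),
      TotPos K γ → γ - 1 ∈ 𝔣 → IsCoprime 𝔟 𝔮 → Ideal.span {γ} = 𝔞 * 𝔟 →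
      z = (χ (f.toFun 𝔟))⁻¹ := by
    intro 𝔞
    by_cases hc : IsCoprime 𝔞 𝔣
    · obtain ⟨γ, 𝔟, hγ, hγ0, hγ1, hγ𝔟, h𝔟⟩ :=
        exists_totPos_span_eq_mul h0 h1 hle (ne_bot_of_isCoprime h𝔣 hc) hc
      refine ⟨(χ (f.toFun 𝔟))⁻¹, fun _ γ' 𝔟' hγ' hγ1' h𝔟' hγ𝔟' => ?_⟩
      have h2 := hχ (f.inv_mul_mem_raySubgroup h0 h1 hle h𝔟' h𝔟 hγ hγ' hγ0 hγ1 hγ1'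
        (by rw [hγ𝔟, hγ𝔟']; ring))
      rw [MonoidHom.mem_ker, map_mul, map_inv, inv_mul_eq_one] at h2
      rw [h2]
    · exact ⟨1, fun h => absurd h hc⟩
  choose z hz using key
  have hex : ∀ 𝔞 : Ideal (𝓞 K), IsCoprime 𝔞 𝔣 → ∃ (γ : 𝓞 K) (𝔟 : Ideal (𝓞 K)),
      TotPos K γ ∧ γ - 1 ∈ 𝔣 ∧ IsCoprime 𝔟 𝔮 ∧ Ideal.span {γ} = 𝔞 * 𝔟 ∧
      z 𝔞 = (χ (f.toFun 𝔟))⁻¹ := by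
    intro 𝔞 hc
    obtain ⟨γ, 𝔟, hγ, hγ0, hγ1, hγ𝔟, h𝔟⟩ :=
        exists_totPos_span_eq_mul h0 h1 hle (ne_bot_of_isCoprime h𝔣 hc) hc
    exact ⟨γ, 𝔟, hγ, hγ1, h𝔟, hγ𝔟, hz 𝔞 hc γ 𝔟 hγ hγ1 h𝔟 hγ𝔟⟩
  have hzmul : ∀ 𝔞 𝔟, IsCoprime 𝔞 𝔣 → IsCoprime 𝔟 𝔣 → z (𝔞 * 𝔟) = z 𝔞 * z 𝔟 := by
    intro 𝔞 𝔟 h𝔞 h𝔟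
    obtain ⟨γ, 𝔠, hγ, hγ1, h𝔠, hγ𝔠, hz1⟩ := hex 𝔞 h𝔞
    obtain ⟨γ', 𝔠', hγ', hγ1', h𝔠', hγ𝔠', hz2⟩ := hex 𝔟 h𝔟
    rw [hz (𝔞 * 𝔟) (h𝔞.mul_left h𝔟) (γ * γ') (𝔠 * 𝔠') (hγ.mul hγ') ?_ (h𝔠.mul_left h𝔠') ?_,
      f.map_mul' _ _ h𝔠 h𝔠', map_mul, mul_inv, hz1, hz2]
    · have : γ * γ' - 1 = γ * (γ' - 1) + (γ - 1) := by ring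
      rw [this]
      exact add_mem (Ideal.mul_mem_left _ _ hγ1') hγ1
    · rw [← Ideal.span_singleton_mul_span_singleton, hγ𝔠, hγ𝔠']; ring
  refine ⟨{ toFun := fun 𝔞 => if IsCoprime 𝔞 𝔣 then (z 𝔞 : ℂ) else 0
            map_mul' := fun 𝔞 𝔟 => ?_
            eq_zero' := fun 𝔞 h => by simp [h]
            norm_one' := fun 𝔞 h => ?_
            ray_one' := fun α hα h => ?_ }, hle, fun 𝔞 h𝔞 => ?_⟩
  · by_cases h𝔞 : IsCoprime 𝔞 𝔣
    · by_cases h𝔟 : IsCoprime 𝔟 𝔣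
      · simp [h𝔞, h𝔟, h𝔞.mul_left h𝔟, hzmul _ _ h𝔞 h𝔟]
      · simp [h𝔟, IsCoprime.mul_left_iff]
    · simp [h𝔞, IsCoprime.mul_left_iff]
  · obtain ⟨γ, 𝔠, hγ, hγ1, h𝔠, hγ𝔠, hz1⟩ := hex 𝔞 h
    have := (f.heckeChar χ).norm_one' 𝔠 h𝔠
    rw [f.heckeChar_apply χ h𝔠] at this
    simp [h, hz1, this]
  · have h2 : z (Ideal.span {α}) = 1 := by
      have h3 : f.toFun 1 = 1 := by
        rw [Ideal.one_eq_top, ← Ideal.span_singleton_one]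
        exact f.ray_one' 1 totPos_one (by simp)
      rw [hz _ (isCoprime_of_sub_one_mem h) α 1 hα h isCoprime_one_left (mul_one _).symm, h3,
        map_one, inv_one]
    simp [h2, isCoprime_of_sub_one_mem h]
  · have hc : IsCoprime 𝔞 𝔣 := by
      rw [Ideal.isCoprime_iff_sup_eq, eq_top_iff] at h𝔞 ⊢
      exact h𝔞.trans (sup_le_sup_left hle _)
    obtain ⟨γ, 𝔟, hγ, -, hγ1, hγ𝔟, h𝔟⟩ :=
      exists_totPos_span_eq_mul h0 h1 le_rfl (ne_bot_of_isCoprime h1 h𝔞) h𝔞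
    have h2 := f.ray_one' γ hγ hγ1
    rw [hγ𝔟, f.map_mul' _ _ h𝔞 h𝔟] at h2
    rw [f.heckeChar_apply χ h𝔞]
    simp [hc, hz 𝔞 hc γ 𝔟 hγ (hle hγ1) h𝔟 hγ𝔟, eq_inv_of_mul_eq_one_left h2]

/-- A character induced from modulus `𝔣` is trivial on the subgroup attached to any `𝔫 ≤ 𝔣`. -/
lemma RayHom.raySubgroup_le_ker [Finite G] (h0 : 𝔮 ≠ ⊥) {𝔣 𝔫 : Ideal (𝓞 K)} (χ : G →* ℂˣ)
    {χ' : HeckeChar K 𝔣} (h : Induces χ' (f.heckeChar χ)) (hle : 𝔫 ≤ 𝔣) :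
    f.raySubgroup h0 𝔫 ≤ χ.ker := by
  intro g hg
  obtain ⟨α, hα, hαc, hα1, rfl⟩ := (f.mem_raySubgroup h0 h.1).1 (f.raySubgroup_mono h0 hle hg)
  have h2 := h.2 _ hαc
  rw [f.heckeChar_apply χ hαc, χ'.ray_one' α hα hα1] at h2
  exact Units.ext h2

end RayHom

open scoped Classical in
lemma prod_pow_update {R : Type*} [CommRing R] {S : Finset (Ideal R)} (e : Ideal R → ℕ)
    {𝔭 : Ideal R} (h𝔭 : 𝔭 ∈ S) (k : ℕ) :
    ∏ 𝔭' ∈ S, 𝔭' ^ Function.update e 𝔭 k 𝔭' = 𝔭 ^ k * ∏ 𝔭' ∈ S.erase 𝔭, 𝔭' ^ e 𝔭' := by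
  rw [← Finset.mul_prod_erase S _ h𝔭, Function.update_self]
  congr 1
  refine Finset.prod_congr rfl fun 𝔭' h => ?_
  rw [Function.update_of_ne (Finset.ne_of_mem_erase h)]

open scoped Classical in
lemma card_filter_not_le {P : ℕ → Prop} (hP : ∀ k l, k ≤ l → P k → P l) {e k : ℕ} (hk : P k) :
    ((Finset.range e).filter fun j => ¬ P j).card ≤ k := by
  rw [← Finset.card_range k]
  refine Finset.card_le_card fun j hj => ?_
  rw [Finset.mem_filter] at hj
  exact Finset.mem_range.2 (not_le.1 fun h => hj.2 (hP _ _ h hk))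

open scoped Classical in
lemma card_filter_not_spec {P : ℕ → Prop} (hP : ∀ k l, k ≤ l → P k → P l) {e : ℕ} (he : P e) :
    P ((Finset.range e).filter fun j => ¬ P j).card := by
  by_contra h
  set a := ((Finset.range e).filter fun j => ¬ P j).card with ha
  have hae : a < e := not_le.1 fun hle => h (hP _ _ hle he)
  have h1 : Finset.range (a + 1) ⊆ (Finset.range e).filter fun j => ¬ P j := by
    intro j hj
    rw [Finset.mem_range] at hj
    exact Finset.mem_filter.2 ⟨Finset.mem_range.2 (by omega), fun h2 => h (hP _ _ (by omega) h2)⟩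
  have h2 := Finset.card_le_card h1
  rw [Finset.card_range, ← ha] at h2
  omega

open scoped Classical in
lemma card_filter_le_ker {G : Type*} [CommGroup G] [Finite G] [Fintype (G →* ℂˣ)]
    (B : Subgroup G) :
    ((Finset.univ.filter fun χ : G →* ℂˣ => B ≤ χ.ker).card : ℝ) = Nat.card G / Nat.card B := by
  have h1 := CommGroup.card_domRestrictHom_ker (M := ℂ) B
  have h2 : Nat.card (MonoidHom.domRestrictHom B ℂˣ).ker =
      (Finset.univ.filter fun χ : G →* ℂˣ => B ≤ χ.ker).card := by
    rw [← Fintype.card_subtype, ← Nat.card_eq_fintype_card]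
    refine Nat.card_congr (Equiv.subtypeEquivRight fun χ => ?_)
    rw [MonoidHom.mem_ker, MonoidHom.ext_iff]
    exact ⟨fun h x hx => h ⟨x, hx⟩, fun h x => h x.2⟩
  rw [← h2, h1, B.card_eq_card_quotient_mul_card_subgroup, Nat.cast_mul,
    mul_div_cancel_right₀]
  exact_mod_cast Nat.card_pos.ne'

section RayHom

variable {𝔮 : Ideal (𝓞 K)} {G : Type*} [CommGroup G] (f : RayHom 𝔮 G)

open scoped Classical in
/-- The subgroup attached to the modulus obtained from `∏ 𝔭' ^ e 𝔭'` by changing the exponent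
at `𝔭` to `k`. -/
def RayHom.localSubgroup (h0 : 𝔮 ≠ ⊥) (S : Finset (Ideal (𝓞 K))) (e : Ideal (𝓞 K) → ℕ)
    (𝔭 : Ideal (𝓞 K)) (k : ℕ) : Subgroup G :=
  f.raySubgroup h0 (∏ 𝔭' ∈ S, 𝔭' ^ Function.update e 𝔭 k 𝔭')

lemma RayHom.localSubgroup_anti (h0 : 𝔮 ≠ ⊥) (S : Finset (Ideal (𝓞 K)))
    (e : Ideal (𝓞 K) → ℕ) (𝔭 : Ideal (𝓞 K)) {k l : ℕ} (h : k ≤ l) :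
    f.localSubgroup h0 S e 𝔭 l ≤ f.localSubgroup h0 S e 𝔭 k := by
  classical
  refine f.raySubgroup_mono h0 (prod_pow_anti fun 𝔭' _ => ?_)
  by_cases h' : 𝔭' = 𝔭
  · subst h'; simpa using h
  · simp [h']

lemma RayHom.localSubgroup_self (h0 : 𝔮 ≠ ⊥) {S : Finset (Ideal (𝓞 K))}
    {e : Ideal (𝓞 K) → ℕ} (h𝔮 : 𝔮 = ∏ 𝔭 ∈ S, 𝔭 ^ e 𝔭) (𝔭 : Ideal (𝓞 K)) :
    f.localSubgroup h0 S e 𝔭 (e 𝔭) = ⊥ := by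
  rw [localSubgroup, Function.update_eq_self, ← h𝔮, f.raySubgroup_self]

lemma RayHom.card_localSubgroup_le [Finite G] (h0 : 𝔮 ≠ ⊥) {S : Finset (Ideal (𝓞 K))}
    {e : Ideal (𝓞 K) → ℕ} (h𝔮 : 𝔮 = ∏ 𝔭 ∈ S, 𝔭 ^ e 𝔭) {𝔭 : Ideal (𝓞 K)} (h𝔭 : 𝔭 ∈ S)
    {k : ℕ} (hk : k < e 𝔭) :
    Nat.card (f.localSubgroup h0 S e 𝔭 k) ≤
      Ideal.absNorm 𝔭 * Nat.card (f.localSubgroup h0 S e 𝔭 (k + 1)) := by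
  classical
  refine f.card_raySubgroup_le h0 (h𝔮.trans_le (prod_pow_anti fun 𝔭' _ => ?_))
    (prod_pow_anti fun 𝔭' _ => ?_) ?_
  · by_cases h' : 𝔭' = 𝔭
    · subst h'; simpa using hk
    · simp [h']
  · by_cases h' : 𝔭' = 𝔭
    · subst h'; simp
    · simp [h']
  · rw [prod_pow_update e h𝔭, prod_pow_update e h𝔭, pow_succ', mul_assoc, map_mul]

open scoped Classical in
/-- The exponent at `𝔭` of the conductor of the Hecke character attached to `χ`. -/
def RayHom.localExp (h0 : 𝔮 ≠ ⊥) (S : Finset (Ideal (𝓞 K))) (e : Ideal (𝓞 K) → ℕ)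
    (χ : G →* ℂˣ) (𝔭 : Ideal (𝓞 K)) : ℕ :=
  ((Finset.range (e 𝔭)).filter fun k => ¬ f.localSubgroup h0 S e 𝔭 k ≤ χ.ker).card

lemma RayHom.isConductor_heckeChar [Finite G] (h0 : 𝔮 ≠ ⊥) (h1 : 𝔮 ≠ ⊤)
    {S : Finset (Ideal (𝓞 K))} (hS : ∀ 𝔭 ∈ S, Prime 𝔭) {e : Ideal (𝓞 K) → ℕ}
    (h𝔮 : 𝔮 = ∏ 𝔭 ∈ S, 𝔭 ^ e 𝔭) (χ : G →* ℂˣ)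
    (hne : ∏ 𝔭 ∈ S, 𝔭 ^ f.localExp h0 S e χ 𝔭 ≠ ⊤) :
    IsConductor (f.heckeChar χ) (∏ 𝔭 ∈ S, 𝔭 ^ f.localExp h0 S e χ 𝔭) := by
  classical
  have hle : ∀ 𝔭 ∈ S, f.localExp h0 S e χ 𝔭 ≤ e 𝔭 := fun 𝔭 _ =>
    (Finset.card_filter_le _ _).trans (Finset.card_range _).le
  have hmono : ∀ 𝔭 k l, k ≤ l → f.localSubgroup h0 S e 𝔭 k ≤ χ.ker →
      f.localSubgroup h0 S e 𝔭 l ≤ χ.ker := fun 𝔭 k l hkl h =>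
    (f.localSubgroup_anti h0 S e 𝔭 hkl).trans h
  refine ⟨f.exists_induces h0 h1 (h𝔮.trans_le (prod_pow_anti hle)) hne χ
    (f.raySubgroup_prod_le h0 hS h𝔮 hle fun 𝔭 _ => ?_), ?_⟩
  · refine card_filter_not_spec (hmono 𝔭) ?_
    rw [f.localSubgroup_self h0 h𝔮]
    exact bot_le
  · rintro 𝔣 ⟨χ', hχ'⟩
    intro x hx
    rw [mem_prod_pow_iff hS]
    intro 𝔭 h𝔭
    have h𝔣0 : 𝔣 ≠ ⊥ := by
      rintro rfl
      exact h0 (le_bot_iff.1 hχ'.1)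
    obtain ⟨c, hc, hnc⟩ := (FiniteMultiplicity.of_prime_left (hS 𝔭 h𝔭)
      (h𝔣0 : 𝔣 ≠ 0)).exists_eq_pow_mul_and_not_dvd
    set m := multiplicity 𝔭 𝔣
    have hc𝔮 : c ∣ 𝔭 ^ e 𝔭 * ∏ 𝔭' ∈ S.erase 𝔭, 𝔭' ^ e 𝔭' := by
      rw [← prod_pow_update e h𝔭, Function.update_eq_self, ← h𝔮, Ideal.dvd_iff_le]
      refine hχ'.1.trans ?_
      rw [hc]
      exact Ideal.mul_le_right
    have hcR : c ∣ ∏ 𝔭' ∈ S.erase 𝔭, 𝔭' ^ e 𝔭' := by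
      refine UniqueFactorizationMonoid.dvd_of_dvd_mul_right_of_no_prime_factors ?_ ?_ hc𝔮
      · rintro rfl
        exact h𝔣0 (by simpa using hc)
      · intro d hd hd2 hdp
        have h3 : d = 𝔭 := associated_iff_eq.1
          (hdp.associated_of_dvd (hS 𝔭 h𝔭) (hdp.dvd_of_dvd_pow hd2))
        rw [h3] at hd
        exact hnc hd
    have hker : f.localSubgroup h0 S e 𝔭 m ≤ χ.ker := by
      refine f.raySubgroup_le_ker h0 χ hχ' ?_
      rw [prod_pow_update e h𝔭, ← Ideal.dvd_iff_le, hc]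
      exact mul_dvd_mul_left _ hcR
    have ha : f.localExp h0 S e χ 𝔭 ≤ m := card_filter_not_le (hmono 𝔭) hker
    refine Ideal.pow_le_pow_right ha ?_
    rw [hc] at hx
    exact Ideal.mul_le_left hx

lemma RayHom.sum_localExp_mul_log_le [Finite G] (h0 : 𝔮 ≠ ⊥) (h1 : 𝔮 ≠ ⊤)
    {S : Finset (Ideal (𝓞 K))} (hS : ∀ 𝔭 ∈ S, Prime 𝔭) {e : Ideal (𝓞 K) → ℕ}
    (h𝔮 : 𝔮 = ∏ 𝔭 ∈ S, 𝔭 ^ e 𝔭) {Q : ℕ} (hQ1 : 1 ≤ Q)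
    (hQ : ∀ (χ : G →* ℂˣ) (𝔣 : Ideal (𝓞 K)), IsConductor (f.heckeChar χ) 𝔣 →
      Ideal.absNorm 𝔣 ≤ Q) (χ : G →* ℂˣ) :
    ∑ 𝔭 ∈ S, (f.localExp h0 S e χ 𝔭 : ℝ) * Real.log (Ideal.absNorm 𝔭) ≤ Real.log Q := by
  have hpos : ∀ 𝔭 ∈ S, Ideal.absNorm 𝔭 ≠ 0 := fun 𝔭 h𝔭 h =>
    (hS 𝔭 h𝔭).ne_zero (Ideal.absNorm_eq_zero_iff.1 h)
  have key : Ideal.absNorm (∏ 𝔭 ∈ S, 𝔭 ^ f.localExp h0 S e χ 𝔭) ≤ Q := by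
    by_cases h : ∏ 𝔭 ∈ S, 𝔭 ^ f.localExp h0 S e χ 𝔭 = ⊤
    · rwa [h, Ideal.absNorm_top]
    · exact hQ χ _ (f.isConductor_heckeChar h0 h1 hS h𝔮 χ h)
  rw [map_prod] at key
  calc _ = Real.log (∏ 𝔭 ∈ S, (Ideal.absNorm 𝔭 : ℝ) ^ f.localExp h0 S e χ 𝔭) := by
        rw [Real.log_prod fun 𝔭 h𝔭 => pow_ne_zero _ (by exact_mod_cast hpos 𝔭 h𝔭)]
        simp
    _ ≤ _ := by
        refine Real.log_le_log (Finset.prod_pos fun 𝔭 h𝔭 => pow_pos (by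
          exact_mod_cast Nat.pos_of_ne_zero (hpos 𝔭 h𝔭)) _) ?_
        refine le_trans (le_of_eq ?_) (Nat.cast_le.2 key)
        simp

/-- Averaging the logarithm of the conductor norm over all characters of `G`. -/
lemma RayHom.sum_sum_le_log [Finite G] (h0 : 𝔮 ≠ ⊥) (h1 : 𝔮 ≠ ⊤)
    {S : Finset (Ideal (𝓞 K))} (hS : ∀ 𝔭 ∈ S, Prime 𝔭) {e : Ideal (𝓞 K) → ℕ}
    (h𝔮 : 𝔮 = ∏ 𝔭 ∈ S, 𝔭 ^ e 𝔭) {Q : ℕ} (hQ1 : 1 ≤ Q)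
    (hQ : ∀ (χ : G →* ℂˣ) (𝔣 : Ideal (𝓞 K)), IsConductor (f.heckeChar χ) 𝔣 →
      Ideal.absNorm 𝔣 ≤ Q) :
    ∑ 𝔭 ∈ S, (∑ k ∈ Finset.range (e 𝔭),
      (1 - 1 / (Nat.card (f.localSubgroup h0 S e 𝔭 k) : ℝ))) * Real.log (Ideal.absNorm 𝔭) ≤
      Real.log Q := by
  classical
  have hcard := CommGroup.card_monoidHom_of_hasEnoughRootsOfUnity G ℂ
  have : Finite (G →* ℂˣ) := Nat.finite_of_card_ne_zero (hcard ▸ Nat.card_pos.ne')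
  have : Fintype (G →* ℂˣ) := Fintype.ofFinite _
  have hG : (0 : ℝ) < Nat.card G := by exact_mod_cast Nat.card_pos
  have hG2 : (Finset.univ : Finset (G →* ℂˣ)).card = Nat.card G := by
    rw [Finset.card_univ, ← Nat.card_eq_fintype_card, hcard]
  have h2 : ∀ 𝔭, ∑ χ : G →* ℂˣ, (f.localExp h0 S e χ 𝔭 : ℝ) = Nat.card G *
      ∑ k ∈ Finset.range (e 𝔭), (1 - 1 / (Nat.card (f.localSubgroup h0 S e 𝔭 k) : ℝ)) := by
    intro 𝔭
    simp only [localExp, Finset.card_filter, Nat.cast_sum]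
    rw [Finset.sum_comm, Finset.mul_sum]
    refine Finset.sum_congr rfl fun k _ => ?_
    have h3 := Finset.card_filter_add_card_filter_not (s := (Finset.univ : Finset (G →* ℂˣ)))
      (fun χ => f.localSubgroup h0 S e 𝔭 k ≤ χ.ker)
    rw [hG2] at h3
    have h4 := card_filter_le_ker (f.localSubgroup h0 S e 𝔭 k)
    rw [← Nat.cast_sum, ← Finset.card_filter, mul_sub, mul_one, mul_one_div, ← h4, eq_sub_iff_add_eq']
    exact_mod_cast h3
  have h5 := Finset.sum_le_card_nsmul Finset.univ _ _ fun χ _ =>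
    f.sum_localExp_mul_log_le h0 h1 hS h𝔮 hQ1 hQ χ
  rw [hG2, nsmul_eq_mul, Finset.sum_comm] at h5
  refine le_of_mul_le_mul_left (le_trans (le_of_eq ?_) h5) hG
  rw [Finset.mul_sum]
  refine Finset.sum_congr rfl fun 𝔭 _ => ?_
  rw [← Finset.sum_mul, h2, mul_assoc]

end RayHom

lemma log_le_mul_of_large {ε : ℝ} (hε : 0 < ε) {q r b : ℕ} (hq : (1 / ε + 1) ^ 2 ≤ q)
    (hr : 1 ≤ r) (hrq : r ≤ q) (hrb : r ≤ b) :
    Real.log r ≤ (1 + ε) * (1 - 1 / (b : ℝ)) * Real.log q := by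
  have hr' : (1 : ℝ) ≤ r := by exact_mod_cast hr
  have hrb' : (r : ℝ) ≤ b := by exact_mod_cast hrb
  have hrq' : (r : ℝ) ≤ q := by exact_mod_cast hrq
  have hq0 : 0 ≤ Real.log q := Real.log_natCast_nonneg q
  have h1b : 1 / (b : ℝ) ≤ 1 / r := one_div_le_one_div_of_le (by linarith) hrb'
  rcases hr.eq_or_lt with h | h
  · have : 1 / (r : ℝ) ≤ 1 := by rw [div_le_one (by linarith)]; exact hr'
    rw [← h, Nat.cast_one, Real.log_one]
    have h2 : 0 ≤ 1 - 1 / (b : ℝ) := by linarith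
    positivity
  have h2 : (2 : ℝ) ≤ r := by exact_mod_cast h
  have h2r : 1 / (r : ℝ) ≤ 1 / 2 := one_div_le_one_div_of_le (by norm_num) h2
  by_cases hc : 1 / ε + 1 ≤ r
  · have h3 : 1 ≤ (1 + ε) * (1 - 1 / (r : ℝ)) := by
      have h4 : 1 + ε ≤ ε * r := by
        have := mul_le_mul_of_nonneg_left hc hε.le
        rw [mul_add, mul_one_div_cancel hε.ne'] at this
        linarith
      have h5 : (1 + ε) * (1 - 1 / (r : ℝ)) - 1 = (ε * r - (1 + ε)) / r := by
        field_simp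
        ring
      have h6 : 0 ≤ (ε * r - (1 + ε)) / r := div_nonneg (by linarith) (by linarith)
      linarith
    have h4 : 1 ≤ (1 + ε) * (1 - 1 / (b : ℝ)) :=
      h3.trans (mul_le_mul_of_nonneg_left (by linarith) (by linarith))
    exact (Real.log_le_log (by linarith) hrq').trans (le_mul_of_one_le_left hq0 h4)
  · rw [not_le] at hc
    have h3 : (r : ℝ) ^ 2 ≤ q := le_trans (pow_le_pow_left₀ (by linarith) hc.le 2) hq
    have h4 := Real.log_le_log (by positivity) h3
    rw [Real.log_pow] at h4
    push_cast at h4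
    have h5 : 1 / 2 ≤ (1 + ε) * (1 - 1 / (b : ℝ)) := by nlinarith
    nlinarith

lemma log_le_mul_add {q r b' : ℕ} (hr : 1 ≤ r) (hrq : r ≤ q) (hb' : 1 ≤ b') :
    Real.log r ≤ (1 - 1 / ((r * b' : ℕ) : ℝ)) * Real.log q +
      (1 / (b' : ℝ) - 1 / ((r * b' : ℕ) : ℝ)) * Real.log q := by
  have hr' : (1 : ℝ) ≤ r := by exact_mod_cast hr
  have hb : (1 : ℝ) ≤ b' := by exact_mod_cast hb'
  have hq0 : 0 ≤ Real.log q := Real.log_natCast_nonneg q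
  rcases hr.eq_or_lt with h | h
  · subst h
    have : 1 / (b' : ℝ) ≤ 1 := by rw [div_le_one (by linarith)]; exact hb
    simp only [one_mul, sub_self, zero_mul, add_zero, Nat.cast_one, Real.log_one]
    exact mul_nonneg (by linarith) hq0
  have h2 : (2 : ℝ) ≤ r := by exact_mod_cast h
  have hrq' : (r : ℝ) ≤ q := by exact_mod_cast hrq
  rw [← add_mul]
  refine (Real.log_le_log (by linarith) hrq').trans (le_mul_of_one_le_left hq0 ?_)
  push_cast
  have h5 : 1 - 1 / ((r : ℝ) * b') + (1 / (b' : ℝ) - 1 / ((r : ℝ) * b')) =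
      1 + (r - 2) / (r * b') := by
    field_simp
    ring
  rw [h5]
  have : 0 ≤ ((r : ℝ) - 2) / (r * b') := div_nonneg (by linarith) (by positivity)
  linarith

section Chain

variable {b : ℕ → ℕ} {e q : ℕ}

lemma exists_ratio_of_chain (hb : ∀ k, 1 ≤ b k) (hdvd : ∀ k, b (k + 1) ∣ b k)
    (hle : ∀ k < e, b k ≤ q * b (k + 1)) {k : ℕ} (hk : k < e) :
    ∃ r, 1 ≤ r ∧ r ≤ q ∧ r ≤ b k ∧ b k = r * b (k + 1) ∧
      Real.log (b k) - Real.log (b (k + 1)) = Real.log r := by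
  obtain ⟨r, hr⟩ := hdvd k
  rw [mul_comm] at hr
  have h1 := hb k
  have h2 := hb (k + 1)
  have hr1 : 1 ≤ r := by
    rcases Nat.eq_zero_or_pos r with h | h
    · rw [h, zero_mul] at hr; omega
    · exact h
  refine ⟨r, hr1, ?_, ?_, hr, ?_⟩
  · have := hle k hk
    rw [hr] at this
    exact Nat.le_of_mul_le_mul_right this h2
  · rw [hr]; exact Nat.le_mul_of_pos_right r h2
  · rw [hr, Nat.cast_mul, Real.log_mul (by positivity) (by positivity), add_sub_cancel_right]

lemma sum_log_chain (he : b e = 1) :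
    ∑ k ∈ Finset.range e, (Real.log (b k) - Real.log (b (k + 1))) = Real.log (b 0) := by
  rw [Finset.sum_range_sub' (fun k => Real.log (b k)), he]
  simp

lemma log_chain_le_of_large (hb : ∀ k, 1 ≤ b k) (he : b e = 1)
    (hdvd : ∀ k, b (k + 1) ∣ b k) (hle : ∀ k < e, b k ≤ q * b (k + 1))
    {ε : ℝ} (hε : 0 < ε) (hq : (1 / ε + 1) ^ 2 ≤ q) :
    Real.log (b 0) ≤
      (1 + ε) * ((∑ k ∈ Finset.range e, (1 - 1 / (b k : ℝ))) * Real.log q) := by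
  rw [← sum_log_chain he, Finset.sum_mul, Finset.mul_sum]
  refine Finset.sum_le_sum fun k hk => ?_
  obtain ⟨r, hr1, hrq, hrb, -, hlog⟩ :=
    exists_ratio_of_chain hb hdvd hle (Finset.mem_range.1 hk)
  rw [hlog, ← mul_assoc]
  exact log_le_mul_of_large hε hq hr1 hrq hrb

lemma log_chain_le (hb : ∀ k, 1 ≤ b k) (he : b e = 1) (hdvd : ∀ k, b (k + 1) ∣ b k)
    (hle : ∀ k < e, b k ≤ q * b (k + 1)) :
    Real.log (b 0) ≤
      (∑ k ∈ Finset.range e, (1 - 1 / (b k : ℝ))) * Real.log q + Real.log q := by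
  have h1 : ∑ k ∈ Finset.range e, (1 / (b (k + 1) : ℝ) - 1 / (b k : ℝ)) ≤ 1 := by
    rw [Finset.sum_range_sub (fun k => 1 / (b k : ℝ)), he]
    simp
  have h2 := mul_le_mul_of_nonneg_right h1 (Real.log_natCast_nonneg q)
  rw [one_mul] at h2
  refine le_trans ?_ (add_le_add_right h2 _)
  rw [← sum_log_chain he, Finset.sum_mul, Finset.sum_mul, ← Finset.sum_add_distrib]
  refine Finset.sum_le_sum fun k hk => ?_
  obtain ⟨r, hr1, hrq, -, hr, hlog⟩ :=
    exists_ratio_of_chain hb hdvd hle (Finset.mem_range.1 hk)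
  rw [hlog, hr]
  exact log_le_mul_add hr1 hrq (hb _)

end Chain

/-- The order of a quotient of the narrow ray class group modulo `𝔮`, in terms of a bound `Q` for
the conductors of its characters and the number `T.card` of narrow ideal classes. -/
lemma RayHom.card_le {ε : ℝ} (hε : 0 < ε) {𝔮 : Ideal (𝓞 K)} {G : Type*} [CommGroup G]
    (f : RayHom 𝔮 G) [Finite G] (h0 : 𝔮 ≠ ⊥) (h1 : 𝔮 ≠ ⊤) {Q : ℕ} (hQ1 : 1 ≤ Q)
    (hQ : ∀ (χ : G →* ℂˣ) (𝔣 : Ideal (𝓞 K)), IsConductor (f.heckeChar χ) 𝔣 →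
      Ideal.absNorm 𝔣 ≤ Q) {X : Type*} (T : Finset X)
    (c : Ideal (𝓞 K) → X) (hc : ∀ 𝔞, 𝔞 ≠ ⊥ → c 𝔞 ∈ T)
    (h : ∀ 𝔞 𝔟, 𝔞 ≠ ⊥ → 𝔟 ≠ ⊥ → c 𝔞 = c 𝔟 → ∃ α β : 𝓞 K, α ≠ 0 ∧ β ≠ 0 ∧
        TotPos K α ∧ TotPos K β ∧ Ideal.span {α} * 𝔞 = Ideal.span {β} * 𝔟) :
    (Nat.card G : ℝ) ≤ Real.exp (⌈(1 / ε + 1) ^ 2⌉₊ * Real.log ((1 / ε + 1) ^ 2) * nK K) *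
      T.card * (Q : ℝ) ^ (1 + ε) := by
  classical
  set P : ℝ := (1 / ε + 1) ^ 2 with hP
  have hP1 : 1 ≤ P := one_le_pow₀ (by have : 0 < 1 / ε := by positivity
                                      linarith)
  have hlogP : 0 ≤ Real.log P := Real.log_nonneg hP1
  set S := (UniqueFactorizationMonoid.normalizedFactors 𝔮).toFinset with hSdef
  have hS : ∀ 𝔭 ∈ S, Prime 𝔭 := fun 𝔭 h𝔭 =>
    UniqueFactorizationMonoid.prime_of_normalized_factor _ (Multiset.mem_toFinset.1 h𝔭)
  set e : Ideal (𝓞 K) → ℕ :=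
    fun 𝔭 => (UniqueFactorizationMonoid.normalizedFactors 𝔮).count 𝔭
  have h𝔮 : 𝔮 = ∏ 𝔭 ∈ S, 𝔭 ^ e 𝔭 := eq_prod_pow_count h0 S subset_rfl
  set b : Ideal (𝓞 K) → ℕ → ℕ := fun 𝔭 k => Nat.card (f.localSubgroup h0 S e 𝔭 k)
  have hb : ∀ 𝔭 k, 1 ≤ b 𝔭 k := fun 𝔭 k => Nat.card_pos
  have he : ∀ 𝔭, b 𝔭 (e 𝔭) = 1 := fun 𝔭 => by
    simp only [b]
    rw [f.localSubgroup_self h0 h𝔮, Subgroup.card_bot]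
  have hdvd : ∀ 𝔭 k, b 𝔭 (k + 1) ∣ b 𝔭 k := fun 𝔭 k =>
    Subgroup.card_dvd_of_le (f.localSubgroup_anti h0 S e 𝔭 k.le_succ)
  have hle : ∀ 𝔭 ∈ S, ∀ k < e 𝔭, b 𝔭 k ≤ Ideal.absNorm 𝔭 * b 𝔭 (k + 1) := fun 𝔭 h𝔭 k hk =>
    f.card_localSubgroup_le h0 h𝔮 h𝔭 hk
  set A : Ideal (𝓞 K) → ℝ :=
    fun 𝔭 => (∑ k ∈ Finset.range (e 𝔭), (1 - 1 / (b 𝔭 k : ℝ))) * Real.log (Ideal.absNorm 𝔭)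
  have hA0 : ∀ 𝔭, 0 ≤ A 𝔭 := fun 𝔭 => mul_nonneg (Finset.sum_nonneg fun k _ => by
    have : (1 : ℝ) ≤ b 𝔭 k := by exact_mod_cast hb 𝔭 k
    rw [sub_nonneg, div_le_one (by linarith)]
    exact this) (Real.log_natCast_nonneg _)
  have hA : ∑ 𝔭 ∈ S, A 𝔭 ≤ Real.log Q := f.sum_sum_le_log h0 h1 hS h𝔮 hQ1 hQ
  set F := S.filter fun 𝔭 => (Ideal.absNorm 𝔭 : ℝ) < P
  have hF : (F.card : ℝ) ≤ nK K * ⌈P⌉₊ :=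
    card_small_primes_le F (fun 𝔭 h𝔭 => hS 𝔭 (Finset.mem_filter.1 h𝔭).1) ⌈P⌉₊ fun 𝔭 h𝔭 => by
      exact_mod_cast (Finset.mem_filter.1 h𝔭).2.le.trans (Nat.le_ceil P)
  have hloc : ∀ 𝔭 ∈ S, Real.log (b 𝔭 0) ≤ (1 + ε) * A 𝔭 +
      if (Ideal.absNorm 𝔭 : ℝ) < P then Real.log P else 0 := by
    intro 𝔭 h𝔭
    split_ifs with hlt
    · have h2 := log_chain_le (hb 𝔭) (he 𝔭) (hdvd 𝔭) (hle 𝔭 h𝔭)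
      have h3 : Real.log (Ideal.absNorm 𝔭) ≤ Real.log P :=
        Real.log_le_log (by exact_mod_cast (two_le_absNorm (hS 𝔭 h𝔭)).trans' one_le_two) hlt.le
      have h4 := mul_nonneg hε.le (hA0 𝔭)
      have h5 : Real.log (b 𝔭 0) ≤ A 𝔭 + Real.log (Ideal.absNorm 𝔭) := h2
      linarith
    · rw [add_zero]
      exact log_chain_le_of_large (hb 𝔭) (he 𝔭) (hdvd 𝔭) (hle 𝔭 h𝔭) hε (not_lt.1 hlt)
  have hsum : ∑ 𝔭 ∈ S, Real.log (b 𝔭 0) ≤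
      (1 + ε) * Real.log Q + ⌈P⌉₊ * Real.log P * nK K := by
    refine (Finset.sum_le_sum hloc).trans ?_
    rw [Finset.sum_add_distrib, ← Finset.mul_sum, ← Finset.sum_filter, Finset.sum_const,
      nsmul_eq_mul]
    have h2 := mul_le_mul_of_nonneg_left hA (by linarith : 0 ≤ 1 + ε)
    have h3 := mul_le_mul_of_nonneg_right hF hlogP
    linarith
  have hQ0 : (0 : ℝ) < Q := by exact_mod_cast hQ1
  have hprod : (∏ 𝔭 ∈ S, (b 𝔭 0 : ℝ)) ≤
      Real.exp (⌈P⌉₊ * Real.log P * nK K) * (Q : ℝ) ^ (1 + ε) := by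
    have hpos : ∀ 𝔭, (0 : ℝ) < b 𝔭 0 := fun 𝔭 => by exact_mod_cast hb 𝔭 0
    rw [← Real.exp_log (Finset.prod_pos fun 𝔭 _ => hpos 𝔭),
      Real.log_prod fun 𝔭 _ => (hpos 𝔭).ne', Real.rpow_def_of_pos hQ0, ← Real.exp_add]
    refine Real.exp_le_exp.2 ?_
    linarith
  have h2 : (Nat.card G : ℝ) ≤ (∏ 𝔭 ∈ S, (b 𝔭 0 : ℝ)) * T.card := by
    have h3 := (f.card_le_card_mul h0 h1 T c hc h).trans
      (Nat.mul_le_mul_right _ (f.card_raySubgroup_top_le h0 hS h𝔮))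
    exact_mod_cast h3
  calc (Nat.card G : ℝ) ≤ _ := h2
    _ ≤ _ := mul_le_mul_of_nonneg_right hprod (Nat.cast_nonneg _)
    _ = _ := by ring

section Coset

variable {𝔮 : Ideal (𝓞 K)}

lemma rayEquiv_of_eq_mul {𝔞 𝔟 : Ideal (𝓞 K)} {δ : 𝓞 K} (hδ : TotPos K δ) (hδ1 : δ - 1 ∈ 𝔮)
    (h : 𝔞 = Ideal.span {δ} * 𝔟) : rayEquiv 𝔮 𝔞 𝔟 :=
  ⟨1, δ, totPos_one, hδ, by simp, hδ1, by simp [h, ← Ideal.one_eq_top]⟩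

lemma rayEquiv_refl (𝔞 : Ideal (𝓞 K)) : rayEquiv 𝔮 𝔞 𝔞 :=
  rayEquiv_of_eq_mul totPos_one (by simp) (by simp [← Ideal.one_eq_top])

lemma rayEquiv.symm {𝔞 𝔟 : Ideal (𝓞 K)} (h : rayEquiv 𝔮 𝔞 𝔟) : rayEquiv 𝔮 𝔟 𝔞 := by
  obtain ⟨α, β, hα, hβ, hα1, hβ1, h⟩ := h
  exact ⟨β, α, hβ, hα, hβ1, hα1, h.symm⟩

lemma rayEquiv.trans {𝔞 𝔟 𝔠 : Ideal (𝓞 K)} (h : rayEquiv 𝔮 𝔞 𝔟) (h' : rayEquiv 𝔮 𝔟 𝔠) :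
    rayEquiv 𝔮 𝔞 𝔠 := by
  obtain ⟨α, β, hα, hβ, hα1, hβ1, h⟩ := h
  obtain ⟨γ, δ, hγ, hδ, hγ1, hδ1, h'⟩ := h'
  have hmem : ∀ x y : 𝓞 K, x - 1 ∈ 𝔮 → y - 1 ∈ 𝔮 → x * y - 1 ∈ 𝔮 := fun x y hx hy => by
    have : x * y - 1 = y * (x - 1) + (y - 1) := by ring
    rw [this]
    exact add_mem (Ideal.mul_mem_left _ _ hx) hy
  refine ⟨α * γ, β * δ, hα.mul hγ, hβ.mul hδ, hmem _ _ hα1 hγ1, hmem _ _ hβ1 hδ1, ?_⟩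
  rw [← Ideal.span_singleton_mul_span_singleton, ← Ideal.span_singleton_mul_span_singleton,
    mul_right_comm, h, mul_assoc (Ideal.span {β}) (Ideal.span {δ}), ← h']
  ring

lemma rayEquiv.mul_right {𝔞 𝔟 : Ideal (𝓞 K)} (h : rayEquiv 𝔮 𝔞 𝔟) (𝔠 : Ideal (𝓞 K)) :
    rayEquiv 𝔮 (𝔞 * 𝔠) (𝔟 * 𝔠) := by
  obtain ⟨α, β, hα, hβ, hα1, hβ1, h⟩ := h
  exact ⟨α, β, hα, hβ, hα1, hβ1, by rw [← mul_assoc, h, mul_assoc]⟩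

variable (H : CongClassGroup K 𝔮)

lemma CongClassGroup.one_mem : H.mem 1 := by
  rw [Ideal.one_eq_top, ← Ideal.span_singleton_one]
  exact H.princ_mem' 1 totPos_one (by simp)

lemma CongClassGroup.pow_mem {𝔞 : Ideal (𝓞 K)} (h : H.mem 𝔞) (n : ℕ) : H.mem (𝔞 ^ n) := by
  induction n with
  | zero => rw [pow_zero]; exact H.one_mem
  | succ n ih => rw [pow_succ]; exact H.mul_mem' _ _ ih h

lemma coset_subset_iff {𝔞 𝔟 : Ideal (𝓞 K)} : coset H 𝔞 ⊆ coset H 𝔟 ↔ 𝔞 ∈ coset H 𝔟 := by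
  constructor
  · exact fun h => h ⟨1, H.one_mem, by rw [mul_one]; exact rayEquiv_refl _⟩
  · rintro ⟨𝔥, h𝔥, h⟩ 𝔠 ⟨𝔥', h𝔥', h'⟩
    refine ⟨𝔥 * 𝔥', H.mul_mem' _ _ h𝔥 h𝔥', ?_⟩
    rw [← mul_assoc]
    exact (h.mul_right 𝔥').trans h'

lemma coset_eq_iff {𝔞 𝔟 : Ideal (𝓞 K)} :
    coset H 𝔞 = coset H 𝔟 ↔ 𝔞 ∈ coset H 𝔟 ∧ 𝔟 ∈ coset H 𝔞 := by
  rw [Set.Subset.antisymm_iff, coset_subset_iff, coset_subset_iff]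

lemma coset_eq_of_rayEquiv {𝔞 𝔟 : Ideal (𝓞 K)} (h : rayEquiv 𝔮 𝔞 𝔟) :
    coset H 𝔞 = coset H 𝔟 :=
  (coset_eq_iff H).2 ⟨⟨1, H.one_mem, by rw [mul_one]; exact h.symm⟩,
    ⟨1, H.one_mem, by rw [mul_one]; exact h⟩⟩

lemma mul_mem_coset {𝔞 𝔟 : Ideal (𝓞 K)} (h : 𝔞 ∈ coset H 𝔟) (𝔠 : Ideal (𝓞 K)) :
    𝔞 * 𝔠 ∈ coset H (𝔟 * 𝔠) := by
  obtain ⟨𝔥, h𝔥, h⟩ := h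
  exact ⟨𝔥, h𝔥, by rw [mul_right_comm]; exact h.mul_right 𝔠⟩

lemma coset_mul_eq {𝔞 𝔟 : Ideal (𝓞 K)} (h : coset H 𝔞 = coset H 𝔟) (𝔠 : Ideal (𝓞 K)) :
    coset H (𝔞 * 𝔠) = coset H (𝔟 * 𝔠) := by
  rw [coset_eq_iff] at h ⊢
  exact ⟨mul_mem_coset H h.1 𝔠, mul_mem_coset H h.2 𝔠⟩

variable (𝔮) in
/-- The monoid of integral ideals coprime to `𝔮`. -/
def coprimeIdeals : Submonoid (Ideal (𝓞 K)) where
  carrier := {𝔞 | IsCoprime 𝔞 𝔮}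
  one_mem' := isCoprime_one_left
  mul_mem' h𝔞 h𝔟 := IsCoprime.mul_left h𝔞 h𝔟

/-- The congruence on ideals coprime to `𝔮` defined by equality of cosets of `H`. -/
def cosetCon : Con (coprimeIdeals 𝔮) where
  toSetoid := Setoid.ker fun 𝔞 => coset H 𝔞
  mul' {𝔞 𝔟 𝔠 𝔡} h h' := by
    change coset H (𝔞 * 𝔠 : Ideal (𝓞 K)) = coset H (𝔟 * 𝔡 : Ideal (𝓞 K))
    rw [coset_mul_eq H h, mul_comm (𝔟 : Ideal (𝓞 K)), mul_comm (𝔟 : Ideal (𝓞 K)),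
      coset_mul_eq H h']

lemma cosetCon_eq {𝔞 𝔟 : coprimeIdeals 𝔮} :
    (𝔞 : (cosetCon H).Quotient) = 𝔟 ↔ coset H (𝔞 : Ideal (𝓞 K)) = coset H 𝔟 :=
  (cosetCon H).eq

lemma exists_mul_eq_one (h0 : 𝔮 ≠ ⊥) (h1 : 𝔮 ≠ ⊤) (x : (cosetCon H).Quotient) :
    ∃ y, y * x = 1 := by
  induction x using Con.induction_on with
  | H 𝔞 =>
    obtain ⟨δ, 𝔠, hδ, -, hδ1, hδ𝔠, h𝔠⟩ := exists_totPos_span_eq_mul h0 h1 le_rfl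
      (ne_bot_of_isCoprime h1 𝔞.2) 𝔞.2
    refine ⟨((⟨𝔠, h𝔠⟩ : coprimeIdeals 𝔮) : (cosetCon H).Quotient), ?_⟩
    rw [← Con.coe_mul, ← Con.coe_one, cosetCon_eq]
    refine coset_eq_of_rayEquiv H (rayEquiv_of_eq_mul hδ hδ1 ?_)
    change 𝔠 * 𝔞 = _ * 1
    rw [hδ𝔠, mul_one, mul_comm]

/-- The quotient `I(𝔮)/H`. -/
abbrev cosetGroup (h0 : 𝔮 ≠ ⊥) (h1 : 𝔮 ≠ ⊤) : CommGroup (cosetCon H).Quotient where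
  inv x := (exists_mul_eq_one H h0 h1 x).choose
  inv_mul_cancel x := (exists_mul_eq_one H h0 h1 x).choose_spec
  mul_comm := mul_comm

lemma card_cosetCon : Nat.card (cosetCon H).Quotient = hH H := by
  refine Nat.card_congr ((Setoid.quotientKerEquivRange
    fun 𝔞 : coprimeIdeals 𝔮 => coset H 𝔞).trans (Equiv.subtypeEquivRight fun C => ?_))
  constructor
  · rintro ⟨𝔞, rfl⟩
    exact ⟨𝔞, 𝔞.2, rfl⟩
  · rintro ⟨𝔞, h𝔞, rfl⟩
    exact ⟨⟨𝔞, h𝔞⟩, rfl⟩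

open scoped Classical in
/-- The projection from ideals coprime to `𝔮` to `I(𝔮)/H`. -/
def cosetRayHom (h0 : 𝔮 ≠ ⊥) (h1 : 𝔮 ≠ ⊤) :
    letI := cosetGroup H h0 h1
    RayHom 𝔮 (cosetCon H).Quotient :=
  letI := cosetGroup H h0 h1
  { toFun := fun 𝔞 => if h : IsCoprime 𝔞 𝔮 then
      ((⟨𝔞, h⟩ : coprimeIdeals 𝔮) : (cosetCon H).Quotient) else 1
    map_mul' := fun 𝔞 𝔟 h𝔞 h𝔟 => by
      rw [dif_pos h𝔞, dif_pos h𝔟, dif_pos (h𝔞.mul_left h𝔟)]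
      rfl
    ray_one' := fun α hα hα1 => by
      rw [dif_pos (isCoprime_of_sub_one_mem hα1)]
      exact (cosetCon_eq H).2 (coset_eq_of_rayEquiv H
        (rayEquiv_of_eq_mul hα hα1 (mul_one _).symm))
    surj' := fun x => by
      induction x using Con.induction_on with
      | H 𝔞 => exact ⟨𝔞, 𝔞.2, dif_pos 𝔞.2⟩ }

lemma cosetRayHom_eq_iff (h0 : 𝔮 ≠ ⊥) (h1 : 𝔮 ≠ ⊤) {𝔞 𝔟 : Ideal (𝓞 K)} (h𝔞 : IsCoprime 𝔞 𝔮)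
    (h𝔟 : IsCoprime 𝔟 𝔮) :
    letI := cosetGroup H h0 h1
    (cosetRayHom H h0 h1).toFun 𝔞 = (cosetRayHom H h0 h1).toFun 𝔟 ↔ coset H 𝔞 = coset H 𝔟 := by
  simp only [cosetRayHom, dif_pos h𝔞, dif_pos h𝔟, cosetCon_eq]

lemma RayHom.map_one {G : Type*} [CommGroup G] (f : RayHom 𝔮 G) : f.toFun 1 = 1 := by
  rw [Ideal.one_eq_top, ← Ideal.span_singleton_one]
  exact f.ray_one' 1 totPos_one (by simp)

lemma RayHom.map_pow {G : Type*} [CommGroup G] (f : RayHom 𝔮 G) {𝔞 : Ideal (𝓞 K)}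
    (h : IsCoprime 𝔞 𝔮) (n : ℕ) : f.toFun (𝔞 ^ n) = f.toFun 𝔞 ^ n := by
  induction n with
  | zero => rw [pow_zero, pow_zero, f.map_one]
  | succ n ih => rw [pow_succ, pow_succ, f.map_mul' _ _ h.pow_left h, ih]

lemma charTrivOn_heckeChar (h0 : 𝔮 ≠ ⊥) (h1 : 𝔮 ≠ ⊤) [Finite (cosetCon H).Quotient] :
    letI := cosetGroup H h0 h1
    ∀ χ : (cosetCon H).Quotient →* ℂˣ, CharTrivOn ((cosetRayHom H h0 h1).heckeChar χ) H := by
  let _ := cosetGroup H h0 h1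
  intro χ 𝔥 h𝔥
  have hc := H.coprime' 𝔥 h𝔥
  obtain ⟨n, hn⟩ := Nat.exists_eq_succ_of_ne_zero
    (Nat.card_pos (α := (cosetCon H).Quotient)).ne'
  have h2 : (cosetRayHom H h0 h1).toFun (𝔥 ^ (n + 1)) = (cosetRayHom H h0 h1).toFun 1 := by
    rw [RayHom.map_pow _ hc, RayHom.map_one, ← Nat.succ_eq_add_one, ← hn, pow_card_eq_one']
  rw [cosetRayHom_eq_iff H h0 h1 hc.pow_left isCoprime_one_left, coset_eq_iff] at h2
  obtain ⟨𝔨, h𝔨, h3⟩ := h2.2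
  have h4 : 𝔥 ∈ coset H 1 := ⟨𝔥, h𝔥, by rw [one_mul]; exact rayEquiv_refl _⟩
  have h5 : 1 ∈ coset H 𝔥 := ⟨𝔥 ^ n * 𝔨, H.mul_mem' _ _ (H.pow_mem h𝔥 n) h𝔨, by
    rwa [← mul_assoc, ← pow_succ']⟩
  rw [RayHom.heckeChar_apply _ _ hc, (cosetRayHom_eq_iff H h0 h1 hc isCoprime_one_left).2
    ((coset_eq_iff H).2 ⟨h4, h5⟩), RayHom.map_one, _root_.map_one, Units.val_one]

variable (𝔮) in
open scoped Classical in
/-- The principal character modulo `𝔮`. -/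
def trivialChar : HeckeChar K 𝔮 where
  toFun 𝔞 := if IsCoprime 𝔞 𝔮 then 1 else 0
  map_mul' 𝔞 𝔟 := by
    by_cases h𝔞 : IsCoprime 𝔞 𝔮 <;> simp [h𝔞, IsCoprime.mul_left_iff]
  eq_zero' 𝔞 h := if_neg h
  norm_one' 𝔞 h := by simp [h]
  ray_one' α _ h := if_pos (isCoprime_of_sub_one_mem h)

lemma trivialChar_apply {𝔞 : Ideal (𝓞 K)} (h : IsCoprime 𝔞 𝔮) :
    (trivialChar 𝔮).toFun 𝔞 = 1 := if_pos h

lemma isCoprime_top {R : Type*} [CommRing R] (𝔞 : Ideal R) : IsCoprime 𝔞 ⊤ := by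
  rw [Ideal.isCoprime_iff_sup_eq, sup_top_eq]

lemma bddAbove_absNorm_conductor : BddAbove {n | ∃ (χ : HeckeChar K 𝔮) (𝔣 : Ideal (𝓞 K)),
    CharTrivOn χ H ∧ IsConductor χ 𝔣 ∧ n = Ideal.absNorm 𝔣} := by
  by_cases h0 : 𝔮 = ⊥
  · refine ⟨1, ?_⟩
    rintro n ⟨χ, 𝔣, -, h𝔣, rfl⟩
    have h1 : 𝔣 = ⊤ := top_le_iff.1 (h𝔣.2 ⊤ ⟨trivialChar ⊤, le_top, fun 𝔞 h𝔞 => by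
      rw [h0, Ideal.isCoprime_iff_sup_eq, sup_bot_eq] at h𝔞
      rw [trivialChar_apply (isCoprime_top _), h𝔞, ← Ideal.span_singleton_one]
      exact χ.ray_one' 1 totPos_one (by simp)⟩)
    rw [h1, Ideal.absNorm_top]
  · refine ⟨Ideal.absNorm 𝔮, ?_⟩
    rintro n ⟨χ, 𝔣, -, ⟨⟨χ', hle, -⟩, -⟩, rfl⟩
    exact Nat.le_of_dvd (Nat.pos_of_ne_zero (Ideal.absNorm_eq_zero_iff.not.2 h0))
      (Ideal.absNorm_dvd_absNorm_of_le hle)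

lemma one_le_QH : 1 ≤ QH H :=
  le_csSup (bddAbove_absNorm_conductor H) ⟨trivialChar 𝔮, ⊤,
    fun 𝔞 h𝔞 => trivialChar_apply (H.coprime' 𝔞 h𝔞),
    ⟨⟨trivialChar ⊤, le_top, fun 𝔞 h𝔞 => by
      rw [trivialChar_apply h𝔞, trivialChar_apply (isCoprime_top _)]⟩, fun _ _ => le_top⟩,
    by rw [Ideal.absNorm_top]⟩

end Coset

lemma hH_le_one_of_eq_bot {𝔮 : Ideal (𝓞 K)} (H : CongClassGroup K 𝔮) (h0 : 𝔮 = ⊥) :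
    hH H ≤ 1 := by
  have hs : Subsingleton {C : Set (Ideal (𝓞 K)) // ∃ 𝔞₀, IsCoprime 𝔞₀ 𝔮 ∧ C = coset H 𝔞₀} := by
    refine ⟨?_⟩
    rintro ⟨_, 𝔞, h𝔞, rfl⟩ ⟨_, 𝔟, h𝔟, rfl⟩
    rw [h0, Ideal.isCoprime_iff_sup_eq, sup_bot_eq] at h𝔞 h𝔟
    rw [Subtype.mk.injEq, h𝔞, h𝔟]
  exact Finite.card_le_one_iff_subsingleton.2 hs

lemma hH_le_of_eq_top {𝔮 : Ideal (𝓞 K)} (H : CongClassGroup K 𝔮) (h1 : 𝔮 = ⊤)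
    {X : Type*} (T : Finset X) (c : Ideal (𝓞 K) → X) (hc : ∀ 𝔞, 𝔞 ≠ ⊥ → c 𝔞 ∈ T)
    (h : ∀ 𝔞 𝔟, 𝔞 ≠ ⊥ → 𝔟 ≠ ⊥ → c 𝔞 = c 𝔟 → ∃ α β : 𝓞 K, α ≠ 0 ∧ β ≠ 0 ∧
        TotPos K α ∧ TotPos K β ∧ Ideal.span {α} * 𝔞 = Ideal.span {β} * 𝔟) :
    hH H ≤ T.card + 1 := by
  classical
  choose r hr hrC using fun C : {C : Set (Ideal (𝓞 K)) //
    ∃ 𝔞₀, IsCoprime 𝔞₀ 𝔮 ∧ C = coset H 𝔞₀} => C.2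
  let F : {C : Set (Ideal (𝓞 K)) // ∃ 𝔞₀, IsCoprime 𝔞₀ 𝔮 ∧ C = coset H 𝔞₀} → Option T :=
    fun C => if hC : r C = ⊥ then none else some ⟨c (r C), hc _ hC⟩
  have hF : Function.Injective F := by
    intro C D hCD
    refine Subtype.ext ?_
    rw [hrC C, hrC D]
    by_cases hC : r C = ⊥ <;> by_cases hD : r D = ⊥
    · rw [hC, hD]
    · simp [F, hC, hD] at hCD
    · simp [F, hC, hD] at hCD
    · have h2 : c (r C) = c (r D) := by simpa [F, hC, hD] using hCD
      obtain ⟨α, β, -, -, hα, hβ, hαβ⟩ := h _ _ hC hD h2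
      exact coset_eq_of_rayEquiv H ⟨α, β, hα, hβ, by simp [h1], by simp [h1], hαβ⟩
  have := Nat.card_le_card_of_injective F hF
  rwa [Nat.card_eq_fintype_card (α := Option T), Fintype.card_option, Fintype.card_coe] at this

/-- **Bound for `h_H`** (Lemma 2.11). For any congruence class group `H` of `K` and any
`ε > 0`, `h_H ≤ e^{O_ε(n_K)} D_K^{1/2+ε} Q^{1+ε}`. -/
theorem hH_bound :
    ∀ ε : ℝ, 0 < ε →
    ∃ C : ℝ, 0 < C ∧
      ∀ (K : Type) [Field K] [NumberField K] (𝔮 : Ideal (𝓞 K))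
        (H : CongClassGroup K 𝔮),
        (hH H : ℝ) ≤ Real.exp (C * (nK K : ℝ)) *
          (DK K : ℝ) ^ ((1 : ℝ) / 2 + ε) * (QH H : ℝ) ^ ((1 : ℝ) + ε) := by
  intro ε hε
  obtain ⟨C₀, hC₀, hnarrow⟩ := narrow_class_bound ε hε
  set C₁ : ℝ := ⌈(1 / ε + 1) ^ 2⌉₊ * Real.log ((1 / ε + 1) ^ 2)
  have hC₁ : 0 ≤ C₁ := mul_nonneg (Nat.cast_nonneg _) (Real.log_nonneg (one_le_pow₀ (by
    have : 0 < 1 / ε := by positivity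
    linarith)))
  refine ⟨C₀ + C₁ + 1, by linarith, fun K _ _ 𝔮 H => ?_⟩
  obtain ⟨X, T, c, hcT, hT, hc⟩ := hnarrow K
  have hn : (1 : ℝ) ≤ nK K := by exact_mod_cast (Module.finrank_pos : 0 < Module.finrank ℚ K)
  have hD : 1 ≤ (DK K : ℝ) ^ ((1 : ℝ) / 2 + ε) :=
    Real.one_le_rpow (one_le_DK K) (by linarith)
  have hQ1 := one_le_QH H
  have hQ : 1 ≤ (QH H : ℝ) ^ ((1 : ℝ) + ε) :=
    Real.one_le_rpow (by exact_mod_cast hQ1) (by linarith)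
  have hE₀ : 1 ≤ Real.exp (C₀ * nK K) := Real.one_le_exp (by positivity)
  have hE₁ : 1 ≤ Real.exp (C₁ * nK K) := Real.one_le_exp (by positivity)
  have hE₂ : 2 ≤ Real.exp (nK K) := by linarith [Real.add_one_le_exp (nK K : ℝ)]
  rw [add_mul, add_mul, one_mul, Real.exp_add, Real.exp_add]
  set D := (DK K : ℝ) ^ ((1 : ℝ) / 2 + ε)
  set Q := (QH H : ℝ) ^ ((1 : ℝ) + ε)
  set E₀ := Real.exp (C₀ * nK K)
  set E₁ := Real.exp (C₁ * nK K)
  set E₂ := Real.exp (nK K)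
  have hE₀D : 1 ≤ E₀ * D := one_le_mul_of_one_le_of_one_le hE₀ hD
  have hfin : ∀ x : ℝ, 0 ≤ x → x ≤ E₁ * E₂ → (hH H : ℝ) ≤ x * (E₀ * D) * Q →
      (hH H : ℝ) ≤ E₀ * E₁ * E₂ * D * Q := fun x _ hx h => by
    refine h.trans ?_
    have h2 : x * (E₀ * D) * Q ≤ E₁ * E₂ * (E₀ * D) * Q := by gcongr
    refine h2.trans (le_of_eq ?_)
    ring
  by_cases h0 : 𝔮 = ⊥
  · refine hfin 1 zero_le_one (by nlinarith) ?_
    have h2 : (hH H : ℝ) ≤ 1 := by exact_mod_cast hH_le_one_of_eq_bot H h0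
    rw [one_mul]
    exact h2.trans (one_le_mul_of_one_le_of_one_le hE₀D hQ)
  by_cases h1 : 𝔮 = ⊤
  · refine hfin 2 zero_le_two (by nlinarith) ?_
    have h2 : (hH H : ℝ) ≤ T.card + 1 := by exact_mod_cast hH_le_of_eq_top H h1 T c hcT hc
    have h3 : (2 : ℝ) * (E₀ * D) ≤ 2 * (E₀ * D) * Q :=
      le_mul_of_one_le_right (by positivity) hQ
    linarith
  · rcases finite_or_infinite (cosetCon H).Quotient with hf | hf
    · refine hfin E₁ (by positivity) (le_mul_of_one_le_right (by positivity) (by linarith)) ?_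
      let _ := cosetGroup H h0 h1
      have h2 := (cosetRayHom H h0 h1).card_le hε h0 h1 hQ1
        (fun χ 𝔣 h𝔣 => le_csSup (bddAbove_absNorm_conductor H)
          ⟨_, 𝔣, charTrivOn_heckeChar H h0 h1 χ, h𝔣, rfl⟩) T c hcT hc
      rw [card_cosetCon] at h2
      refine h2.trans ?_
      gcongr
    · rw [← card_cosetCon, Nat.card_eq_zero_of_infinite, Nat.cast_zero]
      positivity

end RTZ
end
end

section
/- Let χ (mod 𝔮) be a Hecke character with χ(H)=1, induced by the primitive character χ* (mod 𝔣_χ). Let T ≥ 1, R ≥ 1 sufficiently large, 0 < r₀ < 1/16, ε ∈ (0,1/4), φ = 1 + (4/π)ε + 16ε², and suppose R/ℒ ≤ r < r₀ and |τ| ≤ T. Set E_k(u) = u^k e^{−u}/k!. If the integer k satisfies 25.0·φ·r·ℒ ≤ k ≤ 28.8·φ·r·ℒ, then | Σ_𝔫 (χ*(𝔫) Λ_K(𝔫) / N𝔫^{1+iτ}) · r·E_k(r log N𝔫) | ≤ r² ∫_y^x | Σ_{y ≤ N𝔭 < u} χ*(𝔭)(log N𝔭)/N𝔭^{1+iτ}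 | du/u + O( e^{−16.8·φ·r·ℒ}·(2.01)^{−k} ), provided x,y ≥ 1 satisfy log y ≤ 2.3·φ·ℒ and 122·φ·ℒ ≤ log x ≪ ℒ. -/
open scoped BigOperators
open Complex NumberField Filter Topology

noncomputable section

namespace RTZ

variable {K : Type*} [Field K] [NumberField K]

/-- `E_k(u) = u^k e^{-u} / k!`. -/
def Efun (k : ℕ) (u : ℝ) : ℝ := u ^ k * Real.exp (-u) / (k.factorial : ℝ)

section Geometry

open MeasureTheory
open scoped ENNReal NNReal

/-- If the volume of `s` exceeds `M` times the covolume of `L`, then some translate of `s`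
contains more than `M` lattice points. -/
theorem exists_finset_lattice_vadd_mem {E L : Type*} [MeasurableSpace E] {μ : Measure E}
    {F s : Set E} [AddGroup L] [Countable L] [AddAction L E]
    [MeasurableConstVAdd L E] [VAddInvariantMeasure L E μ] (fund : IsAddFundamentalDomain L F μ)
    (hs : MeasurableSet s) (M : ℕ) (h : M * μ F < μ s) :
    ∃ (x : E) (T : Finset L), M < T.card ∧ ∀ g ∈ T, g +ᵥ x ∈ s := by
  classical
  have key : ∃ x : E, (M : ℝ≥0∞) < ∑' g : L, s.indicator (fun _ => (1 : ℝ≥0∞)) (g +ᵥ x) := by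
    by_contra! hcon
    refine h.not_ge ?_
    calc μ s = ∫⁻ x, s.indicator (fun _ => (1 : ℝ≥0∞)) x ∂μ := by
          rw [lintegral_indicator_const hs, one_mul]
      _ = ∑' g : L, ∫⁻ x in F, s.indicator (fun _ => (1 : ℝ≥0∞)) (g +ᵥ x) ∂μ :=
          fund.lintegral_eq_tsum'' _
      _ = ∫⁻ x in F, ∑' g : L, s.indicator (fun _ => (1 : ℝ≥0∞)) (g +ᵥ x) ∂μ := by
          rw [lintegral_tsum]
          intro g
          exact ((measurable_const.indicator hs).comp (measurable_const_vadd g)).aemeasurable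
      _ ≤ ∫⁻ _ in F, (M : ℝ≥0∞) ∂μ := lintegral_mono fun x => hcon x
      _ = M * μ F := by simp
  obtain ⟨x, hx⟩ := key
  rw [ENNReal.tsum_eq_iSup_sum, lt_iSup_iff] at hx
  obtain ⟨T, hT⟩ := hx
  refine ⟨x, T.filter (fun g => g +ᵥ x ∈ s), ?_, fun g hg => (Finset.mem_filter.mp hg).2⟩
  have : ∑ g ∈ T, s.indicator (fun _ => (1 : ℝ≥0∞)) (g +ᵥ x)
      = ((T.filter (fun g => g +ᵥ x ∈ s)).card : ℝ≥0∞) := by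
    simp [Set.indicator_apply]
  rw [this] at hT
  exact_mod_cast hT

open NumberField.mixedEmbedding NumberField.InfinitePlace in
/-- For every `M` there are `M` algebraic integers whose differences all have norm at most
`2 ^ n * (M + 1) * √|D|`. -/
theorem exists_finset_norm_sub_le (K : Type*) [Field K] [NumberField K] (M : ℕ) :
    ∃ S : Finset (𝓞 K), S.card = M ∧ ∀ a ∈ S, ∀ b ∈ S,
      (Ideal.absNorm (Ideal.span {a - b}) : ℝ) ≤ 2 ^ nK K * ((M + 1) * √(DK K)) := by
  classical
  set n := nK K with hn
  have hn0 : n ≠ 0 := Module.finrank_pos.ne'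
  have hD : (0 : ℝ) < √(DK K) := by
    have : 0 < DK K := Int.natAbs_pos.mpr (NumberField.discr_ne_zero K)
    positivity
  set V : ℝ≥0 := ⟨(M + 1) * √(DK K), by positivity⟩ with hV
  set B : ℝ≥0 := V ^ ((n : ℝ)⁻¹) with hB
  have hBn : B ^ n = V := by
    rw [hB, ← NNReal.rpow_natCast, ← NNReal.rpow_mul, inv_mul_cancel₀ (by exact_mod_cast hn0),
      NNReal.rpow_one]
  set s : Set (mixedSpace K) := convexBodyLT K (fun _ => B)
  have hvol : (M : ℝ≥0∞) * volume (ZSpan.fundamentalDomain (latticeBasis K)) < volume s := by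
    rw [convexBodyLT_volume, volume_fundamentalDomain_latticeBasis, Finset.prod_pow_eq_pow_sum,
      sum_mult_eq]
    change _ < _ * ((B ^ n : ℝ≥0) : ℝ≥0∞)
    rw [hBn]
    have h1 : (M : ℝ≥0∞) * ((2 : ℝ≥0∞)⁻¹ ^ nrComplexPlaces K * (NNReal.sqrt ‖discr K‖₊))
        ≤ M * NNReal.sqrt ‖discr K‖₊ := by
      gcongr
      refine mul_le_of_le_one_left (by positivity) (pow_le_one₀ (by positivity) ?_)
      exact ENNReal.inv_le_one.mpr (by norm_num)
    refine h1.trans_lt (lt_of_lt_of_le (b := (V : ℝ≥0∞)) ?_ ?_)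
    · have : (M : ℝ≥0) * NNReal.sqrt ‖discr K‖₊ < V := by
        rw [← NNReal.coe_lt_coe]
        have e : ((NNReal.sqrt ‖discr K‖₊ : ℝ≥0) : ℝ) = √(DK K) := by
          simp [DK, Int.norm_eq_abs, Nat.cast_natAbs]
        rw [NNReal.coe_mul, e, hV]
        change (M : ℝ) * _ < (M + 1) * _
        nlinarith
      exact_mod_cast this
    · refine le_mul_of_one_le_left (by positivity) ?_
      exact_mod_cast one_le_convexBodyLTFactor K
  have hmeas : MeasurableSet s := by
    refine MeasurableSet.prod ?_ ?_
    · exact MeasurableSet.univ_pi fun _ => measurableSet_ball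
    · exact MeasurableSet.univ_pi fun _ => measurableSet_ball
  have : Countable (mixedEmbedding.integerLattice K).toAddSubgroup :=
    inferInstanceAs (Countable (mixedEmbedding.integerLattice K))
  obtain ⟨x, T, hcard, hT⟩ := exists_finset_lattice_vadd_mem
    (L := (mixedEmbedding.integerLattice K).toAddSubgroup)
    (fundamentalDomain_integerLattice K) hmeas M hvol
  have hpre : ∀ g : (mixedEmbedding.integerLattice K).toAddSubgroup, ∃ a : 𝓞 K, mixedEmbedding K a = g := by
    rintro ⟨_, a, rfl⟩
    exact ⟨a, rfl⟩
  choose f hf using hpre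
  have hfinj : Function.Injective f := by
    intro a b hab
    apply Subtype.ext
    rw [← hf a, ← hf b, hab]
  obtain ⟨S, hS, hSM⟩ := Finset.exists_subset_card_eq
    (s := T.image f) (n := M) (by rw [Finset.card_image_of_injective _ hfinj]; exact hcard.le)
  refine ⟨S, hSM, fun a ha b hb => ?_⟩
  obtain ⟨g, hg, rfl⟩ := Finset.mem_image.mp (hS ha)
  obtain ⟨g', hg', rfl⟩ := Finset.mem_image.mp (hS hb)
  have e1 : (Ideal.absNorm (Ideal.span {f g - f g'}) : ℝ)
      = mixedEmbedding.norm (mixedEmbedding K ((f g - f g' : 𝓞 K) : K)) := by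
    rw [mixedEmbedding.norm_eq_norm, Ideal.absNorm_span_singleton, ← Algebra.coe_norm_int]
    simp [Nat.cast_natAbs]
  have hpl : ∀ y ∈ s, ∀ w, normAtPlace w y ≤ B := by
    intro y hy w
    rcases w.isReal_or_isComplex with hw | hw
    · have := hy.1 ⟨w, hw⟩ (Set.mem_univ _)
      rw [normAtPlace_apply_of_isReal hw]
      simpa using (mem_ball_zero_iff.mp this).le
    · have := hy.2 ⟨w, hw⟩ (Set.mem_univ _)
      rw [normAtPlace_apply_of_isComplex hw]
      simpa using (mem_ball_zero_iff.mp this).le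
  have e2 : mixedEmbedding K ((f g - f g' : 𝓞 K) : K) = (g +ᵥ x) + -(g' +ᵥ x) := by
    have e3 : ((f g - f g' : 𝓞 K) : K) = f g - f g' := rfl
    rw [e3, map_sub, hf, hf, AddSubgroup.vadd_def, AddSubgroup.vadd_def, vadd_eq_add, vadd_eq_add]
    abel
  rw [e1, e2, mixedEmbedding.norm_apply]
  calc ∏ w, normAtPlace w ((g +ᵥ x) + -(g' +ᵥ x)) ^ mult w
      ≤ ∏ w : InfinitePlace K, (2 * B : ℝ) ^ mult w := by
        refine Finset.prod_le_prod (fun w _ => pow_nonneg (normAtPlace_nonneg _ _) _)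
          fun w _ => pow_le_pow_left₀ (normAtPlace_nonneg _ _) ?_ _
        refine (normAtPlace_add_le w _ _).trans ?_
        rw [normAtPlace_neg]
        linarith [hpl _ (hT g hg) w, hpl _ (hT g' hg') w]
    _ = 2 ^ n * (B ^ n : ℝ≥0) := by
        rw [Finset.prod_pow_eq_pow_sum, sum_mult_eq, mul_pow]
        rfl
    _ = _ := by rw [hBn]; rfl

end Geometry

section PrimeSums

open scoped Classical in
theorem card_sq_le_absNorm_mul_card (S : Finset (𝓞 K)) {I : Ideal (𝓞 K)} (hI : I ≠ ⊥) :
    (S.card : ℝ) ^ 2 ≤ Ideal.absNorm I *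
      (((S ×ˢ S).filter fun p : 𝓞 K × 𝓞 K => p.1 - p.2 ∈ I).card : ℝ) := by
  have : Finite (𝓞 K ⧸ I) := Ideal.finiteQuotientOfFreeOfNeBot I hI
  have := Fintype.ofFinite (𝓞 K ⧸ I)
  let c : 𝓞 K ⧸ I → ℕ := fun q => (S.filter fun a => Ideal.Quotient.mk I a = q).card
  have h1 : S.card = ∑ q, c q :=
    Finset.card_eq_sum_card_fiberwise (fun _ _ => Finset.mem_coe.mpr (Finset.mem_univ _))
  have h2 : ((S ×ˢ S).filter fun p => p.1 - p.2 ∈ I).card = ∑ q, c q ^ 2 := by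
    rw [Finset.card_eq_sum_card_fiberwise (f := fun p => Ideal.Quotient.mk I p.1)
      (t := Finset.univ) (fun _ _ => Finset.mem_coe.mpr (Finset.mem_univ _))]
    refine Finset.sum_congr rfl fun q _ => ?_
    rw [sq, ← Finset.card_product]
    congr 1
    ext ⟨a, b⟩
    simp only [Finset.mem_filter, Finset.mem_product]
    rw [← Ideal.Quotient.eq]
    constructor
    · rintro ⟨⟨⟨ha, hb⟩, hab⟩, hq⟩
      exact ⟨⟨ha, hq⟩, hb, hab ▸ hq⟩
    · rintro ⟨⟨ha, hq⟩, hb, hq'⟩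
      exact ⟨⟨⟨ha, hb⟩, hq.trans hq'.symm⟩, hq⟩
  have h3 : Ideal.absNorm I = (Finset.univ : Finset (𝓞 K ⧸ I)).card := by
    rw [Ideal.absNorm_apply, Submodule.cardQuot_apply, Finset.card_univ, Nat.card_eq_fintype_card]
  have h4 : S.card ^ 2 ≤
      Ideal.absNorm I * ((S ×ˢ S).filter fun p => p.1 - p.2 ∈ I).card := by
    rw [h1, h2, h3]
    exact sq_sum_le_card_mul_sum_sq
  exact_mod_cast h4

theorem absNorm_pos_of_ne_bot {I : Ideal (𝓞 K)} (hI : I ≠ ⊥) : 0 < Ideal.absNorm I :=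
  Nat.pos_of_ne_zero (Ideal.absNorm_eq_zero_iff.not.mpr hI)

open scoped Classical in
theorem sum_log_absNorm_le_of_mem (F : Finset (Ideal (𝓞 K)))
    (hF : ∀ 𝔭 ∈ F, 𝔭.IsPrime ∧ 𝔭 ≠ ⊥) {a : 𝓞 K} (ha : a ≠ 0) :
    ∑ 𝔭 ∈ F with a ∈ 𝔭, Real.log (Ideal.absNorm 𝔭) ≤
      Real.log (Ideal.absNorm (Ideal.span {a})) := by
  have hne : Ideal.span {a} ≠ ⊥ := by simpa using ha
  have hdvd : ∏ 𝔭 ∈ F with a ∈ 𝔭, 𝔭 ∣ Ideal.span {a} := by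
    refine Finset.prod_primes_dvd _ (fun 𝔭 h𝔭 => ?_) fun 𝔭 h𝔭 => ?_
    · obtain ⟨h1, h2⟩ := hF 𝔭 (Finset.mem_filter.mp h𝔭).1
      exact Ideal.prime_of_isPrime h2 h1
    · exact Ideal.dvd_span_singleton.mpr (Finset.mem_filter.mp h𝔭).2
  have hle := Nat.le_of_dvd (absNorm_pos_of_ne_bot hne) (map_dvd Ideal.absNorm hdvd)
  have hpos : ∀ 𝔭 ∈ F.filter (a ∈ ·), (Ideal.absNorm 𝔭 : ℝ) ≠ 0 := fun 𝔭 h𝔭 => by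
    exact_mod_cast (absNorm_pos_of_ne_bot (hF 𝔭 (Finset.mem_filter.mp h𝔭).1).2).ne'
  rw [← Real.log_prod hpos]
  refine Real.log_le_log (Finset.prod_pos fun 𝔭 h𝔭 => ?_) ?_
  · exact (hpos 𝔭 h𝔭).symm.lt_of_le (Nat.cast_nonneg _)
  · rw [map_prod] at hle
    exact_mod_cast hle

/-- A Mertens-type upper bound for primes of norm at most `M / 2`. -/
theorem sum_log_absNorm_div_le (F : Finset (Ideal (𝓞 K)))
    (hF : ∀ 𝔭 ∈ F, 𝔭.IsPrime ∧ 𝔭 ≠ ⊥) (M : ℕ) (hM : ∀ 𝔭 ∈ F, 2 * Ideal.absNorm 𝔭 ≤ M) :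
    ∑ 𝔭 ∈ F, Real.log (Ideal.absNorm 𝔭) / Ideal.absNorm 𝔭 ≤
      2 * Real.log (2 ^ nK K * ((M + 1) * √(DK K))) := by
  classical
  set B := Real.log (2 ^ nK K * ((M + 1) * √(DK K)))
  have hD : (1 : ℝ) ≤ √(DK K) := by
    rw [Real.one_le_sqrt]
    exact_mod_cast Int.natAbs_pos.mpr (NumberField.discr_ne_zero K)
  have hB : 0 ≤ B := Real.log_nonneg <| one_le_mul_of_one_le_of_one_le
    (one_le_pow₀ (by norm_num)) (one_le_mul_of_one_le_of_one_le (by simp) hD)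
  rcases F.eq_empty_or_nonempty with rfl | ⟨𝔭₀, h𝔭₀⟩
  · simpa using hB
  have hM0 : (0 : ℝ) < M := by
    have := hM 𝔭₀ h𝔭₀
    have := absNorm_pos_of_ne_bot (hF 𝔭₀ h𝔭₀).2
    exact_mod_cast (by omega : 0 < M)
  obtain ⟨S, hS, hSB⟩ := exists_finset_norm_sub_le K M
  let l : Ideal (𝓞 K) → ℝ := fun 𝔭 => Real.log (Ideal.absNorm 𝔭)
  have hl : ∀ 𝔭, 0 ≤ l 𝔭 := fun 𝔭 => Real.log_natCast_nonneg _
  have hupper : ∑ p ∈ S.offDiag, ∑ 𝔭 ∈ F with p.1 - p.2 ∈ 𝔭, l 𝔭 ≤ M ^ 2 * B := by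
    calc ∑ p ∈ S.offDiag, ∑ 𝔭 ∈ F with p.1 - p.2 ∈ 𝔭, l 𝔭 ≤ ∑ p ∈ S.offDiag, B := by
          refine Finset.sum_le_sum fun p hp => ?_
          obtain ⟨h1, h2, h3⟩ := Finset.mem_offDiag.mp hp
          have hne : p.1 - p.2 ≠ 0 := sub_ne_zero.mpr h3
          refine (sum_log_absNorm_le_of_mem F hF hne).trans ?_
          refine Real.log_le_log ?_ (hSB _ h1 _ h2)
          exact_mod_cast absNorm_pos_of_ne_bot (by simpa using hne)
      _ = (S.offDiag.card : ℝ) * B := by simp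
      _ ≤ M ^ 2 * B := by
          gcongr
          rw [Finset.offDiag_card, hS]
          exact_mod_cast (Nat.sub_le _ _).trans (by rw [sq])
  have hlower : ∀ 𝔭 ∈ F, M ^ 2 / 2 * (l 𝔭 / Ideal.absNorm 𝔭) ≤
      ∑ p ∈ S.offDiag, if p.1 - p.2 ∈ 𝔭 then l 𝔭 else 0 := by
    intro 𝔭 h𝔭
    have hN : (0 : ℝ) < Ideal.absNorm 𝔭 := by
      exact_mod_cast absNorm_pos_of_ne_bot (hF 𝔭 h𝔭).2
    have h2N : 2 * (Ideal.absNorm 𝔭 : ℝ) ≤ M := by exact_mod_cast hM 𝔭 h𝔭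
    have hcs := card_sq_le_absNorm_mul_card S (hF 𝔭 h𝔭).2
    have hsplit : (((S ×ˢ S).filter fun p => p.1 - p.2 ∈ 𝔭).card : ℝ) ≤
        M + ((S.offDiag.filter fun p => p.1 - p.2 ∈ 𝔭).card : ℝ) := by
      have : (S ×ˢ S).filter (fun p => p.1 - p.2 ∈ 𝔭) ⊆
          S.diag ∪ S.offDiag.filter fun p => p.1 - p.2 ∈ 𝔭 := by
        rw [← Finset.diag_union_offDiag, Finset.filter_union]
        exact Finset.union_subset_union (Finset.filter_subset _ _) subset_rfl
      have := (Finset.card_le_card this).trans (Finset.card_union_le _ _)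
      rw [Finset.diag_card, hS] at this
      exact_mod_cast this
    rw [← Finset.sum_filter, Finset.sum_const, nsmul_eq_mul, ← mul_div_assoc,
      mul_comm (M ^ 2 / 2 : ℝ), mul_div_assoc, mul_comm (l 𝔭)]
    refine mul_le_mul_of_nonneg_right ?_ (hl 𝔭)
    rw [div_le_iff₀ hN]
    rw [hS] at hcs
    have h1 := mul_le_mul_of_nonneg_left hsplit hN.le
    have h2 := mul_le_mul_of_nonneg_right h2N hM0.le
    nlinarith
  have hswap : ∑ p ∈ S.offDiag, ∑ 𝔭 ∈ F with p.1 - p.2 ∈ 𝔭, l 𝔭 =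
      ∑ 𝔭 ∈ F, ∑ p ∈ S.offDiag, if p.1 - p.2 ∈ 𝔭 then l 𝔭 else 0 := by
    rw [Finset.sum_comm]
    simp_rw [Finset.sum_filter]
  have htot := (Finset.sum_le_sum hlower).trans (hswap ▸ hupper)
  rw [← Finset.mul_sum] at htot
  have hM2 : (0 : ℝ) < M ^ 2 := by positivity
  nlinarith [htot]

end PrimeSums

section KernelBounds

theorem Efun_nonneg (k : ℕ) {u : ℝ} (hu : 0 ≤ u) : 0 ≤ Efun k u := by
  unfold Efun
  positivity

theorem Efun_le_rpow_mul_exp (k : ℕ) {u a : ℝ} (hu : 0 ≤ u) (ha : 0 < a) :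
    Efun k u ≤ (a ^ k)⁻¹ * Real.exp ((a - 1) * u) := by
  have h := Real.pow_div_factorial_le_exp (a * u) (by positivity) k
  have e : (a - 1) * u = a * u + -u := by ring
  rw [e, Real.exp_add, ← mul_assoc]
  unfold Efun
  rw [mul_div_right_comm]
  refine mul_le_mul_of_nonneg_right ?_ (Real.exp_pos _).le
  rw [← div_eq_inv_mul, le_div_iff₀ (by positivity)]
  calc u ^ k / k.factorial * a ^ k = (a * u) ^ k / k.factorial := by ring
    _ ≤ _ := h

theorem Efun_le_one (k : ℕ) {u : ℝ} (hu : 0 ≤ u) : Efun k u ≤ 1 := by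
  simpa using Efun_le_rpow_mul_exp k hu one_pos

theorem hasDerivAt_Efun_succ (m : ℕ) (u : ℝ) :
    HasDerivAt (Efun (m + 1)) (Efun m u - Efun (m + 1) u) u := by
  have h : HasDerivAt (Efun (m + 1)) _ u :=
    (((hasDerivAt_id u).pow (m + 1)).mul (hasDerivAt_id u).neg.exp).div_const
      ((m + 1).factorial : ℝ)
  refine h.congr_deriv ?_
  have h1 : (m.factorial : ℝ) ≠ 0 := by positivity
  simp only [Efun, Nat.factorial_succ, id, Pi.pow_apply, Pi.neg_apply, Nat.add_sub_cancel]
  push_cast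
  field_simp
  ring

theorem continuous_Efun (k : ℕ) : Continuous (Efun k) := by
  unfold Efun
  fun_prop

theorem Efun_le_of_le {k : ℕ} {u P : ℝ} (hu : 0 ≤ u) (hP : 25.0 * P ≤ k) (huP : u ≤ 2.3 * P) :
    Efun k u ≤ Real.exp (-16.8 * P) * (2.01 ^ k)⁻¹ * 0.99 ^ k * Real.exp (-0.1 * u) := by
  refine (Efun_le_rpow_mul_exp k hu (a := 10) (by norm_num)).trans ?_
  have key : Real.exp (9.1 * u + 16.8 * P) ≤ (10 * 0.99 / 2.01 : ℝ) ^ k := by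
    have h1 : Real.exp 1.51 ≤ (10 * 0.99 / 2.01 : ℝ) := by
      have := Real.one_sub_div_pow_le_exp_neg (n := 100) (t := 1.51) (by norm_num)
      rw [Real.exp_neg] at this
      have h3 : (10 * 0.99 / 2.01 : ℝ)⁻¹ ≤ (Real.exp 1.51)⁻¹ := le_trans (by norm_num) this
      exact (inv_le_inv₀ (by norm_num) (Real.exp_pos _)).mp h3
    calc Real.exp (9.1 * u + 16.8 * P) ≤ Real.exp (k * 1.51) := by
          gcongr
          linarith
      _ = Real.exp 1.51 ^ k := Real.exp_nat_mul _ _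
      _ ≤ _ := by gcongr
  have e1 : Real.exp ((10 - 1) * u) =
      Real.exp (9.1 * u + 16.8 * P) * (Real.exp (-16.8 * P) * Real.exp (-0.1 * u)) := by
    rw [← Real.exp_add, ← Real.exp_add]
    ring_nf
  rw [e1]
  calc ((10 : ℝ) ^ k)⁻¹ *
        (Real.exp (9.1 * u + 16.8 * P) * (Real.exp (-16.8 * P) * Real.exp (-0.1 * u)))
      ≤ ((10 : ℝ) ^ k)⁻¹ *
        ((10 * 0.99 / 2.01 : ℝ) ^ k * (Real.exp (-16.8 * P) * Real.exp (-0.1 * u))) := by gcongr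
    _ = _ := by
        rw [div_pow, mul_pow]
        field_simp

theorem Efun_le_of_ge {k : ℕ} {u P : ℝ} (hu : 0 ≤ u) (hP : k ≤ 28.8 * P) (huP : 122 * P ≤ u) :
    Efun k u ≤ Real.exp (-16.8 * P) * (2.01 ^ k)⁻¹ * 0.99 ^ k * Real.exp (-0.1 * u) := by
  refine (Efun_le_rpow_mul_exp k hu (a := 1 / 4) (by norm_num)).trans ?_
  have key : (4 * 2.01 / 0.99 : ℝ) ^ k ≤ Real.exp (0.65 * u - 16.8 * P) := by
    have h1 : (4 * 2.01 / 0.99 : ℝ) ≤ Real.exp 2.17 := by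
      have h2 : Real.exp 2.17 = Real.exp 0.0217 ^ 100 := by
        rw [← Real.exp_nat_mul]
        norm_num
      have h3 := Real.add_one_le_exp 0.0217
      have h4 : (0.0217 + 1 : ℝ) ^ 100 ≤ Real.exp 0.0217 ^ 100 := by gcongr
      rw [h2]
      exact le_trans (by norm_num) h4
    calc (4 * 2.01 / 0.99 : ℝ) ^ k ≤ Real.exp 2.17 ^ k := by gcongr
      _ = Real.exp (k * 2.17) := (Real.exp_nat_mul _ _).symm
      _ ≤ _ := by
          gcongr
          linarith
  have e1 : Real.exp (-0.1 * u) * Real.exp (-16.8 * P) =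
      Real.exp ((1 / 4 - 1) * u) * Real.exp (0.65 * u - 16.8 * P) := by
    rw [← Real.exp_add, ← Real.exp_add]
    ring_nf
  calc ((1 / 4 : ℝ) ^ k)⁻¹ * Real.exp ((1 / 4 - 1) * u)
      = Real.exp ((1 / 4 - 1) * u) * (4 * 2.01 / 0.99 : ℝ) ^ k * ((2.01 ^ k)⁻¹ * 0.99 ^ k) := by
        rw [div_pow, div_pow, mul_pow]
        field_simp
        simp
    _ ≤ Real.exp ((1 / 4 - 1) * u) * Real.exp (0.65 * u - 16.8 * P) *
        ((2.01 ^ k)⁻¹ * 0.99 ^ k) := by gcongr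
    _ = _ := by
        rw [← e1]
        ring

theorem Efun_le_mul_exp {k : ℕ} {u P : ℝ} (hu : 0 ≤ u) (hP : 25.0 * P ≤ k) :
    Efun k u ≤ Real.exp (-16.8 * P) * (2.01 ^ k)⁻¹ * 0.99 ^ k * Real.exp (3 * u) := by
  refine (Efun_le_rpow_mul_exp k hu (a := 4) (by norm_num)).trans ?_
  have e : (4 - 1 : ℝ) = 3 := by norm_num
  rw [e]
  refine mul_le_mul_of_nonneg_right ?_ (Real.exp_pos _).le
  have key : Real.exp (16.8 * P) ≤ (4 * 0.99 / 2.01 : ℝ) ^ k := by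
    have h1 : Real.exp 0.672 ≤ (4 * 0.99 / 2.01 : ℝ) := by
      have := Real.one_sub_div_pow_le_exp_neg (n := 100) (t := 0.672) (by norm_num)
      rw [Real.exp_neg] at this
      have h3 : (4 * 0.99 / 2.01 : ℝ)⁻¹ ≤ (Real.exp 0.672)⁻¹ := le_trans (by norm_num) this
      exact (inv_le_inv₀ (by norm_num) (Real.exp_pos _)).mp h3
    calc Real.exp (16.8 * P) ≤ Real.exp (k * 0.672) := by
          exact Real.exp_le_exp.mpr (by linarith)
      _ = Real.exp 0.672 ^ k := Real.exp_nat_mul _ _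
      _ ≤ _ := by gcongr
  have e1 : Real.exp (16.8 * P) * Real.exp (-16.8 * P) = 1 := by
    rw [← Real.exp_add]
    simp
  calc ((4 : ℝ) ^ k)⁻¹ = (4 ^ k)⁻¹ * (Real.exp (16.8 * P) * Real.exp (-16.8 * P)) := by
        rw [e1, mul_one]
    _ ≤ (4 ^ k)⁻¹ * ((4 * 0.99 / 2.01 : ℝ) ^ k * Real.exp (-16.8 * P)) := by gcongr
    _ = _ := by
        rw [div_pow, mul_pow]
        field_simp

theorem natCast_mul_pow_le (k : ℕ) : (k : ℝ) * 0.99 ^ k ≤ 100 := by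
  have h := one_add_mul_le_pow (a := (1 / 99 : ℝ)) (by norm_num) k
  have h2 : (1 + 1 / 99 : ℝ) ^ k * 0.99 ^ k = 1 := by
    rw [← mul_pow]
    norm_num
  have h3 : (0 : ℝ) < 0.99 ^ k := by positivity
  nlinarith [mul_le_mul_of_nonneg_right h h3.le]

end KernelBounds

section PartialSummation

open MeasureTheory

theorem norm_sum_mul_le_of_hasDerivAt {ι : Type*} (A : Finset ι) (a : ι → ℂ) (N : ι → ℝ)
    {W W' : ℝ → ℝ} {c x y : ℝ} (hy : 0 < y)
    (hN : ∀ i ∈ A, y ≤ N i ∧ N i < x)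
    (hW : ∀ t ∈ Set.Icc y x, HasDerivAt W (W' t) t) (hW' : ContinuousOn W' (Set.Icc y x))
    (hc : ∀ t ∈ Set.Icc y x, |W' t| ≤ c / t) :
    ‖∑ i ∈ A, a i * (W (N i) : ℂ)‖ ≤ |W x| * ‖∑ i ∈ A, a i‖ +
      c * ∫ t in Set.Ioc y x, ‖∑ i ∈ A with N i < t, a i‖ / t := by
  have hterm : ∀ i ∈ A, a i * (W (N i) : ℂ) = a i * (W x : ℂ) -
      ∫ t in Set.Ioc y x, (Set.Ioi (N i)).indicator (fun t => a i * (W' t : ℂ)) t := by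
    intro i hi
    obtain ⟨h1, h2⟩ := hN i hi
    have hsub : Set.Icc (N i) x ⊆ Set.Icc y x := Set.Icc_subset_Icc_left h1
    have hset : Set.Ioc y x ∩ Set.Ioi (N i) = Set.Ioc (N i) x := by
      ext t
      simp only [Set.mem_inter_iff, Set.mem_Ioc, Set.mem_Ioi]
      constructor
      · rintro ⟨⟨_, h⟩, h'⟩
        exact ⟨h', h⟩
      · rintro ⟨h, h'⟩
        exact ⟨⟨h1.trans_lt h, h'⟩, h⟩
    rw [setIntegral_indicator measurableSet_Ioi, hset, integral_const_mul, integral_complex_ofReal,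
      ← intervalIntegral.integral_of_le h2.le,
      intervalIntegral.integral_eq_sub_of_hasDerivAt (f := W)]
    · push_cast
      ring
    · intro t ht
      rw [Set.uIcc_of_le h2.le] at ht
      exact hW t (hsub ht)
    · refine ContinuousOn.intervalIntegrable ?_
      rw [Set.uIcc_of_le h2.le]
      exact hW'.mono hsub
  have hint : ∀ g : ℝ → ℂ, ContinuousOn g (Set.Icc y x) →
      ∀ i, IntegrableOn ((Set.Ioi (N i)).indicator g) (Set.Ioc y x) := fun g hg i =>
    ((hg.integrableOn_Icc).mono_set Set.Ioc_subset_Icc_self).indicator measurableSet_Ioi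
  have hcont : ∀ i, ContinuousOn (fun t => a i * (W' t : ℂ)) (Set.Icc y x) := fun i =>
    continuousOn_const.mul (Complex.continuous_ofReal.comp_continuousOn hW')
  have hcont' : ∀ i, ContinuousOn (fun t : ℝ => a i / (t : ℂ)) (Set.Icc y x) := fun i =>
    continuousOn_const.div Complex.continuous_ofReal.continuousOn fun t ht => by
      exact_mod_cast (hy.trans_le ht.1).ne'
  rw [Finset.sum_congr rfl hterm, Finset.sum_sub_distrib, ← Finset.sum_mul,
    ← integral_finsetSum _ fun i _ => hint _ (hcont i) i]
  refine (norm_sub_le _ _).trans (add_le_add ?_ ?_)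
  · rw [norm_mul, Complex.norm_real, Real.norm_eq_abs, mul_comm]
  · refine (norm_integral_le_integral_norm _).trans ?_
    rw [← integral_const_mul]
    refine setIntegral_mono_on ?_ ?_ measurableSet_Ioc fun t ht => ?_
    · exact (integrable_finsetSum _ fun i _ => hint _ (hcont i) i).norm
    · refine Integrable.const_mul ?_ c
      refine (integrable_finsetSum A fun i _ => hint _ (hcont' i) i).norm.congr ?_
      filter_upwards [ae_restrict_mem measurableSet_Ioc] with t ht
      have ht0 : 0 < t := hy.trans ht.1
      simp only [Set.indicator_apply, Set.mem_Ioi]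
      rw [← Finset.sum_filter, ← Finset.sum_div, norm_div, Complex.norm_real, Real.norm_eq_abs,
        abs_of_pos ht0]
    · have ht' : t ∈ Set.Icc y x := Set.Ioc_subset_Icc_self ht
      simp only [Set.indicator_apply, Set.mem_Ioi]
      rw [← Finset.sum_filter, ← Finset.sum_mul, norm_mul, Complex.norm_real, Real.norm_eq_abs]
      calc _ ≤ ‖∑ i ∈ A with N i < t, a i‖ * (c / t) := by
            gcongr
            exact hc t ht'
        _ = _ := by ring

end PartialSummation

section PrimePowers

theorem ΛK_prime_pow {𝔭 : Ideal (𝓞 K)} (h1 : 𝔭.IsPrime) (h2 : 𝔭 ≠ ⊥) {m : ℕ} (hm : 1 ≤ m) :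
    ΛK K (𝔭 ^ m) = Real.log (Ideal.absNorm 𝔭) := by
  have h : ∃ (𝔮 : Ideal (𝓞 K)) (k : ℕ), 𝔮.IsPrime ∧ 𝔮 ≠ ⊥ ∧ 1 ≤ k ∧ 𝔭 ^ m = 𝔮 ^ k :=
    ⟨𝔭, m, h1, h2, hm, rfl⟩
  obtain ⟨k, hp, -, hk, he⟩ := h.choose_spec
  have hle : 𝔭 ≤ h.choose := by
    rw [← hp.pow_le_iff (n := m) (by omega)]
    exact he.le.trans (Ideal.pow_le_self (by omega))
  have hge : h.choose ≤ 𝔭 := by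
    rw [← h1.pow_le_iff (n := k) (by omega)]
    exact he.ge.trans (Ideal.pow_le_self (by omega))
  rw [ΛK, dif_pos h, le_antisymm hge hle]

theorem ΛK_prime {𝔭 : Ideal (𝓞 K)} (h1 : 𝔭.IsPrime) (h2 : 𝔭 ≠ ⊥) :
    ΛK K 𝔭 = Real.log (Ideal.absNorm 𝔭) := by
  simpa using ΛK_prime_pow h1 h2 le_rfl

theorem HeckeChar.norm_le_one {𝔮 : Ideal (𝓞 K)} (χ : HeckeChar K 𝔮) (𝔞 : Ideal (𝓞 K)) :
    ‖χ.toFun 𝔞‖ ≤ 1 := by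
  by_cases h : IsCoprime 𝔞 𝔮
  · exact (χ.norm_one' 𝔞 h).le
  · simp [χ.eq_zero' 𝔞 h]

theorem two_le_absNorm_s17 {𝔭 : Ideal (𝓞 K)} (h1 : 𝔭.IsPrime) (h2 : 𝔭 ≠ ⊥) :
    2 ≤ Ideal.absNorm 𝔭 := by
  have h3 : Ideal.absNorm 𝔭 ≠ 1 := Ideal.absNorm_eq_one_iff.not.mpr h1.ne_top
  have := absNorm_pos_of_ne_bot h2
  omega

/-- The Mertens-type bound with a real parameter. -/
theorem sum_log_absNorm_div_le_log (F : Finset (Ideal (𝓞 K)))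
    (hF : ∀ 𝔭 ∈ F, 𝔭.IsPrime ∧ 𝔭 ≠ ⊥) {t : ℝ} (ht : 1 ≤ t)
    (hFt : ∀ 𝔭 ∈ F, (Ideal.absNorm 𝔭 : ℝ) ≤ t) :
    ∑ 𝔭 ∈ F, Real.log (Ideal.absNorm 𝔭) / Ideal.absNorm 𝔭 ≤
      2 * Real.log t + (Real.log (DK K) + 10 * nK K) := by
  have hn : (1 : ℝ) ≤ nK K := by exact_mod_cast (Module.finrank_pos : 0 < nK K)
  have hD : (1 : ℝ) ≤ DK K := by
    exact_mod_cast Int.natAbs_pos.mpr (NumberField.discr_ne_zero K)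
  refine (sum_log_absNorm_div_le F hF ⌈2 * t⌉₊ fun 𝔭 h𝔭 => ?_).trans ?_
  · have := (mul_le_mul_of_nonneg_left (hFt 𝔭 h𝔭) zero_le_two).trans (Nat.le_ceil (2 * t))
    exact_mod_cast this
  · have h1 : (⌈2 * t⌉₊ : ℝ) + 1 ≤ 4 * t := by
      have := Nat.ceil_lt_add_one (a := 2 * t) (by linarith)
      linarith
    have h2 : Real.log (2 ^ nK K * ((⌈2 * t⌉₊ + 1) * √(DK K))) ≤
        Real.log (2 ^ nK K * ((4 * t) * √(DK K))) := by
      apply Real.log_le_log (by positivity)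
      gcongr
    have h3 : Real.log (2 ^ nK K * ((4 * t) * √(DK K))) =
        nK K * Real.log 2 + (2 * Real.log 2 + Real.log t + Real.log (DK K) / 2) := by
      have h4 : (4 : ℝ) = 2 ^ 2 := by norm_num
      have hs : √(DK K : ℝ) ≠ 0 := by positivity
      rw [Real.log_mul (by positivity) (by positivity), Real.log_mul (by positivity) hs,
        Real.log_mul (by norm_num) (by positivity), Real.log_sqrt (by positivity), Real.log_pow,
        h4, Real.log_pow]
      norm_num
    have h5 := Real.log_two_lt_d9
    nlinarith

theorem sum_range_mul_exp_neg_le (J : ℕ) :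
    ∑ j ∈ Finset.range J, (2 * (j : ℝ) + 3) * Real.exp (-j) ≤ 10 := by
  have key : ∑ j ∈ Finset.range J, (2 * (j : ℝ) + 3) * (1 / 2) ^ j =
      10 - (4 * J + 10) * (1 / 2) ^ J := by
    induction J with
    | zero => simp
    | succ J ih =>
      rw [Finset.sum_range_succ, ih]
      push_cast
      ring
  have hle : ∑ j ∈ Finset.range J, (2 * (j : ℝ) + 3) * Real.exp (-j) ≤
      ∑ j ∈ Finset.range J, (2 * (j : ℝ) + 3) * (1 / 2) ^ j := by
    refine Finset.sum_le_sum fun j _ => mul_le_mul_of_nonneg_left ?_ (by positivity)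
    have : Real.exp (-(j : ℝ)) = Real.exp (-1) ^ j := by
      rw [← Real.exp_nat_mul]
      ring_nf
    rw [this]
    gcongr
    exact Real.exp_neg_one_lt_half.le
  have : (0 : ℝ) ≤ (4 * J + 10) * (1 / 2) ^ J := by positivity
  linarith

/-- A Rankin-type bound deduced from a Mertens-type bound. -/
theorem sum_log_absNorm_div_mul_exp_le {ℒ : ℝ} (hℒ : 0 < ℒ)
    (hV : ∀ F : Finset (Ideal (𝓞 K)), (∀ 𝔭 ∈ F, 𝔭.IsPrime ∧ 𝔭 ≠ ⊥) → ∀ t : ℝ, 1 ≤ t →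
      (∀ 𝔭 ∈ F, (Ideal.absNorm 𝔭 : ℝ) ≤ t) →
      ∑ 𝔭 ∈ F, Real.log (Ideal.absNorm 𝔭) / Ideal.absNorm 𝔭 ≤ 2 * Real.log t + ℒ)
    (F : Finset (Ideal (𝓞 K))) (hF : ∀ 𝔭 ∈ F, 𝔭.IsPrime ∧ 𝔭 ≠ ⊥) {s : ℝ} (hs : 1 ≤ s * ℒ) :
    ∑ 𝔭 ∈ F, Real.log (Ideal.absNorm 𝔭) / Ideal.absNorm 𝔭 *
      Real.exp (-(s * Real.log (Ideal.absNorm 𝔭))) ≤ 10 * ℒ := by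
  classical
  have hs0 : 0 < s := pos_of_mul_pos_left (by linarith) hℒ.le
  let j : Ideal (𝓞 K) → ℕ := fun 𝔭 => ⌊Real.log (Ideal.absNorm 𝔭) / ℒ⌋₊
  let J := F.sup j + 1
  have hj : ∀ 𝔭 ∈ F, j 𝔭 ∈ Finset.range J := fun 𝔭 h𝔭 =>
    Finset.mem_range.mpr (Nat.lt_succ_of_le (Finset.le_sup h𝔭))
  rw [← Finset.sum_fiberwise_of_maps_to hj]
  calc _ ≤ ∑ i ∈ Finset.range J, ((2 * (i : ℝ) + 3) * Real.exp (-i)) * ℒ := by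
        refine Finset.sum_le_sum fun i _ => ?_
        have hFi : ∀ 𝔭 ∈ F.filter (fun 𝔭 => j 𝔭 = i), 𝔭.IsPrime ∧ 𝔭 ≠ ⊥ := fun 𝔭 h𝔭 =>
          hF 𝔭 (Finset.mem_filter.mp h𝔭).1
        have hb := hV (F.filter (fun 𝔭 => j 𝔭 = i)) hFi (Real.exp ((i + 1) * ℒ))
          (Real.one_le_exp (by positivity)) fun 𝔭 h𝔭 => by
            have hp := absNorm_pos_of_ne_bot (hFi 𝔭 h𝔭).2
            have h1 := Nat.lt_floor_add_one (Real.log (Ideal.absNorm 𝔭) / ℒ)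
            have h2 : ⌊Real.log (Ideal.absNorm 𝔭) / ℒ⌋₊ = i := (Finset.mem_filter.mp h𝔭).2
            rw [h2, div_lt_iff₀ hℒ] at h1
            exact ((Real.log_le_iff_le_exp (by exact_mod_cast hp)).mp h1.le)
        rw [Real.log_exp] at hb
        calc _ ≤ ∑ 𝔭 ∈ F with j 𝔭 = i,
                Real.log (Ideal.absNorm 𝔭) / Ideal.absNorm 𝔭 * Real.exp (-i) := by
              refine Finset.sum_le_sum fun 𝔭 h𝔭 => mul_le_mul_of_nonneg_left ?_
                (div_nonneg (Real.log_natCast_nonneg _) (Nat.cast_nonneg _))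
              have h0 : 0 ≤ Real.log (Ideal.absNorm 𝔭) := Real.log_natCast_nonneg _
              have h1 := Nat.floor_le (div_nonneg h0 hℒ.le)
              have h2 : ⌊Real.log (Ideal.absNorm 𝔭) / ℒ⌋₊ = i := (Finset.mem_filter.mp h𝔭).2
              rw [h2, le_div_iff₀ hℒ] at h1
              refine Real.exp_le_exp.mpr (neg_le_neg ?_)
              have hi : (0 : ℝ) ≤ i := Nat.cast_nonneg _
              nlinarith [mul_le_mul_of_nonneg_left h1 hs0.le, mul_le_mul_of_nonneg_left hs hi]
          _ ≤ (2 * ((i + 1) * ℒ) + ℒ) * Real.exp (-i) := by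
              rw [← Finset.sum_mul]
              gcongr
          _ = _ := by ring
    _ ≤ 10 * ℒ := by
        rw [← Finset.sum_mul]
        gcongr
        exact sum_range_mul_exp_neg_le J

theorem sum_Icc_two_pow_le {q : ℝ} (h0 : 0 ≤ q) (h1 : q ≤ 2 / 3) (n : ℕ) :
    ∑ m ∈ Finset.Icc 2 n, q ^ m ≤ 3 * q ^ 2 := by
  rcases Nat.lt_or_ge n 2 with h | h
  · rw [Finset.Icc_eq_empty (by omega), Finset.sum_empty]
    positivity
  · have : ∑ m ∈ Finset.Icc 2 n, q ^ m * (1 - q) = q ^ 2 - q ^ (n + 1) := by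
      induction n, h using Nat.le_induction with
      | base =>
        simp
        ring
      | succ n hn ih =>
        rw [Finset.sum_Icc_succ_top (by omega), ih]
        ring
    rw [← Finset.sum_mul] at this
    have h2 : 0 ≤ ∑ m ∈ Finset.Icc 2 n, q ^ m := Finset.sum_nonneg fun m _ => by positivity
    have h3 : 0 ≤ q ^ (n + 1) := by positivity
    nlinarith

theorem exp_neg_mul_log_absNorm_le {𝔭 : Ideal (𝓞 K)} (h1 : 𝔭.IsPrime) (h2 : 𝔭 ≠ ⊥) :
    Real.exp (-(13 / 16 * Real.log (Ideal.absNorm 𝔭))) ≤ 2 / 3 := by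
  have h : Real.log 2 ≤ Real.log (Ideal.absNorm 𝔭) :=
    Real.log_le_log two_pos (by exact_mod_cast two_le_absNorm_s17 h1 h2)
  have h3 := Real.log_two_gt_d9
  have h4 : (1.5 : ℝ) ≤ Real.exp (13 / 16 * Real.log (Ideal.absNorm 𝔭)) := by
    have := Real.add_one_le_exp (13 / 16 * Real.log (Ideal.absNorm 𝔭))
    linarith
  rw [Real.exp_neg]
  exact (inv_anti₀ (by norm_num) h4).trans (by norm_num)

theorem sum_sum_Icc_two_exp_le {ℒ : ℝ} (hℒ : 10 ≤ ℒ)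
    (hV : ∀ F : Finset (Ideal (𝓞 K)), (∀ 𝔭 ∈ F, 𝔭.IsPrime ∧ 𝔭 ≠ ⊥) → ∀ t : ℝ, 1 ≤ t →
      (∀ 𝔭 ∈ F, (Ideal.absNorm 𝔭 : ℝ) ≤ t) →
      ∑ 𝔭 ∈ F, Real.log (Ideal.absNorm 𝔭) / Ideal.absNorm 𝔭 ≤ 2 * Real.log t + ℒ)
    (F : Finset (Ideal (𝓞 K))) (hF : ∀ 𝔭 ∈ F, 𝔭.IsPrime ∧ 𝔭 ≠ ⊥) (n : ℕ) :
    ∑ 𝔭 ∈ F, ∑ m ∈ Finset.Icc 2 n, Real.log (Ideal.absNorm 𝔭) *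
      Real.exp (-(13 / 16 * Real.log (Ideal.absNorm 𝔭))) ^ m ≤ 30 * ℒ := by
  have h := sum_log_absNorm_div_mul_exp_le (by linarith) hV F hF (s := 5 / 8) (by linarith)
  calc _ ≤ ∑ 𝔭 ∈ F, 3 * (Real.log (Ideal.absNorm 𝔭) / Ideal.absNorm 𝔭 *
        Real.exp (-(5 / 8 * Real.log (Ideal.absNorm 𝔭)))) := by
        refine Finset.sum_le_sum fun 𝔭 h𝔭 => ?_
        obtain ⟨h1, h2⟩ := hF 𝔭 h𝔭
        have hN : (0 : ℝ) < Ideal.absNorm 𝔭 := by exact_mod_cast absNorm_pos_of_ne_bot h2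
        rw [← Finset.mul_sum]
        have h3 := sum_Icc_two_pow_le (Real.exp_pos _).le (exp_neg_mul_log_absNorm_le h1 h2) n
        have h4 : Real.exp (-(13 / 16 * Real.log (Ideal.absNorm 𝔭))) ^ 2 =
            (Ideal.absNorm 𝔭 : ℝ)⁻¹ * Real.exp (-(5 / 8 * Real.log (Ideal.absNorm 𝔭))) := by
          conv_rhs => rw [← Real.exp_log (inv_pos.mpr hN), Real.log_inv, ← Real.exp_add]
          rw [← Real.exp_nat_mul]
          congr 1
          push_cast
          ring
        rw [h4] at h3
        calc _ ≤ Real.log (Ideal.absNorm 𝔭) * _ :=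
              mul_le_mul_of_nonneg_left h3 (Real.log_natCast_nonneg _)
          _ = _ := by ring
    _ ≤ _ := by
        rw [← Finset.mul_sum]
        linarith

end PrimePowers

section SmoothedSum

theorem norm_tsum_subtype_le {ι : Type*} {p : ι → Prop} (f : ι → ℂ) (A : Finset ι)
    (hA : ∀ i ∈ A, p i) {B : ℝ} (hB : 0 ≤ B)
    (h : ∀ F : Finset ι, A ⊆ F → (∀ i ∈ F, p i) → ‖∑ i ∈ F, f i‖ ≤ B) :
    ‖∑' i : {i // p i}, f i‖ ≤ B := by
  classical
  by_cases hs : Summable fun i : {i // p i} => f i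
  · refine le_of_tendsto hs.hasSum.norm ?_
    filter_upwards [eventually_ge_atTop (A.subtype p)] with F hF
    have := h (F.map (Function.Embedding.subtype p)) (fun i hi => ?_) fun i hi => ?_
    · rwa [Finset.sum_map] at this
    · exact Finset.mem_map.mpr ⟨⟨i, hA i hi⟩, hF (Finset.mem_subtype.mpr hi), rfl⟩
    · obtain ⟨j, -, rfl⟩ := Finset.mem_map.mp hi
      exact j.2
  · rw [tsum_eq_zero_of_not_summable hs, norm_zero]
    exact hB

theorem ΛK_nonneg (𝔫 : Ideal (𝓞 K)) : 0 ≤ ΛK K 𝔫 := by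
  rw [ΛK]
  split_ifs
  · exact Real.log_natCast_nonneg _
  · exact le_rfl

/-- The summand `χ(𝔫) Λ_K(𝔫) N𝔫^{-1-iτ} r E_k(r log N𝔫)`. -/
def smoothedTerm {𝔮 : Ideal (𝓞 K)} (χ : HeckeChar K 𝔮) (τ r : ℝ) (k : ℕ)
    (𝔫 : Ideal (𝓞 K)) : ℂ :=
  χ.toFun 𝔫 * (ΛK K 𝔫 : ℂ) / (Ideal.absNorm 𝔫 : ℂ) ^ ((1 : ℂ) + Complex.I * (τ : ℂ)) *
    ((r * Efun k (r * Real.log (Ideal.absNorm 𝔫)) : ℝ) : ℂ)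

/-- The summand `χ(𝔭) log N𝔭 / N𝔭^{1+iτ}`. -/
def primeTerm {𝔮 : Ideal (𝓞 K)} (χ : HeckeChar K 𝔮) (τ : ℝ) (𝔭 : Ideal (𝓞 K)) : ℂ :=
  χ.toFun 𝔭 * (Real.log (Ideal.absNorm 𝔭) : ℂ) /
    (Ideal.absNorm 𝔭 : ℂ) ^ ((1 : ℂ) + Complex.I * (τ : ℂ))

variable {𝔮 : Ideal (𝓞 K)} (χ : HeckeChar K 𝔮) (τ : ℝ)

theorem norm_absNorm_cpow {𝔫 : Ideal (𝓞 K)} (h : 𝔫 ≠ ⊥) :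
    ‖(Ideal.absNorm 𝔫 : ℂ) ^ ((1 : ℂ) + Complex.I * (τ : ℂ))‖ = Ideal.absNorm 𝔫 := by
  rw [Complex.norm_natCast_cpow_of_pos (absNorm_pos_of_ne_bot h)]
  simp

theorem norm_primeTerm_le {𝔭 : Ideal (𝓞 K)} (h : 𝔭 ≠ ⊥) :
    ‖primeTerm χ τ 𝔭‖ ≤ Real.log (Ideal.absNorm 𝔭) / Ideal.absNorm 𝔭 := by
  have h0 : (0 : ℝ) ≤ Real.log (Ideal.absNorm 𝔭) := Real.log_natCast_nonneg _
  rw [primeTerm, norm_div, norm_mul, norm_absNorm_cpow τ h, Complex.norm_real,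
    Real.norm_of_nonneg h0]
  gcongr
  exact mul_le_of_le_one_left h0 (χ.norm_le_one 𝔭)

variable {r : ℝ} (hr : 0 < r) {k : ℕ}

include hr in
theorem norm_smoothedTerm_le {𝔫 : Ideal (𝓞 K)} (h : 𝔫 ≠ ⊥) :
    ‖smoothedTerm χ τ r k 𝔫‖ ≤ ΛK K 𝔫 / Ideal.absNorm 𝔫 *
      (r * Efun k (r * Real.log (Ideal.absNorm 𝔫))) := by
  have h0 : 0 ≤ r * Efun k (r * Real.log (Ideal.absNorm 𝔫)) :=
    mul_nonneg hr.le (Efun_nonneg k (mul_nonneg hr.le (Real.log_natCast_nonneg _)))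
  rw [smoothedTerm, norm_mul, norm_div, norm_mul, norm_absNorm_cpow τ h, Complex.norm_real,
    Complex.norm_real, Real.norm_of_nonneg h0, Real.norm_of_nonneg (ΛK_nonneg 𝔫)]
  gcongr
  exact mul_le_of_le_one_left (ΛK_nonneg 𝔫) (χ.norm_le_one 𝔫)

theorem smoothedTerm_prime {𝔭 : Ideal (𝓞 K)} (h1 : 𝔭.IsPrime) (h2 : 𝔭 ≠ ⊥) :
    smoothedTerm χ τ r k 𝔭 = primeTerm χ τ 𝔭 *
      ((r * Efun k (r * Real.log (Ideal.absNorm 𝔭)) : ℝ) : ℂ) := by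
  rw [smoothedTerm, primeTerm, ΛK_prime h1 h2]

include hr in
theorem norm_smoothedTerm_prime_le {P y x : ℝ} (hP1 : 25.0 * P ≤ k) (hP2 : k ≤ 28.8 * P)
    (hx : 0 < x) (hyP : r * Real.log y ≤ 2.3 * P) (hxP : 122 * P ≤ r * Real.log x)
    {𝔭 : Ideal (𝓞 K)} (h1 : 𝔭.IsPrime) (h2 : 𝔭 ≠ ⊥)
    (h : (Ideal.absNorm 𝔭 : ℝ) < y ∨ x ≤ Ideal.absNorm 𝔭) :
    ‖smoothedTerm χ τ r k 𝔭‖ ≤ r * (Real.exp (-16.8 * P) * (2.01 ^ k)⁻¹ * 0.99 ^ k) *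
      (Real.log (Ideal.absNorm 𝔭) / Ideal.absNorm 𝔭 *
        Real.exp (-((0.1 * r) * Real.log (Ideal.absNorm 𝔭)))) := by
  have hN : (0 : ℝ) < Ideal.absNorm 𝔭 := by exact_mod_cast absNorm_pos_of_ne_bot h2
  have h0 : (0 : ℝ) ≤ Real.log (Ideal.absNorm 𝔭) := Real.log_natCast_nonneg _
  have hu := mul_nonneg hr.le h0
  refine (norm_smoothedTerm_le χ τ hr h2).trans ?_
  have hE : Efun k (r * Real.log (Ideal.absNorm 𝔭)) ≤
      Real.exp (-16.8 * P) * (2.01 ^ k)⁻¹ * 0.99 ^ k *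
        Real.exp (-0.1 * (r * Real.log (Ideal.absNorm 𝔭))) := by
    rcases h with h | h
    · refine Efun_le_of_le hu hP1 (le_trans ?_ hyP)
      exact mul_le_mul_of_nonneg_left (Real.log_le_log hN h.le) hr.le
    · refine Efun_le_of_ge hu hP2 (hxP.trans ?_)
      exact mul_le_mul_of_nonneg_left (Real.log_le_log hx h) hr.le
  rw [ΛK_prime h1 h2]
  calc _ ≤ Real.log (Ideal.absNorm 𝔭) / Ideal.absNorm 𝔭 * (r * _) :=
        mul_le_mul_of_nonneg_left (mul_le_mul_of_nonneg_left hE hr.le) (by positivity)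
    _ = _ := by ring_nf

include hr in
theorem norm_smoothedTerm_prime_pow_le {P : ℝ} (hP1 : 25.0 * P ≤ k) (hr' : r ≤ 1 / 16)
    {𝔭 : Ideal (𝓞 K)} (h1 : 𝔭.IsPrime) (h2 : 𝔭 ≠ ⊥) {m : ℕ} (hm : 1 ≤ m) :
    ‖smoothedTerm χ τ r k (𝔭 ^ m)‖ ≤ r * (Real.exp (-16.8 * P) * (2.01 ^ k)⁻¹ * 0.99 ^ k) *
      (Real.log (Ideal.absNorm 𝔭) *
        Real.exp (-(13 / 16 * Real.log (Ideal.absNorm 𝔭))) ^ m) := by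
  have hN : (0 : ℝ) < Ideal.absNorm 𝔭 := by exact_mod_cast absNorm_pos_of_ne_bot h2
  have h0 : (0 : ℝ) ≤ Real.log (Ideal.absNorm 𝔭) := Real.log_natCast_nonneg _
  refine (norm_smoothedTerm_le χ τ hr (pow_ne_zero m h2)).trans ?_
  rw [ΛK_prime_pow h1 h2 hm, map_pow, Nat.cast_pow, Real.log_pow]
  have hu : 0 ≤ r * (m * Real.log (Ideal.absNorm 𝔭)) := by positivity
  have hE := Efun_le_mul_exp hu hP1
  have hexp : Real.exp (3 * (r * (m * Real.log (Ideal.absNorm 𝔭)))) ≤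
      (Ideal.absNorm 𝔭 : ℝ) ^ m * Real.exp (-(13 / 16 * Real.log (Ideal.absNorm 𝔭))) ^ m := by
    rw [← mul_pow]
    nth_rewrite 2 [← Real.exp_log hN]
    rw [← Real.exp_add, ← Real.exp_nat_mul]
    refine Real.exp_le_exp.mpr ?_
    have : 0 ≤ m * Real.log (Ideal.absNorm 𝔭) := by positivity
    nlinarith
  have hE' := hE.trans (mul_le_mul_of_nonneg_left hexp (by positivity))
  calc _ ≤ Real.log (Ideal.absNorm 𝔭) / (Ideal.absNorm 𝔭 : ℝ) ^ m * (r * _) :=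
        mul_le_mul_of_nonneg_left (mul_le_mul_of_nonneg_left hE' hr.le) (by positivity)
    _ = _ := by
      field_simp

variable {ℒ : ℝ} (hℒ : 10 ≤ ℒ)
  (hV : ∀ F : Finset (Ideal (𝓞 K)), (∀ 𝔭 ∈ F, 𝔭.IsPrime ∧ 𝔭 ≠ ⊥) → ∀ t : ℝ, 1 ≤ t →
    (∀ 𝔭 ∈ F, (Ideal.absNorm 𝔭 : ℝ) ≤ t) →
    ∑ 𝔭 ∈ F, Real.log (Ideal.absNorm 𝔭) / Ideal.absNorm 𝔭 ≤ 2 * Real.log t + ℒ)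

include hr hℒ hV in
/-- The contribution of the ideals which are not primes. -/
theorem sum_norm_smoothedTerm_not_prime_le {P : ℝ} (hP1 : 25.0 * P ≤ k) (hr' : r ≤ 1 / 16)
    (F : Finset (Ideal (𝓞 K))) (hF : ∀ 𝔫 ∈ F, ¬ 𝔫.IsPrime) :
    ∑ 𝔫 ∈ F, ‖smoothedTerm χ τ r k 𝔫‖ ≤
      r * (Real.exp (-16.8 * P) * (2.01 ^ k)⁻¹ * 0.99 ^ k) * (30 * ℒ) := by
  classical
  have hex : ∀ 𝔫 : Ideal (𝓞 K), 𝔫 ∈ F ∧ smoothedTerm χ τ r k 𝔫 ≠ 0 →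
      ∃ q : Ideal (𝓞 K) × ℕ, (q.1.IsPrime ∧ q.1 ≠ ⊥) ∧ 2 ≤ q.2 ∧ q.1 ^ q.2 = 𝔫 := by
    rintro 𝔫 ⟨h𝔫, hne⟩
    have hΛ : ΛK K 𝔫 ≠ 0 := fun h => hne (by simp [smoothedTerm, h])
    rw [ΛK] at hΛ
    split_ifs at hΛ with h
    · obtain ⟨𝔭, m, h1, h2, h3, rfl⟩ := h
      refine ⟨(𝔭, m), ⟨h1, h2⟩, ?_, rfl⟩
      rcases Nat.lt_or_ge m 2 with h | h
      · obtain rfl : m = 1 := by omega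
        exact absurd (by simpa using h1) (hF _ h𝔫)
      · exact h
    · exact absurd rfl hΛ
  choose! q hq1 hq2 hq3 using hex
  let F' := F.filter fun 𝔫 => smoothedTerm χ τ r k 𝔫 ≠ 0
  have hF' : ∀ 𝔫 ∈ F', 𝔫 ∈ F ∧ smoothedTerm χ τ r k 𝔫 ≠ 0 := fun 𝔫 h => Finset.mem_filter.mp h
  let PP := F'.image fun 𝔫 => (q 𝔫).1
  let n := F'.sup fun 𝔫 => (q 𝔫).2
  have hPP : ∀ 𝔭 ∈ PP, 𝔭.IsPrime ∧ 𝔭 ≠ ⊥ := by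
    intro 𝔭 h𝔭
    obtain ⟨𝔫, h𝔫, rfl⟩ := Finset.mem_image.mp h𝔭
    exact hq1 𝔫 (hF' 𝔫 h𝔫)
  have hsub : F' ⊆ (PP ×ˢ Finset.Icc 2 n).image fun z => z.1 ^ z.2 := fun 𝔫 h𝔫 =>
    Finset.mem_image.mpr ⟨q 𝔫, Finset.mem_product.mpr ⟨Finset.mem_image_of_mem _ h𝔫,
      Finset.mem_Icc.mpr ⟨hq2 𝔫 (hF' 𝔫 h𝔫), Finset.le_sup (f := fun 𝔫 => (q 𝔫).2) h𝔫⟩⟩,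
      hq3 𝔫 (hF' 𝔫 h𝔫)⟩
  calc _ = ∑ 𝔫 ∈ F', ‖smoothedTerm χ τ r k 𝔫‖ := by
        refine (Finset.sum_subset (Finset.filter_subset _ _) fun 𝔫 h1 h2 => ?_).symm
        by_contra h
        exact h2 (Finset.mem_filter.mpr ⟨h1, fun h' => h (by simp [h'])⟩)
    _ ≤ ∑ 𝔫 ∈ (PP ×ˢ Finset.Icc 2 n).image fun z => z.1 ^ z.2, ‖smoothedTerm χ τ r k 𝔫‖ :=
        Finset.sum_le_sum_of_subset_of_nonneg hsub fun _ _ _ => norm_nonneg _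
    _ ≤ ∑ z ∈ PP ×ˢ Finset.Icc 2 n, ‖smoothedTerm χ τ r k (z.1 ^ z.2)‖ :=
        Finset.sum_image_le_of_nonneg fun _ _ => norm_nonneg _
    _ ≤ ∑ z ∈ PP ×ˢ Finset.Icc 2 n,
        r * (Real.exp (-16.8 * P) * (2.01 ^ k)⁻¹ * 0.99 ^ k) *
          (Real.log (Ideal.absNorm z.1) *
            Real.exp (-(13 / 16 * Real.log (Ideal.absNorm z.1))) ^ z.2) := by
        refine Finset.sum_le_sum fun z hz => ?_
        obtain ⟨hz1, hz2⟩ := Finset.mem_product.mp hz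
        exact norm_smoothedTerm_prime_pow_le χ τ hr hP1 hr' (hPP _ hz1).1 (hPP _ hz1).2
          (one_le_two.trans (Finset.mem_Icc.mp hz2).1)
    _ ≤ _ := by
        rw [← Finset.mul_sum, Finset.sum_product]
        exact mul_le_mul_of_nonneg_left (sum_sum_Icc_two_exp_le hℒ hV PP hPP n) (by positivity)

include hr hℒ hV in
/-- The contribution of all ideals other than the primes with norm in `[y, x)`. -/
theorem sum_norm_smoothedTerm_le {P y x : ℝ} (hP1 : 25.0 * P ≤ k) (hP2 : k ≤ 28.8 * P)
    (hr' : r ≤ 1 / 16) (hrℒ : 10 ≤ r * ℒ)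
    (hx : 0 < x) (hyP : r * Real.log y ≤ 2.3 * P) (hxP : 122 * P ≤ r * Real.log x)
    (F : Finset (Ideal (𝓞 K))) (hF : ∀ 𝔫 ∈ F, 𝔫 ≠ ⊥)
    (hF' : ∀ 𝔫 ∈ F, 𝔫.IsPrime → (Ideal.absNorm 𝔫 : ℝ) < y ∨ x ≤ Ideal.absNorm 𝔫) :
    ∑ 𝔫 ∈ F, ‖smoothedTerm χ τ r k 𝔫‖ ≤
      r * (Real.exp (-16.8 * P) * (2.01 ^ k)⁻¹ * 0.99 ^ k) * (40 * ℒ) := by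
  classical
  have hp : ∀ 𝔭 ∈ F.filter (fun 𝔫 => 𝔫.IsPrime), 𝔭.IsPrime ∧ 𝔭 ≠ ⊥ := fun 𝔭 h =>
    ⟨(Finset.mem_filter.mp h).2, hF 𝔭 (Finset.mem_filter.mp h).1⟩
  have h1 := sum_norm_smoothedTerm_not_prime_le χ τ hr hℒ hV hP1 hr'
    (F.filter fun 𝔫 => ¬ 𝔫.IsPrime) fun 𝔫 h => (Finset.mem_filter.mp h).2
  have h2 := sum_log_absNorm_div_mul_exp_le (by linarith) hV _ hp (s := 0.1 * r) (by linarith)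
  have h3 : ∑ 𝔫 ∈ F with 𝔫.IsPrime, ‖smoothedTerm χ τ r k 𝔫‖ ≤
      r * (Real.exp (-16.8 * P) * (2.01 ^ k)⁻¹ * 0.99 ^ k) * (10 * ℒ) := by
    calc _ ≤ ∑ 𝔭 ∈ F with 𝔭.IsPrime, _ := Finset.sum_le_sum fun 𝔭 h𝔭 =>
          norm_smoothedTerm_prime_le χ τ hr hP1 hP2 hx hyP hxP (hp 𝔭 h𝔭).1 (hp 𝔭 h𝔭).2
            (hF' 𝔭 (Finset.mem_filter.mp h𝔭).1 (hp 𝔭 h𝔭).1)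
      _ ≤ _ := by
          rw [← Finset.mul_sum]
          exact mul_le_mul_of_nonneg_left h2 (by positivity)
  rw [← Finset.sum_filter_add_sum_filter_not F fun 𝔫 => 𝔫.IsPrime]
  linarith

include hr hV in
/-- The contribution of the primes with norm in `[y, x)`. -/
theorem norm_sum_smoothedTerm_prime_le {P y x : ℝ} (hk : k ≠ 0) (hP2 : k ≤ 28.8 * P)
    (hy : 1 ≤ y) (hyx : y < x) (hxP : 122 * P ≤ r * Real.log x)
    (A : Finset (Ideal (𝓞 K))) (hA : ∀ 𝔭 ∈ A, 𝔭.IsPrime ∧ 𝔭 ≠ ⊥)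
    (hAN : ∀ 𝔭 ∈ A, y ≤ (Ideal.absNorm 𝔭 : ℝ) ∧ (Ideal.absNorm 𝔭 : ℝ) < x) :
    ‖∑ 𝔭 ∈ A, smoothedTerm χ τ r k 𝔭‖ ≤
      r * (Real.exp (-16.8 * P) * (2.01 ^ k)⁻¹ * 0.99 ^ k) * (2 * Real.log x + ℒ) +
      r ^ 2 * ∫ t in Set.Ioc y x,
        ‖∑ 𝔭 ∈ A with (Ideal.absNorm 𝔭 : ℝ) < t, primeTerm χ τ 𝔭‖ / t := by
  obtain ⟨m, rfl⟩ := Nat.exists_eq_succ_of_ne_zero hk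
  have hy0 : 0 < y := by linarith
  have hx1 : 1 ≤ x := by linarith
  have hlog : ∀ t ∈ Set.Icc y x, 0 ≤ r * Real.log t := fun t ht =>
    mul_nonneg hr.le (Real.log_nonneg (hy.trans ht.1))
  have hpos : ∀ t ∈ Set.Icc y x, 0 < t := fun t ht => hy0.trans_le ht.1
  have key := norm_sum_mul_le_of_hasDerivAt A (primeTerm χ τ)
    (fun 𝔭 => (Ideal.absNorm 𝔭 : ℝ)) (W := fun t => r * Efun (m + 1) (r * Real.log t))
    (W' := fun t => r * ((Efun m (r * Real.log t) - Efun (m + 1) (r * Real.log t)) *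
      (r * t⁻¹))) (c := r ^ 2) hy0 hAN
    (fun t ht => by
      have h1 := (Real.hasDerivAt_log (hpos t ht).ne').const_mul r
      exact ((hasDerivAt_Efun_succ m _).comp t h1).const_mul r)
    (by
      have h1 : ContinuousOn (fun t : ℝ => r * Real.log t) (Set.Icc y x) :=
        continuousOn_const.mul (Real.continuousOn_log.mono fun t ht => (hpos t ht).ne')
      have h2 : ContinuousOn (fun t : ℝ => r * t⁻¹) (Set.Icc y x) :=
        continuousOn_const.mul (continuousOn_id.inv₀ fun t ht => (hpos t ht).ne')
      exact continuousOn_const.mul ((((continuous_Efun m).comp_continuousOn h1).sub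
        ((continuous_Efun (m + 1)).comp_continuousOn h1)).mul h2))
    (fun t ht => by
      have ht0 := hpos t ht
      have h1 := Efun_nonneg m (hlog t ht)
      have h2 := Efun_nonneg (m + 1) (hlog t ht)
      have h3 := Efun_le_one m (hlog t ht)
      have h4 := Efun_le_one (m + 1) (hlog t ht)
      have h5 : |Efun m (r * Real.log t) - Efun (m + 1) (r * Real.log t)| ≤ 1 :=
        abs_le.mpr ⟨by linarith, by linarith⟩
      rw [abs_mul, abs_mul, abs_of_pos hr, abs_of_pos (by positivity : 0 < r * t⁻¹)]
      calc _ ≤ r * (1 * (r * t⁻¹)) := by gcongr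
        _ = r ^ 2 / t := by ring)
  have hW : |r * Efun (m + 1) (r * Real.log x)| ≤
      r * (Real.exp (-16.8 * P) * (2.01 ^ (m + 1))⁻¹ * 0.99 ^ (m + 1)) := by
    have hu := hlog x ⟨hyx.le, le_rfl⟩
    rw [abs_of_nonneg (mul_nonneg hr.le (Efun_nonneg _ hu))]
    refine mul_le_mul_of_nonneg_left ((Efun_le_of_ge hu hP2 hxP).trans ?_) hr.le
    refine mul_le_of_le_one_right (by positivity) (Real.exp_le_one_iff.mpr ?_)
    linarith
  have hS : ‖∑ 𝔭 ∈ A, primeTerm χ τ 𝔭‖ ≤ 2 * Real.log x + ℒ :=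
    (norm_sum_le _ _).trans ((Finset.sum_le_sum fun 𝔭 h𝔭 =>
      norm_primeTerm_le χ τ (hA 𝔭 h𝔭).2).trans
        (hV A hA x hx1 fun 𝔭 h𝔭 => (hAN 𝔭 h𝔭).2.le))
  rw [Finset.sum_congr rfl fun 𝔭 h𝔭 => smoothedTerm_prime χ τ (hA 𝔭 h𝔭).1 (hA 𝔭 h𝔭).2]
  refine key.trans (add_le_add ?_ le_rfl)
  exact mul_le_mul hW hS (norm_nonneg _) (by positivity)

theorem finite_primes_absNorm_lt (y x : ℝ) :
    {𝔭 : Ideal (𝓞 K) | 𝔭.IsPrime ∧ 𝔭 ≠ ⊥ ∧ y ≤ (Ideal.absNorm 𝔭 : ℝ) ∧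
      (Ideal.absNorm 𝔭 : ℝ) < x}.Finite :=
  (Ideal.finite_setOfPred_absNorm_le ⌊x⌋₊).subset fun _ h => Nat.le_floor h.2.2.2.le

include hr hℒ hV in
theorem norm_tsum_smoothedTerm_le {P y x : ℝ} (hk : k ≠ 0) (hP1 : 25.0 * P ≤ k)
    (hP2 : k ≤ 28.8 * P) (hr' : r ≤ 1 / 16) (hrℒ : 10 ≤ r * ℒ) (hy : 1 ≤ y) (hyx : y < x)
    (hyP : r * Real.log y ≤ 2.3 * P) (hxP : 122 * P ≤ r * Real.log x) :
    ‖∑' 𝔫 : {I : Ideal (𝓞 K) // I ≠ ⊥}, smoothedTerm χ τ r k 𝔫.1‖ ≤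
      r ^ 2 * (∫ t in Set.Ioc y x, ‖∑' 𝔭 : {I : Ideal (𝓞 K) //
          I.IsPrime ∧ I ≠ ⊥ ∧ y ≤ (Ideal.absNorm I : ℝ) ∧ (Ideal.absNorm I : ℝ) < t},
        primeTerm χ τ 𝔭.1‖ / t) +
      r * (Real.exp (-16.8 * P) * (2.01 ^ k)⁻¹ * 0.99 ^ k) * (2 * Real.log x + 41 * ℒ) := by
  classical
  let A := (finite_primes_absNorm_lt (K := K) y x).toFinset
  have hmem : ∀ 𝔭, 𝔭 ∈ A ↔ 𝔭.IsPrime ∧ 𝔭 ≠ ⊥ ∧ y ≤ (Ideal.absNorm 𝔭 : ℝ) ∧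
      (Ideal.absNorm 𝔭 : ℝ) < x := fun 𝔭 => by simp [A]
  have hA := norm_sum_smoothedTerm_prime_le χ τ hr hV hk hP2 hy hyx hxP A
    (fun 𝔭 h => ⟨((hmem 𝔭).mp h).1, ((hmem 𝔭).mp h).2.1⟩) fun 𝔭 h => ((hmem 𝔭).mp h).2.2
  have hint : ∫ t in Set.Ioc y x,
        ‖∑ 𝔭 ∈ A with (Ideal.absNorm 𝔭 : ℝ) < t, primeTerm χ τ 𝔭‖ / t =
      ∫ t in Set.Ioc y x, ‖∑' 𝔭 : {I : Ideal (𝓞 K) //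
          I.IsPrime ∧ I ≠ ⊥ ∧ y ≤ (Ideal.absNorm I : ℝ) ∧ (Ideal.absNorm I : ℝ) < t},
        primeTerm χ τ 𝔭.1‖ / t := by
    refine MeasureTheory.setIntegral_congr_fun measurableSet_Ioc fun t ht => ?_
    rw [← Finset.tsum_subtype]
    congr 2
    refine (Equiv.subtypeEquivRight fun 𝔭 => ?_).tsum_eq fun 𝔭 : {I : Ideal (𝓞 K) //
      I.IsPrime ∧ I ≠ ⊥ ∧ y ≤ (Ideal.absNorm I : ℝ) ∧ (Ideal.absNorm I : ℝ) < t} =>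
        primeTerm χ τ 𝔭.1
    rw [Finset.mem_filter, hmem]
    constructor
    · rintro ⟨⟨h1, h2, h3, -⟩, h4⟩
      exact ⟨h1, h2, h3, h4⟩
    · rintro ⟨h1, h2, h3, h4⟩
      exact ⟨⟨h1, h2, h3, h4.trans_le ht.2⟩, h4⟩
  rw [hint] at hA
  have hlogx : 0 ≤ Real.log x := Real.log_nonneg (hy.trans hyx.le)
  refine norm_tsum_subtype_le (smoothedTerm χ τ r k) A (fun 𝔭 h => ((hmem 𝔭).mp h).2.1) ?_
    fun F hAF hF => ?_
  · have : 0 ≤ ∫ t in Set.Ioc y x, ‖∑' 𝔭 : {I : Ideal (𝓞 K) //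
          I.IsPrime ∧ I ≠ ⊥ ∧ y ≤ (Ideal.absNorm I : ℝ) ∧ (Ideal.absNorm I : ℝ) < t},
        primeTerm χ τ 𝔭.1‖ / t :=
      MeasureTheory.setIntegral_nonneg measurableSet_Ioc fun t ht =>
        div_nonneg (norm_nonneg _) (by linarith [ht.1])
    positivity
  · have hrest := sum_norm_smoothedTerm_le χ τ hr hℒ hV hP1 hP2 hr' hrℒ
      (by linarith) hyP hxP (F \ A) (fun 𝔫 h => hF 𝔫 (Finset.mem_sdiff.mp h).1) fun 𝔫 h hp => by
        by_contra! hc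
        obtain ⟨h1, h2⟩ := Finset.mem_sdiff.mp h
        exact h2 ((hmem 𝔫).mpr ⟨hp, hF 𝔫 h1, hc⟩)
    rw [← Finset.sum_sdiff hAF]
    have := (norm_add_le (∑ 𝔫 ∈ F \ A, smoothedTerm χ τ r k 𝔫)
      (∑ 𝔫 ∈ A, smoothedTerm χ τ r k 𝔫)).trans
        (add_le_add ((norm_sum_le _ _).trans hrest) hA)
    linarith

end SmoothedSum

/-- **Short sum over prime ideals** (Lemma 5.3). In the setting of Section 5 (with `χ(H)=1`
induced by the primitive `χ* (mod 𝔣_χ)`, `R/ℒ ≤ r < r₀ < 1/16`, `|τ| ≤ T`), if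
`25.0 φ r ℒ ≤ k ≤ 28.8 φ r ℒ` then
`|Σ_𝔫 (χ*(𝔫)Λ_K(𝔫)/N𝔫^{1+iτ}) r E_k(r log N𝔫)|
  ≤ r² ∫_y^x |Σ_{y ≤ N𝔭 < u} χ*(𝔭) log N𝔭 / N𝔭^{1+iτ}| du/u + O(e^{-16.8 φ r ℒ}(2.01)^{-k})`
provided `x, y ≥ 1` satisfy `log y ≤ 2.3 φ ℒ` and `122 φ ℒ ≤ log x ≪ ℒ` (the implied
constant of `log x ≪ ℒ` being the parameter `A`). -/
theorem short_prime_sum :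
    ∀ A : ℝ, 0 < A →
    ∃ Θ R₀ C : ℝ, 1 ≤ Θ ∧ 1 ≤ R₀ ∧ 0 < C ∧
      ∀ (K : Type) [Field K] [NumberField K] (𝔮 𝔣 : Ideal (𝓞 K))
        (H : CongClassGroup K 𝔮) (χ : HeckeChar K 𝔮) (χstar : HeckeChar K 𝔣)
        (ε r r₀ τ T x y : ℝ) (k : ℕ),
        CharTrivOn χ H → IsConductor χ 𝔣 → Induces χstar χ → IsPrimitiveChar χstar →
        1 ≤ T → 0 < r₀ → r₀ < 1 / 16 → 0 < ε → ε < 1 / 4 →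
        let ℒ : ℝ := 2 * Real.log (DK K : ℝ) + Real.log (QH H : ℝ) +
          (nK K : ℝ) * Real.log (T + 3) + Θ * (nK K : ℝ);
        let φ : ℝ := 1 + (4 / Real.pi) * ε + 16 * ε ^ 2;
        R₀ / ℒ ≤ r → r < r₀ → |τ| ≤ T →
        25.0 * φ * r * ℒ ≤ (k : ℝ) → (k : ℝ) ≤ 28.8 * φ * r * ℒ →
        1 ≤ y → 1 ≤ x →
        Real.log y ≤ 2.3 * φ * ℒ →
        122 * φ * ℒ ≤ Real.log x → Real.log x ≤ A * ℒ →
        ‖∑' 𝔫 : {I : Ideal (𝓞 K) // I ≠ ⊥},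
            χstar.toFun 𝔫.1 * (ΛK K 𝔫.1 : ℂ) /
              (Ideal.absNorm 𝔫.1 : ℂ) ^ ((1 : ℂ) + Complex.I * (τ : ℂ)) *
              ((r * Efun k (r * Real.log (Ideal.absNorm 𝔫.1)) : ℝ) : ℂ)‖ ≤
          r ^ 2 * (∫ u in Set.Ioc y x,
            ‖∑' 𝔭 : {I : Ideal (𝓞 K) //
                I.IsPrime ∧ I ≠ ⊥ ∧ y ≤ (Ideal.absNorm I : ℝ) ∧ (Ideal.absNorm I : ℝ) < u},
              χstar.toFun 𝔭.1 * (Real.log (Ideal.absNorm 𝔭.1) : ℂ) /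
                (Ideal.absNorm 𝔭.1 : ℂ) ^ ((1 : ℂ) + Complex.I * (τ : ℂ))‖ / u) +
          C * Real.exp (-16.8 * φ * r * ℒ) * (2.01 : ℝ) ^ (-(k : ℝ)) := by
  intro A hA
  refine ⟨10, 10, 4 * (41 + 2 * A), by norm_num, by norm_num, by positivity, ?_⟩
  intro K _ _ 𝔮 𝔣 H χ χstar ε r r₀ τ T x y k _ _ _ _ hT _ hr₀ hε _ ℒ φ hR hrr _ hk1 hk2 hy hx
    hlogy hlogx hlogA
  have hn : (1 : ℝ) ≤ nK K := by exact_mod_cast (Module.finrank_pos : 0 < nK K)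
  have hD : 0 ≤ Real.log (DK K) := Real.log_natCast_nonneg _
  have hℒ' : Real.log (DK K) + 10 * nK K ≤ ℒ := by
    have h1 : 0 ≤ Real.log (QH H : ℝ) := Real.log_natCast_nonneg _
    have h2 : 0 ≤ (nK K : ℝ) * Real.log (T + 3) :=
      mul_nonneg (Nat.cast_nonneg _) (Real.log_nonneg (by linarith))
    linarith
  have hℒ : 10 ≤ ℒ := by linarith
  have hφ : 1 ≤ φ := by
    have : 0 ≤ (4 / Real.pi) * ε + 16 * ε ^ 2 := by positivity
    linarith
  have hrℒ : 10 ≤ r * ℒ := (div_le_iff₀ (by linarith)).mp hR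
  have hr : 0 < r := pos_of_mul_pos_left (by linarith) (by linarith : 0 ≤ ℒ)
  have hV : ∀ F : Finset (Ideal (𝓞 K)), (∀ 𝔭 ∈ F, 𝔭.IsPrime ∧ 𝔭 ≠ ⊥) → ∀ t : ℝ, 1 ≤ t →
      (∀ 𝔭 ∈ F, (Ideal.absNorm 𝔭 : ℝ) ≤ t) →
      ∑ 𝔭 ∈ F, Real.log (Ideal.absNorm 𝔭) / Ideal.absNorm 𝔭 ≤ 2 * Real.log t + ℒ :=
    fun F hF t ht hFt => (sum_log_absNorm_div_le_log F hF ht hFt).trans (by linarith)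
  have hP : r * ℒ ≤ φ * r * ℒ := by nlinarith
  have hP1 : 25.0 * (φ * r * ℒ) ≤ k := by linarith
  have hP2 : k ≤ 28.8 * (φ * r * ℒ) := by linarith
  have hk : 25 * (r * ℒ) ≤ k := by linarith
  have hk0 : k ≠ 0 := by
    rintro rfl
    norm_num at hk
    linarith
  have hyx : y < x := by
    refine (Real.log_lt_log_iff (by linarith) (by linarith)).mp ?_
    have : 0 < φ * ℒ := by positivity
    linarith
  have hyP : r * Real.log y ≤ 2.3 * (φ * r * ℒ) := by
    linarith [mul_le_mul_of_nonneg_left hlogy hr.le]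
  have hxP : 122 * (φ * r * ℒ) ≤ r * Real.log x := by
    linarith [mul_le_mul_of_nonneg_left hlogx hr.le]
  refine (norm_tsum_smoothedTerm_le χstar τ hr hℒ hV hk0 hP1 hP2 (by linarith) hrℒ hy hyx
    hyP hxP).trans (add_le_add le_rfl ?_)
  have hsmall : r * ℒ * 0.99 ^ k ≤ 4 := by
    have h1 := natCast_mul_pow_le k
    have h2 := mul_le_mul_of_nonneg_right hk (by positivity : (0 : ℝ) ≤ 0.99 ^ k)
    linarith
  have he : -16.8 * φ * r * ℒ = -16.8 * (φ * r * ℒ) := by ring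
  rw [Real.rpow_neg (by norm_num), Real.rpow_natCast, he]
  calc _ ≤ r * (Real.exp (-16.8 * (φ * r * ℒ)) * (2.01 ^ k)⁻¹ * 0.99 ^ k) *
        (2 * (A * ℒ) + 41 * ℒ) := by gcongr
    _ = (41 + 2 * A) * (Real.exp (-16.8 * (φ * r * ℒ)) * (2.01 ^ k)⁻¹) *
        (r * ℒ * 0.99 ^ k) := by ring
    _ ≤ (41 + 2 * A) * (Real.exp (-16.8 * (φ * r * ℒ)) * (2.01 ^ k)⁻¹) * 4 := by gcongr
    _ = _ := by ring

end RTZ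
end
end
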